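/- arXiv:1401.7182 — 7 statements merged into one kernel-verified Lean document; each statement's English description precedes it below -/
import Mathlib

section
/- Let Ω ⊂ ℝ^N be an open set, 1 < q < 2, and let u ∈ C²(Ω) satisfy −Δu(x) = |u(x)|^{q−2}u(x) for every x ∈ Ω. Suppose x₀ ∈ Ω is a point of density one for the zero set u⁻¹(0) = {x ∈ Ω : u(x) = 0}. Then u(x)/|x−x₀|^{2/(2−q)} → 0 as x → x₀ (x ≠ x₀). -/
open MeasureTheory Set Filter

/-- The Laplacian of `u : ℝ^N → ℝ`, i.e. the sum of the pure second partial derivatives. -/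
noncomputable def laplacian {N : ℕ} (u : EuclideanSpace ℝ (Fin N) → ℝ)
    (x : EuclideanSpace ℝ (Fin N)) : ℝ :=
  ∑ i : Fin N,
    fderiv ℝ (fun y => fderiv ℝ u y (EuclideanSpace.single i 1)) x (EuclideanSpace.single i 1)

/-- The weight `(1 - ‖z‖²)₊`, supported in the closed unit ball. -/
noncomputable def parabolaWeight {E : Type*} [Norm E] (z : E) : ℝ :=
  max (1 - ‖z‖ ^ 2) 0

lemma hasDerivAt_max_zero_sq (x : ℝ) :
    HasDerivAt (fun t : ℝ => max t 0 ^ 2) (2 * max x 0) x := by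
  rcases lt_trichotomy x 0 with hx | rfl | hx
  · rw [max_eq_right hx.le, mul_zero]
    refine (hasDerivAt_const x (0 : ℝ)).congr_of_eventuallyEq ?_
    filter_upwards [eventually_lt_nhds hx] with t ht
    simp [max_eq_right ht.le]
  · rw [hasDerivAt_iff_isLittleO]
    simp only [max_self, mul_zero, smul_zero, sub_zero, ne_eq, OfNat.ofNat_ne_zero,
      not_false_eq_true, zero_pow]
    refine Asymptotics.IsBigO.trans_isLittleO (g := fun t : ℝ => t ^ 2) ?_
      (Asymptotics.isLittleO_pow_id one_lt_two)
    refine Asymptotics.IsBigO.of_bound 1 (Eventually.of_forall fun t => ?_)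
    rw [one_mul, norm_pow, norm_pow]
    gcongr
    rw [Real.norm_eq_abs, Real.norm_eq_abs, abs_of_nonneg (le_max_right _ _)]
    exact max_le (le_abs_self t) (abs_nonneg t)
  · rw [max_eq_left hx.le]
    have h : HasDerivAt (fun t : ℝ => t ^ 2) (2 * x) x := by
      simpa using hasDerivAt_pow 2 x
    refine h.congr_of_eventuallyEq ?_
    filter_upwards [eventually_gt_nhds hx] with t ht
    simp [max_eq_left ht.le]

section Weight

variable {E : Type*} [NormedAddCommGroup E]

lemma parabolaWeight_nonneg (z : E) : 0 ≤ parabolaWeight z := le_max_right _ _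

lemma parabolaWeight_le_one (z : E) : parabolaWeight z ≤ 1 :=
  max_le (by nlinarith [sq_nonneg ‖z‖]) zero_le_one

lemma parabolaWeight_eq_zero {z : E} (hz : z ∉ Metric.ball (0 : E) 1) :
    parabolaWeight z = 0 := by
  rw [mem_ball_zero_iff, not_lt] at hz
  exact max_eq_right (by nlinarith)

lemma continuous_parabolaWeight : Continuous (parabolaWeight : E → ℝ) := by
  unfold parabolaWeight; fun_prop

lemma hasCompactSupport_parabolaWeight [ProperSpace E] :
    HasCompactSupport (parabolaWeight : E → ℝ) :=
  HasCompactSupport.intro (isCompact_closedBall (0 : E) 1) fun _ hz =>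
    parabolaWeight_eq_zero fun h => hz (Metric.ball_subset_closedBall h)

lemma integral_parabolaWeight_pos [ProperSpace E] [MeasurableSpace E] [BorelSpace E]
    (μ : Measure E) [IsFiniteMeasureOnCompacts μ] [μ.IsOpenPosMeasure] :
    0 < ∫ z, parabolaWeight z ∂μ :=
  continuous_parabolaWeight.integral_pos_of_hasCompactSupport_nonneg_nonzero
    hasCompactSupport_parabolaWeight parabolaWeight_nonneg (x := 0) (by simp [parabolaWeight])

lemma hasFDerivAt_parabolaWeight_sq [InnerProductSpace ℝ E] (z : E) :
    HasFDerivAt (fun z : E => parabolaWeight z ^ 2)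
      ((-4 * parabolaWeight z) • innerSL ℝ z) z := by
  have h := (hasDerivAt_max_zero_sq (1 - ‖z‖ ^ 2)).comp_hasFDerivAt z
    ((hasStrictFDerivAt_norm_sq z).hasFDerivAt.const_sub 1)
  convert! h using 1
  ext y
  simp [parabolaWeight]
  ring

end Weight

section Laplacian

variable {N : ℕ}

local notation "𝔼" => EuclideanSpace ℝ (Fin N)

lemma continuous_laplacian {v : 𝔼 → ℝ} (hv : ContDiff ℝ 2 v) : Continuous (laplacian v) := by
  unfold laplacian
  refine continuous_finsetSum _ fun i _ => ?_
  have h : ContDiff ℝ 1 (fun y => fderiv ℝ v y (EuclideanSpace.single i 1)) :=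
    (hv.fderiv_right (m := 1) (by norm_num)).clm_apply contDiff_const
  exact (h.continuous_fderiv one_ne_zero).clm_apply continuous_const

/-- Green's identity against the weight: radial derivatives of `v` become Laplacians. -/
lemma integral_parabolaWeight_mul_fderiv {v : 𝔼 → ℝ} (hv : ContDiff ℝ 2 v) (y : 𝔼) (t : ℝ) :
    ∫ z, parabolaWeight z * fderiv ℝ v (y + t • z) z =
      t / 4 * ∫ z, parabolaWeight z ^ 2 * laplacian v (y + t • z) := by
  have hw := continuous_parabolaWeight (E := 𝔼)
  have hws := hasCompactSupport_parabolaWeight (E := 𝔼)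
  have haff : Continuous fun z : 𝔼 => y + t • z := by fun_prop
  have hint : ∀ g : 𝔼 → ℝ, Continuous g → Integrable fun z => parabolaWeight z * g z :=
    fun g hg => (hw.mul hg).integrable_of_hasCompactSupport hws.mul_right
  have hC (i : Fin N) : ContDiff ℝ 1 (fun y => fderiv ℝ v y (EuclideanSpace.single i 1)) :=
    (hv.fderiv_right (m := 1) (by norm_num)).clm_apply contDiff_const
  have hD (i : Fin N) : Continuous fun x =>
      fderiv ℝ (fun y => fderiv ℝ v y (EuclideanSpace.single i 1)) x
        (EuclideanSpace.single i 1) :=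
    ((hC i).continuous_fderiv one_ne_zero).clm_apply continuous_const
  have hc (i : Fin N) : Continuous fun z : 𝔼 => z i := by fun_prop
  have key (i : Fin N) :
      ∫ z : 𝔼, parabolaWeight z ^ 2 *
          (t * fderiv ℝ (fun y => fderiv ℝ v y (EuclideanSpace.single i 1)) (y + t • z)
            (EuclideanSpace.single i 1)) =
        - ∫ z : 𝔼, (-4 * parabolaWeight z * z i) *
            fderiv ℝ v (y + t • z) (EuclideanSpace.single i 1) := by
    refine integral_bilinear_hasFDerivAt_right_eq_neg_left_of_integrable
      (B := ContinuousLinearMap.mul ℝ ℝ) (v := EuclideanSpace.single i 1)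
      (f := fun z : 𝔼 => parabolaWeight z ^ 2)
      (f' := fun z => (-4 * parabolaWeight z) • innerSL ℝ z)
      (g := fun z => fderiv ℝ v (y + t • z) (EuclideanSpace.single i 1))
      (g' := fun z => t • fderiv ℝ (fun y => fderiv ℝ v y (EuclideanSpace.single i 1)) (y + t • z))
      ?_ ?_ ?_ ?_ ?_ |>.trans ?_
    · refine (hint _ (((hc i).mul ((hC i).continuous.comp haff)).const_smul (-4 : ℝ))).congr
        (Eventually.of_forall fun z => ?_)
      simp [EuclideanSpace.inner_single_right]
      ring
    · refine (hint _ ((hw.mul ((hD i).comp haff)).const_smul t)).congr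
        (Eventually.of_forall fun z => ?_)
      simp
      ring
    · refine (hint _ (hw.mul ((hC i).continuous.comp haff))).congr
        (Eventually.of_forall fun z => ?_)
      simp
      ring
    · exact fun z _ => hasFDerivAt_parabolaWeight_sq z
    · intro z _
      have h := (((hC i).differentiable one_ne_zero) (y + t • z)).hasFDerivAt.comp z
        (((hasFDerivAt_id z).const_smul t).const_add y)
      convert! h using 1
      ext x
      simp
    · simp [EuclideanSpace.inner_single_right]
  have hsum (z : 𝔼) : parabolaWeight z * fderiv ℝ v (y + t • z) z =
      ∑ i, parabolaWeight z * (z i * fderiv ℝ v (y + t • z) (EuclideanSpace.single i 1)) := by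
    generalize fderiv ℝ v (y + t • z) = L
    have h : L z = ∑ i, z i * L (EuclideanSpace.single i 1) := by
      conv_lhs => rw [← (EuclideanSpace.basisFun (Fin N) ℝ).sum_repr z]
      simp [map_sum]
    rw [← Finset.mul_sum, h]
  simp_rw [hsum]
  rw [integral_finsetSum _ fun i _ => hint (fun z => z i * fderiv ℝ v (y + t • z) (EuclideanSpace.single i 1))
    ((hc i).mul ((hC i).continuous.comp haff))]
  unfold laplacian
  simp_rw [Finset.mul_sum]
  rw [integral_finsetSum, Finset.mul_sum]
  · refine Finset.sum_congr rfl fun i _ => ?_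
    have h := key i
    simp_rw [mul_left_comm _ t, mul_assoc, integral_const_mul] at h
    linarith
  · intro i _
    simp_rw [pow_two, mul_assoc]
    exact hint _ (hw.mul ((hD i).comp haff))

/-- Approximate mean value inequality, with the error controlled by the Laplacian. -/
lemma abs_mul_integral_parabolaWeight_le {v : 𝔼 → ℝ} (hv : ContDiff ℝ 2 v)
    (hvs : HasCompactSupport v) (y : 𝔼) {s K : ℝ} (hs : 0 < s)
    (hK : ∀ x ∈ Metric.ball y s, |laplacian v x| ≤ K) :
    |v y| * ∫ z : 𝔼, parabolaWeight z ≤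
      (∫ z, parabolaWeight z * |v (y + s • z)|) + s ^ 2 * K * ∫ z : 𝔼, parabolaWeight z := by
  have hw := continuous_parabolaWeight (E := 𝔼)
  have hws := hasCompactSupport_parabolaWeight (E := 𝔼)
  have hwi := hw.integrable_of_hasCompactSupport (μ := volume) hws
  have hint : ∀ g : 𝔼 → ℝ, Continuous g → Integrable fun z => parabolaWeight z * g z :=
    fun g hg => (hw.mul hg).integrable_of_hasCompactSupport hws.mul_right
  have haff (t : ℝ) : Continuous fun z : 𝔼 => y + t • z := by fun_prop
  have hfd : Continuous (fderiv ℝ v) := hv.continuous_fderiv two_ne_zero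
  obtain ⟨B, hB⟩ := hfd.bounded_above_of_compact_support (hvs.fderiv ℝ)
  have hK0 : 0 ≤ K := (abs_nonneg _).trans (hK y (Metric.mem_ball_self hs))
  have hderiv (t : ℝ) : HasDerivAt (fun t => ∫ z, parabolaWeight z * v (y + t • z))
      (∫ z, parabolaWeight z * fderiv ℝ v (y + t • z) z) t := by
    refine (hasDerivAt_integral_of_dominated_loc_of_deriv_le
      (F := fun t z => parabolaWeight z * v (y + t • z))
      (F' := fun t z => parabolaWeight z * fderiv ℝ v (y + t • z) z)
      (bound := fun z => parabolaWeight z * (B * ‖z‖)) (s := univ) univ_mem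
      (Eventually.of_forall fun t => (hint _ (hv.continuous.comp (haff t))).aestronglyMeasurable)
      (hint _ (hv.continuous.comp (haff t)))
      (hint _ ((hfd.comp (haff t)).clm_apply continuous_id)).aestronglyMeasurable
      (Eventually.of_forall fun z t _ => ?_)
      (hint _ (continuous_norm.const_smul B)) (Eventually.of_forall fun z t _ => ?_)).2
    · rw [norm_mul, Real.norm_of_nonneg (parabolaWeight_nonneg z)]
      exact mul_le_mul_of_nonneg_left ((fderiv ℝ v (y + t • z)).le_of_opNorm_le (hB _) z)
        (parabolaWeight_nonneg z)
    · have h1 : HasDerivAt (fun t : ℝ => y + t • z) z t := by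
        simpa using ((hasDerivAt_id t).smul_const z).const_add y
      exact ((hv.differentiable two_ne_zero _).hasFDerivAt.comp_hasDerivAt t h1).const_mul _
  have hbound (t : ℝ) (ht : t ∈ Icc 0 s) :
      ‖∫ z, parabolaWeight z * fderiv ℝ v (y + t • z) z‖ ≤
        s * K * ∫ z : 𝔼, parabolaWeight z := by
    rw [integral_parabolaWeight_mul_fderiv hv]
    have h1 : ‖∫ z, parabolaWeight z ^ 2 * laplacian v (y + t • z)‖ ≤
        ∫ z : 𝔼, parabolaWeight z * K := by
      refine norm_integral_le_of_norm_le (hwi.mul_const K) (Eventually.of_forall fun z => ?_)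
      have h0 := parabolaWeight_nonneg z
      have h1 := parabolaWeight_le_one z
      by_cases hz : z ∈ Metric.ball (0 : 𝔼) 1
      · have hmem : y + t • z ∈ Metric.ball y s := by
          rw [mem_ball_zero_iff] at hz
          rw [mem_ball_iff_norm, add_sub_cancel_left, norm_smul, Real.norm_of_nonneg ht.1]
          nlinarith [ht.1, ht.2, norm_nonneg z]
        rw [norm_mul, norm_pow, Real.norm_of_nonneg h0, Real.norm_eq_abs]
        exact mul_le_mul (by nlinarith) (hK _ hmem) (abs_nonneg _) h0
      · simp [parabolaWeight_eq_zero hz]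
    rw [integral_mul_const] at h1
    have h2 : 0 ≤ (∫ z : 𝔼, parabolaWeight z) * K :=
      mul_nonneg (integral_nonneg parabolaWeight_nonneg) hK0
    rw [norm_mul, Real.norm_of_nonneg (by linarith [ht.1])]
    calc _ ≤ s * ((∫ z : 𝔼, parabolaWeight z) * K) :=
          mul_le_mul (by linarith [ht.1, ht.2]) h1 (norm_nonneg _) hs.le
      _ = _ := by ring
  have hmv := norm_image_sub_le_of_norm_deriv_le_segment'
    (fun t _ => (hderiv t).hasDerivWithinAt) (fun t ht => hbound t (Ico_subset_Icc_self ht))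
    s (right_mem_Icc.2 hs.le)
  have h0 : ∫ z : 𝔼, parabolaWeight z * v (y + (0 : ℝ) • z) =
      v y * ∫ z : 𝔼, parabolaWeight z := by
    simp [mul_comm, integral_const_mul]
  have hs' : ‖∫ z, parabolaWeight z * v (y + s • z)‖ ≤
      ∫ z, parabolaWeight z * |v (y + s • z)| := by
    refine norm_integral_le_of_norm_le (hint _ (hv.continuous.comp (haff s)).abs)
      (Eventually.of_forall fun z => ?_)
    rw [norm_mul, Real.norm_of_nonneg (parabolaWeight_nonneg z), Real.norm_eq_abs]
  rw [h0] at hmv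
  have hv0 : ‖v y * ∫ z : 𝔼, parabolaWeight z‖ = |v y| * ∫ z : 𝔼, parabolaWeight z := by
    rw [norm_mul, Real.norm_eq_abs, Real.norm_of_nonneg (integral_nonneg parabolaWeight_nonneg)]
  have htri := norm_sub_norm_le (v y * ∫ z : 𝔼, parabolaWeight z)
    (∫ z, parabolaWeight z * v (y + s • z))
  rw [norm_sub_rev] at htri
  nlinarith

/-- On small balls `|v|` is controlled by the measure of `{v ≠ 0}` and by the Laplacian. -/
lemma exists_abs_le_measure_support_add_laplacian (N : ℕ) :
    ∃ C : ℝ, 0 < C ∧ ∀ v : EuclideanSpace ℝ (Fin N) → ℝ, ContDiff ℝ 2 v → HasCompactSupport v →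
      ∀ (y : EuclideanSpace ℝ (Fin N)) (s M K : ℝ), 0 < s →
        (∀ x ∈ Metric.ball y s, |v x| ≤ M) → (∀ x ∈ Metric.ball y s, |laplacian v x| ≤ K) →
        |v y| ≤ C * (M * (volume.real (Metric.ball y s ∩ {x | v x ≠ 0}) / s ^ N) + K * s ^ 2) := by
  have hI : 0 < ∫ z : EuclideanSpace ℝ (Fin N), parabolaWeight z :=
    integral_parabolaWeight_pos volume
  refine ⟨1 + (∫ z : EuclideanSpace ℝ (Fin N), parabolaWeight z)⁻¹, by positivity,
    fun v hv hvs y s M K hs hM hK => ?_⟩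
  have hM0 : 0 ≤ M := (abs_nonneg _).trans (hM y (Metric.mem_ball_self hs))
  have hK0 : 0 ≤ K := (abs_nonneg _).trans (hK y (Metric.mem_ball_self hs))
  set S := Metric.ball y s ∩ {x | v x ≠ 0} with hS
  have hSo : IsOpen S := Metric.isOpen_ball.inter (isOpen_ne_fun hv.continuous continuous_const)
  have hSfin : volume S ≠ ⊤ := ((measure_mono inter_subset_left).trans_lt measure_ball_lt_top).ne
  set T := (fun z : EuclideanSpace ℝ (Fin N) => y + s • z) ⁻¹' S with hT
  have hTm : MeasurableSet T := (hSo.preimage (by fun_prop)).measurableSet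
  have hTvol : volume T = ENNReal.ofReal |(s ^ N)⁻¹| * volume S := by
    have : T = (fun z => s • z) ⁻¹' ((fun x => y + x) ⁻¹' S) := rfl
    rw [this, Measure.addHaar_preimage_smul _ hs.ne', measure_preimage_add,
      finrank_euclideanSpace_fin]
  have hTreal : volume.real T = volume.real S / s ^ N := by
    rw [measureReal_def, hTvol, ENNReal.toReal_mul, ENNReal.toReal_ofReal (abs_nonneg _),
      abs_of_nonneg (by positivity), measureReal_def]
    ring
  have hTfin : volume T ≠ ⊤ := by
    rw [hTvol]; exact ENNReal.mul_ne_top ENNReal.ofReal_ne_top hSfin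
  have hle : ∫ z, parabolaWeight z * |v (y + s • z)| ≤ M * volume.real T := by
    have h1 : ‖∫ z, parabolaWeight z * |v (y + s • z)|‖ ≤ ∫ z, T.indicator (fun _ => M) z := by
      refine norm_integral_le_of_norm_le ((integrable_indicator_iff hTm).2
        (integrableOn_const hTfin)) (Eventually.of_forall fun z => ?_)
      rw [norm_mul, Real.norm_of_nonneg (parabolaWeight_nonneg z), Real.norm_eq_abs, abs_abs]
      by_cases hz : z ∈ Metric.ball (0 : EuclideanSpace ℝ (Fin N)) 1
      · have hmem : y + s • z ∈ Metric.ball y s := by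
          rw [mem_ball_zero_iff] at hz
          rw [mem_ball_iff_norm, add_sub_cancel_left, norm_smul, Real.norm_of_nonneg hs.le]
          nlinarith
        by_cases h0 : v (y + s • z) = 0
        · simp only [h0, abs_zero, mul_zero]
          exact indicator_nonneg (fun _ _ => hM0) z
        · rw [indicator_of_mem (show z ∈ T from ⟨hmem, h0⟩)]
          exact (mul_le_of_le_one_left (abs_nonneg _) (parabolaWeight_le_one z)).trans (hM _ hmem)
      · rw [parabolaWeight_eq_zero hz, zero_mul]
        exact indicator_nonneg (fun _ _ => hM0) z
    rw [integral_indicator_const _ hTm, smul_eq_mul, mul_comm] at h1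
    exact (le_abs_self _).trans h1
  have hmain := abs_mul_integral_parabolaWeight_le hv hvs y hs hK
  rw [← hTreal]
  set I := ∫ z : EuclideanSpace ℝ (Fin N), parabolaWeight z
  have hT0 : 0 ≤ volume.real T := measureReal_nonneg
  have h2 : |v y| ≤ M * volume.real T * I⁻¹ + s ^ 2 * K := by
    rw [← mul_le_mul_iff_left₀ hI]
    have : (M * volume.real T * I⁻¹ + s ^ 2 * K) * I = M * volume.real T + s ^ 2 * K * I := by
      field_simp
    linarith
  have h3 : 0 ≤ M * volume.real T := mul_nonneg hM0 hT0
  have h4 : 0 ≤ K * s ^ 2 * I⁻¹ := by positivity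
  nlinarith

/-- Decay is improved by a factor two when the radius is halved: the growth constant `b` of `v`
relative to the critical power `r ^ (2 / (1 - p))` becomes `b / 2`, as long as `b ≥ τ`. -/
lemma exists_radius_growth_halving {v : 𝔼 → ℝ} (hv : ContDiff ℝ 2 v) (hvs : HasCompactSupport v)
    {x₀ : 𝔼} {p R : ℝ} (hp0 : 0 < p) (hp1 : p < 1) (hR : 0 < R)
    (hlap : ∀ x ∈ Metric.ball x₀ R, |laplacian v x| ≤ |v x| ^ p)
    (hdens : ∀ δ > 0, ∃ r₁ > 0, ∀ r, 0 < r → r < r₁ →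
      volume.real (Metric.ball x₀ r ∩ {x | v x ≠ 0}) ≤ δ * r ^ N)
    {τ : ℝ} (hτ : 0 < τ) :
    ∃ r₀ > 0, ∀ r, 0 < r → r ≤ r₀ → ∀ b, τ ≤ b →
      (∀ x ∈ Metric.ball x₀ r, |v x| ≤ b * r ^ (2 / (1 - p))) →
      ∀ x ∈ Metric.ball x₀ (r / 2), |v x| ≤ b / 2 * (r / 2) ^ (2 / (1 - p)) := by
  obtain ⟨C, hC, hCv⟩ := exists_abs_le_measure_support_add_laplacian N
  set γ := 2 / (1 - p) with hγ
  have hγp : γ * p + 2 = γ := by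
    have : 1 - p ≠ 0 := by linarith
    rw [hγ]; field_simp; ring
  obtain ⟨D, hD0, hD⟩ : ∃ D > 0, C * D = 1 / (2 * 2 ^ γ) :=
    ⟨1 / (2 * 2 ^ γ) / C, by positivity, by field_simp⟩
  have hτp : 0 < τ ^ (p - 1) := Real.rpow_pos_of_pos hτ _
  obtain ⟨η, hη0, hη1, hη⟩ : ∃ η > 0, η ≤ 1 / 2 ∧ τ ^ (p - 1) * η ^ 2 ≤ D / 2 := by
    refine ⟨min (1 / 2) (D / 2 / τ ^ (p - 1)), by positivity, min_le_left _ _, ?_⟩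
    set η := min (1 / 2) (D / 2 / τ ^ (p - 1))
    have h0 : 0 < η := by positivity
    have h1 : η ≤ 1 / 2 := min_le_left _ _
    have h2 : η ≤ D / 2 / τ ^ (p - 1) := min_le_right _ _
    rw [le_div_iff₀ hτp] at h2
    nlinarith
  obtain ⟨r₁, hr₁, hvol⟩ := hdens (η ^ N * (D / 2)) (by positivity)
  refine ⟨min R (r₁ / 2), by positivity, fun r hr hrle b hb hbound y hy => ?_⟩
  have hrR : r ≤ R := hrle.trans (min_le_left _ _)
  have hrr₁ : r < r₁ := by linarith [hrle.trans (min_le_right _ _)]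
  have hb0 : 0 < b := hτ.trans_le hb
  have hsub : Metric.ball y (η * r) ⊆ Metric.ball x₀ r := by
    refine Metric.ball_subset_ball' ?_
    rw [Metric.mem_ball] at hy
    nlinarith
  have hmain := hCv v hv hvs y (η * r) (b * r ^ γ) ((b * r ^ γ) ^ p) (by positivity)
    (fun x hx => hbound x (hsub hx)) fun x hx =>
      (hlap x (Metric.ball_subset_ball hrR (hsub hx))).trans
        (Real.rpow_le_rpow (abs_nonneg _) (hbound x (hsub hx)) hp0.le)
  have hmeas : volume.real (Metric.ball y (η * r) ∩ {x | v x ≠ 0}) / (η * r) ^ N ≤ D / 2 := by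
    rw [div_le_iff₀ (by positivity), mul_pow]
    calc _ ≤ volume.real (Metric.ball x₀ r ∩ {x | v x ≠ 0}) :=
          measureReal_mono (inter_subset_inter_left _ hsub)
            ((measure_mono inter_subset_left).trans_lt measure_ball_lt_top).ne
      _ ≤ _ := hvol r hr hrr₁
      _ = _ := by ring
  have hpow : (b * r ^ γ) ^ p * (η * r) ^ 2 = b * b ^ (p - 1) * η ^ 2 * r ^ γ := by
    have h1 : r ^ γ = r ^ (γ * p) * r ^ 2 := by
      rw [← Real.rpow_natCast r 2, ← Real.rpow_add hr]
      exact congrArg _ (by push_cast; exact hγp.symm)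
    have h2 : b ^ p = b * b ^ (p - 1) := by
      rw [Real.rpow_sub_one hb0.ne']; field_simp
    rw [Real.mul_rpow hb0.le (by positivity), ← Real.rpow_mul hr.le, h1, h2]
    ring
  have hbp : b ^ (p - 1) ≤ τ ^ (p - 1) :=
    Real.rpow_le_rpow_of_nonpos hτ hb (by linarith)
  rw [hpow] at hmain
  calc |v y| ≤ _ := hmain
    _ ≤ C * (b * r ^ γ * (D / 2) + b * τ ^ (p - 1) * η ^ 2 * r ^ γ) := by gcongr
    _ = C * (b * r ^ γ * (D / 2 + τ ^ (p - 1) * η ^ 2)) := by ring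
    _ ≤ C * (b * r ^ γ * (D / 2 + D / 2)) := by gcongr
    _ = C * D * (b * r ^ γ) := by ring
    _ = b / 2 * (r / 2) ^ γ := by
      rw [hD, Real.div_rpow hr.le two_pos.le]
      field_simp

lemma exists_dyadic_growth {v : 𝔼 → ℝ} (hv : ContDiff ℝ 2 v) (hvs : HasCompactSupport v)
    {x₀ : 𝔼} {p R : ℝ} (hp0 : 0 < p) (hp1 : p < 1) (hR : 0 < R)
    (hlap : ∀ x ∈ Metric.ball x₀ R, |laplacian v x| ≤ |v x| ^ p)
    (hdens : ∀ δ > 0, ∃ r₁ > 0, ∀ r, 0 < r → r < r₁ →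
      volume.real (Metric.ball x₀ r ∩ {x | v x ≠ 0}) ≤ δ * r ^ N)
    {τ : ℝ} (hτ : 0 < τ) :
    ∃ r₀ > 0, ∃ k₀ : ℕ, ∀ k ≥ k₀, ∀ x ∈ Metric.ball x₀ (r₀ * (1 / 2) ^ k),
      |v x| ≤ τ * (r₀ * (1 / 2) ^ k) ^ (2 / (1 - p)) := by
  obtain ⟨r₀, hr₀, hstep⟩ := exists_radius_growth_halving hv hvs hp0 hp1 hR hlap hdens hτ
  obtain ⟨B, hB⟩ := hv.continuous.bounded_above_of_compact_support hvs
  set b := B / r₀ ^ (2 / (1 - p))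
  have hiter (k : ℕ) : ∀ x ∈ Metric.ball x₀ (r₀ * (1 / 2) ^ k),
      |v x| ≤ max τ (b * (1 / 2) ^ k) * (r₀ * (1 / 2) ^ k) ^ (2 / (1 - p)) := by
    induction k with
    | zero =>
      intro x _
      have h1 : 0 < r₀ ^ (2 / (1 - p)) := Real.rpow_pos_of_pos hr₀ _
      rw [pow_zero, mul_one, mul_one]
      calc |v x| ≤ B := hB x
        _ = b * r₀ ^ (2 / (1 - p)) := by simp only [b]; field_simp
        _ ≤ _ := by gcongr; exact le_max_right _ _
    | succ k ih =>
      intro x hx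
      have hhalf : r₀ * (1 / 2) ^ (k + 1) = r₀ * (1 / 2) ^ k / 2 := by ring
      have hk : (1 / 2 : ℝ) ^ k ≤ 1 := pow_le_one₀ (by norm_num) (by norm_num)
      rw [hhalf] at hx ⊢
      refine (hstep _ (by positivity) (by nlinarith) _ (le_max_left _ _) ih x hx).trans ?_
      gcongr
      rw [div_le_iff₀ two_pos]
      have h1 := le_max_left τ (b * (1 / 2) ^ (k + 1))
      have h2 := le_max_right τ (b * (1 / 2) ^ (k + 1))
      rw [pow_succ] at h1 h2 ⊢
      exact max_le (by linarith) (by linarith)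
  have hlim : Tendsto (fun k : ℕ => b * (1 / 2 : ℝ) ^ k) atTop (nhds 0) := by
    simpa using (tendsto_pow_atTop_nhds_zero_of_lt_one (r := (1 / 2 : ℝ))
      (by norm_num) (by norm_num)).const_mul b
  obtain ⟨k₀, hk₀⟩ := eventually_atTop.1 (hlim.eventually_le_const hτ)
  refine ⟨r₀, hr₀, k₀, fun k hk x hx => ?_⟩
  simpa only [max_eq_left (hk₀ k hk)] using hiter k x hx

lemma tendsto_div_norm_rpow_of_density {v : 𝔼 → ℝ} (hv : ContDiff ℝ 2 v)
    (hvs : HasCompactSupport v) {x₀ : 𝔼} {p R : ℝ} (hp0 : 0 < p) (hp1 : p < 1) (hR : 0 < R)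
    (hlap : ∀ x ∈ Metric.ball x₀ R, |laplacian v x| ≤ |v x| ^ p)
    (hdens : ∀ δ > 0, ∃ r₁ > 0, ∀ r, 0 < r → r < r₁ →
      volume.real (Metric.ball x₀ r ∩ {x | v x ≠ 0}) ≤ δ * r ^ N) :
    Tendsto (fun x => v x / ‖x - x₀‖ ^ (2 / (1 - p))) (nhdsWithin x₀ {x₀}ᶜ) (nhds 0) := by
  have hγ : 0 < 2 / (1 - p) := div_pos two_pos (by linarith)
  generalize hγ' : 2 / (1 - p) = γ at hγ
  rw [Metric.tendsto_nhdsWithin_nhds]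
  intro ε hε
  obtain ⟨r₀, hr₀, k₀, hk₀⟩ := exists_dyadic_growth hv hvs hp0 hp1 hR hlap hdens
    (τ := ε / 2 / 4 ^ γ) (by positivity)
  refine ⟨r₀ / 2 * (1 / 2) ^ (k₀ + 1), by positivity, fun x hx hxd => ?_⟩
  have hx0 : 0 < ‖x - x₀‖ := norm_pos_iff.2 (sub_ne_zero.2 hx)
  rw [dist_eq_norm] at hxd
  have ht : ‖x - x₀‖ / (r₀ / 2) < (1 / 2) ^ (k₀ + 1) := by
    rwa [div_lt_iff₀' (by positivity)]
  obtain ⟨n, hn1, hn2⟩ := exists_nat_pow_near_of_lt_one (x := ‖x - x₀‖ / (r₀ / 2))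
    (y := (1 / 2 : ℝ)) (by positivity)
    (ht.le.trans (pow_le_one₀ (by norm_num) (by norm_num))) (by norm_num) (by norm_num)
  have hkn : k₀ ≤ n := by
    have := (pow_lt_pow_iff_right_of_lt_one₀ (by norm_num : (0 : ℝ) < 1 / 2)
      (by norm_num)).1 (hn1.trans ht)
    lia
  rw [lt_div_iff₀' (by positivity), pow_succ] at hn1
  rw [div_le_iff₀' (by positivity)] at hn2
  have hpos : 0 < r₀ * (1 / 2 : ℝ) ^ n := by positivity
  have hvx := hk₀ n hkn x (by rw [mem_ball_iff_norm]; linarith)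
  rw [hγ'] at hvx
  have h4 : (r₀ * (1 / 2 : ℝ) ^ n) ^ γ ≤ 4 ^ γ * ‖x - x₀‖ ^ γ := by
    rw [← Real.mul_rpow (by norm_num) hx0.le]
    exact Real.rpow_le_rpow hpos.le (by linarith) hγ.le
  have hxγ : 0 < ‖x - x₀‖ ^ γ := Real.rpow_pos_of_pos hx0 _
  rw [dist_zero_right, norm_div, Real.norm_of_nonneg hxγ.le, Real.norm_eq_abs, div_lt_iff₀ hxγ]
  calc |v x| ≤ _ := hvx
    _ ≤ ε / 2 / 4 ^ γ * (4 ^ γ * ‖x - x₀‖ ^ γ) := by gcongr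
    _ = ε / 2 * ‖x - x₀‖ ^ γ := by field_simp
    _ < ε * ‖x - x₀‖ ^ γ := by gcongr; linarith

lemma Filter.EventuallyEq.laplacian_eq {u v : 𝔼 → ℝ} {x : 𝔼} (h : u =ᶠ[nhds x] v) :
    laplacian u x = laplacian v x := by
  unfold laplacian
  refine Finset.sum_congr rfl fun i _ => ?_
  have h' : (fun y => fderiv ℝ u y (EuclideanSpace.single i 1)) =ᶠ[nhds x]
      fun y => fderiv ℝ v y (EuclideanSpace.single i 1) := by
    filter_upwards [h.fderiv (𝕜 := ℝ)] with y hy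
    rw [hy]
  rw [h'.fderiv_eq]

lemma exists_contDiff_hasCompactSupport_eqOn_ball {u : 𝔼 → ℝ} {Ω : Set 𝔼} (hΩo : IsOpen Ω)
    (hu : ContDiffOn ℝ 2 u Ω) {x₀ : 𝔼} (hx₀ : x₀ ∈ Ω) :
    ∃ v : 𝔼 → ℝ, ContDiff ℝ 2 v ∧ HasCompactSupport v ∧
      ∃ R > 0, Metric.ball x₀ R ⊆ Ω ∧ EqOn u v (Metric.ball x₀ R) := by
  obtain ⟨R, hR, hRΩ⟩ := Metric.nhds_basis_closedBall.mem_iff.1 (hΩo.mem_nhds hx₀)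
  let f : ContDiffBump x₀ := ⟨R / 2, R, by positivity, by linarith⟩
  refine ⟨fun x => f x * u x, ?_, f.hasCompactSupport.mul_right, R / 2, by positivity, ?_, ?_⟩
  · refine contDiff_iff_contDiffAt.2 fun x => ?_
    by_cases hx : x ∈ tsupport f
    · rw [f.tsupport_eq] at hx
      exact f.contDiff.contDiffAt.mul (hu.contDiffAt (hΩo.mem_nhds (hRΩ hx)))
    · refine (contDiffAt_const (c := (0 : ℝ))).congr_of_eventuallyEq ?_
      filter_upwards [notMem_tsupport_iff_eventuallyEq.1 hx] with y hy
      simp [hy]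
  · exact (Metric.ball_subset_ball (by linarith)).trans
      (Metric.ball_subset_closedBall.trans hRΩ)
  · intro x hx
    have : f x = 1 := f.one_of_mem_closedBall (Metric.ball_subset_closedBall hx)
    simp [this]

/-- At a density point of the zero set, the non-zero set has measure `o(r ^ N)` in balls. -/
lemma exists_measure_support_le_of_density {v : 𝔼 → ℝ} (hv : Continuous v) {x₀ : 𝔼}
    (hdens : Tendsto
      (fun r : ℝ => volume (Metric.ball x₀ r ∩ {x | v x = 0}) / volume (Metric.ball x₀ r))
      (nhdsWithin 0 (Ioi 0)) (nhds 1)) {δ : ℝ} (hδ : 0 < δ) :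
    ∃ r₁ > 0, ∀ r, 0 < r → r < r₁ →
      volume.real (Metric.ball x₀ r ∩ {x | v x ≠ 0}) ≤ δ * r ^ N := by
  set ω := volume.real (Metric.ball (0 : 𝔼) 1)
  have hω : 0 < ω := ENNReal.toReal_pos (Metric.measure_ball_pos _ _ one_pos).ne'
    measure_ball_lt_top.ne
  have hlim := (ENNReal.tendsto_toReal ENNReal.one_ne_top).comp hdens
  have hev := hlim.eventually_const_le (u := 1 - δ / ω) (by simp; positivity)
  obtain ⟨r₁, hr₁, h⟩ := mem_nhdsGT_iff_exists_Ioo_subset.1 hev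
  refine ⟨r₁, hr₁, fun r hr hrr₁ => ?_⟩
  have h1 : 1 - δ / ω ≤ _ := h ⟨hr, hrr₁⟩
  have hball : volume.real (Metric.ball x₀ r) = r ^ N * ω := by
    rw [measureReal_def, Measure.addHaar_ball_of_pos _ _ hr, ENNReal.toReal_mul,
      ENNReal.toReal_ofReal (by positivity), finrank_euclideanSpace_fin]
    rfl
  rw [Function.comp_apply, ENNReal.toReal_div, ← measureReal_def, ← measureReal_def, hball,
    le_div_iff₀ (by positivity)] at h1
  have hsplit := measureReal_inter_add_sdiff (μ := volume) (s := Metric.ball x₀ r)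
    (isClosed_eq hv (continuous_const (y := (0 : ℝ)))).measurableSet measure_ball_lt_top.ne
  have hdiff : Metric.ball x₀ r \ {x | v x = 0} = Metric.ball x₀ r ∩ {x | v x ≠ 0} := rfl
  rw [hdiff, hball] at hsplit
  have : (1 - δ / ω) * (r ^ N * ω) = r ^ N * ω - δ * r ^ N := by field_simp
  linarith

end Laplacian

/-- If `u ∈ C²(Ω)` solves `-Δu = |u|^{q-2}u` in the open set `Ω` and `x₀ ∈ Ω`
is a point of density one for the zero set of `u`, then `u(x) = o(|x-x₀|^{2/(2-q)})` as
`x → x₀`. -/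
theorem statement4 {N : ℕ} (Ω : Set (EuclideanSpace ℝ (Fin N))) (hΩo : IsOpen Ω)
    (q : ℝ) (hq1 : 1 < q) (hq2 : q < 2)
    (u : EuclideanSpace ℝ (Fin N) → ℝ) (hu : ContDiffOn ℝ 2 u Ω)
    (hpde : ∀ x ∈ Ω, -laplacian u x = |u x| ^ (q - 2) * u x)
    (x₀ : EuclideanSpace ℝ (Fin N)) (hx₀ : x₀ ∈ Ω)
    (hdens : Tendsto
      (fun r : ℝ => volume ({x ∈ Ω | u x = 0} ∩ Metric.ball x₀ r) / volume (Metric.ball x₀ r))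
      (nhdsWithin 0 (Ioi 0)) (nhds 1)) :
    Tendsto (fun x => u x / ‖x - x₀‖ ^ (2 / (2 - q))) (nhdsWithin x₀ {x₀}ᶜ) (nhds 0) := by
  obtain ⟨v, hv, hvs, R, hR, hRΩ, huv⟩ := exists_contDiff_hasCompactSupport_eqOn_ball hΩo hu hx₀
  have hlap : ∀ x ∈ Metric.ball x₀ R, |laplacian v x| ≤ |v x| ^ (q - 1) := by
    intro x hx
    have hx' : laplacian v x = laplacian u x :=
      (huv.symm.eventuallyEq_of_mem (Metric.isOpen_ball.mem_nhds hx)).laplacian_eq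
    rw [hx', ← huv hx, ← abs_neg, hpde x (hRΩ hx), abs_mul,
      abs_of_nonneg (Real.rpow_nonneg (abs_nonneg _) _)]
    rcases eq_or_ne (u x) 0 with h0 | h0
    · simp [h0, Real.zero_rpow (sub_ne_zero.2 hq1.ne')]
    · rw [← Real.rpow_add_one (abs_ne_zero.2 h0)]
      exact le_of_eq (congrArg _ (by ring))
  have hdens' : Tendsto
      (fun r : ℝ => volume (Metric.ball x₀ r ∩ {x | v x = 0}) / volume (Metric.ball x₀ r))
      (nhdsWithin 0 (Ioi 0)) (nhds 1) := by
    refine hdens.congr' ?_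
    filter_upwards [Ioo_mem_nhdsGT hR] with r hr
    congr 2
    ext x
    simp only [mem_inter_iff, mem_ofPred_eq]
    constructor
    · rintro ⟨⟨_, h0⟩, hx⟩
      exact ⟨hx, by rwa [← huv (Metric.ball_subset_ball hr.2.le hx)]⟩
    · rintro ⟨hx, h0⟩
      have hx' := Metric.ball_subset_ball hr.2.le hx
      exact ⟨⟨hRΩ hx', by rwa [huv hx']⟩, hx⟩
  have hmain := tendsto_div_norm_rpow_of_density hv hvs (p := q - 1) (by linarith) (by linarith)
    hR hlap fun δ hδ => exists_measure_support_le_of_density hv.continuous hdens' hδ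
  rw [show 1 - (q - 1) = 2 - q by ring] at hmain
  refine hmain.congr' ?_
  filter_upwards [mem_nhdsWithin_of_mem_nhds (Metric.ball_mem_nhds x₀ hR)] with x hx
  rw [huv hx]
end

section
/- Let Ω ⊂ ℝ^N be a bounded open set, 1 < q < 2, and let u ∈ C²(Ω) be bounded with ∫_Ω |∇u|² dx < ∞ and satisfy −Δu = |u|^{q−2}u pointwise in Ω. Let x₀ ∈ Ω be a point of density one for the zero set u⁻¹(0). Let v be a C¹ function on ℝ^N with compact support contained in the open unit ball B₁(0) such that (1/2)∫_{B₁(0)} |∇v|² dx − (1/q)∫_{B₁(0)} |v|^q dx < 0. For r > 0 define v_r : Ω → ℝ by v_r(x) = r^{2/(2−q)} v((x−x₀)/r) for x ∈ B_r(x₀) ∩ Ω and v_r(x) = 0 otherwise. Then there exists r₀ > 0 such that B_{r₀}(x₀) ⊂ Ω and φ(u+v_r) < φ(u) for every r ∈ (0, r₀), where φ(w) = (1/2)∫_Ω |∇w|² dx − (1/q)∫_Ω |w|^q dx. -/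
open MeasureTheory Set Filter Classical

attribute [local instance] Classical.propDecidable

/-- The energy functional `φ(w) = (1/2)∫_Ω |∇w|² dx - (1/q)∫_Ω |w|^q dx`. -/
noncomputable def energy {N : ℕ} (q : ℝ) (Ω : Set (EuclideanSpace ℝ (Fin N)))
    (w : EuclideanSpace ℝ (Fin N) → ℝ) : ℝ :=
  (1 / 2) * (∫ x in Ω, ‖gradient w x‖ ^ 2) - (1 / q) * ∫ x in Ω, |w x| ^ q

theorem abs_rpow_add_tangent_le {q : ℝ} (hq : 1 < q) (a b : ℝ) (ha : a ≠ 0) :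
    |a| ^ q + q * (|a| ^ (q - 2) * a * b) ≤ |a + b| ^ q := by
  have key : ∀ s : ℝ, 1 + q * s ≤ |1 + s| ^ q := fun s => by
    rcases le_or_gt (-1) s with hs | hs
    · rw [abs_of_nonneg (by linarith)]
      exact one_add_mul_self_le_rpow_one_add hs hq.le
    · have : 0 ≤ |1 + s| ^ q := by positivity
      nlinarith
  have hpos : 0 < |a| := abs_pos.mpr ha
  have h1 : |a| ^ q = |a| ^ (q - 2) * a ^ 2 := by
    rw [← sq_abs, ← Real.rpow_natCast, ← Real.rpow_add hpos]
    norm_num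
  have h2 : |a + b| ^ q = |a| ^ q * |1 + b / a| ^ q := by
    rw [← Real.mul_rpow (abs_nonneg _) (abs_nonneg _), ← abs_mul]
    congr 2
    field_simp
  have h3 : |a| ^ q * (b / a) = |a| ^ (q - 2) * a * b := by
    rw [h1]; field_simp
  rw [h2, ← h3]
  nlinarith [mul_le_mul_of_nonneg_left (key (b / a)) (Real.rpow_nonneg (abs_nonneg a) q)]

theorem ContinuousOn.integrable_mul_of_tsupport_subset {N : ℕ}
    {Ω : Set (EuclideanSpace ℝ (Fin N))} (hΩ : IsOpen Ω)
    {f g : EuclideanSpace ℝ (Fin N) → ℝ} (hf : ContinuousOn f Ω) (hg : Continuous g)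
    (hgc : HasCompactSupport g) (hgs : tsupport g ⊆ Ω) :
    Integrable (fun x => f x * g x) := by
  refine Continuous.integrable_of_hasCompactSupport ?_ (hgc.mul_left (f := f))
  refine continuous_of_tsupport fun x hx => ?_
  have hx' : x ∈ Ω := hgs (tsupport_mul_subset_right hx)
  exact (hf.continuousAt (hΩ.mem_nhds hx')).mul hg.continuousAt

theorem inner_gradient_eq_sum {N : ℕ} (u w : EuclideanSpace ℝ (Fin N) → ℝ)
    (x : EuclideanSpace ℝ (Fin N)) :
    inner ℝ (gradient u x) (gradient w x) = ∑ i : Fin N,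
      fderiv ℝ u x (EuclideanSpace.single i 1) * fderiv ℝ w x (EuclideanSpace.single i 1) := by
  rw [← (EuclideanSpace.basisFun (Fin N) ℝ).sum_inner_mul_inner]
  refine Finset.sum_congr rfl fun i _ => ?_
  rw [EuclideanSpace.basisFun_apply, real_inner_comm (gradient w x), gradient, gradient,
    InnerProductSpace.toDual_symm_apply, InnerProductSpace.toDual_symm_apply]

theorem integral_inner_gradient_eq_neg_integral_laplacian_mul {N : ℕ}
    {Ω : Set (EuclideanSpace ℝ (Fin N))} (hΩ : IsOpen Ω)
    {u w : EuclideanSpace ℝ (Fin N) → ℝ} (hu : ContDiffOn ℝ 2 u Ω) (hw : ContDiff ℝ 1 w)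
    (hwc : HasCompactSupport w) (hws : tsupport w ⊆ Ω) :
    Integrable (fun x => inner ℝ (gradient u x) (gradient w x)) ∧
    Integrable (fun x => -laplacian u x * w x) ∧
    ∫ x, inner ℝ (gradient u x) (gradient w x) = ∫ x, -laplacian u x * w x := by
  have hdu (i : Fin N) :
      ContDiffOn ℝ 1 (fun y => fderiv ℝ u y (EuclideanSpace.single i 1)) Ω :=
    (hu.fderiv_of_isOpen hΩ (by norm_num)).clm_apply contDiffOn_const
  have hddu (i : Fin N) : ContinuousOn (fun x => fderiv ℝ
      (fun y => fderiv ℝ u y (EuclideanSpace.single i 1)) x (EuclideanSpace.single i 1)) Ω :=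
    ((hdu i).continuousOn_fderiv_of_isOpen hΩ le_rfl).clm_apply continuousOn_const
  have hint (i : Fin N) : Integrable (fun x => fderiv ℝ u x (EuclideanSpace.single i 1) *
      fderiv ℝ w x (EuclideanSpace.single i 1)) :=
    (hdu i).continuousOn.integrable_mul_of_tsupport_subset hΩ
      ((hw.continuous_fderiv one_ne_zero).clm_apply continuous_const)
      (hwc.fderiv_apply ℝ _) ((tsupport_fderiv_apply_subset ℝ _).trans hws)
  have hint' (i : Fin N) : Integrable (fun x => fderiv ℝ
      (fun y => fderiv ℝ u y (EuclideanSpace.single i 1)) x (EuclideanSpace.single i 1) * w x) :=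
    (hddu i).integrable_mul_of_tsupport_subset hΩ hw.continuous hwc hws
  have hlap : (fun x => -laplacian u x * w x) = fun x => -∑ i : Fin N, fderiv ℝ
      (fun y => fderiv ℝ u y (EuclideanSpace.single i 1)) x (EuclideanSpace.single i 1) * w x := by
    funext x
    rw [laplacian, neg_mul, Finset.sum_mul]
  simp only [inner_gradient_eq_sum, hlap]
  refine ⟨integrable_finsetSum _ fun i _ => hint i,
    (integrable_finsetSum _ fun i _ => hint' i).neg, ?_⟩
  rw [integral_neg, integral_finsetSum _ fun i _ => hint i,
    integral_finsetSum _ fun i _ => hint' i, ← Finset.sum_neg_distrib]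
  refine Finset.sum_congr rfl fun i _ => ?_
  refine integral_mul_fderiv_eq_neg_fderiv_mul_of_integrable (hint' i) (hint i)
    ((hdu i).continuousOn.integrable_mul_of_tsupport_subset hΩ hw.continuous hwc hws)
    (fun x hx => ?_) (fun x _ => hw.differentiable one_ne_zero x)
  exact ((hdu i).differentiableOn one_ne_zero).differentiableAt (hΩ.mem_nhds (hws hx))

theorem integrableOn_abs_rpow_of_bounded {N : ℕ} {Ω : Set (EuclideanSpace ℝ (Fin N))}
    (hΩo : IsOpen Ω) (hΩb : Bornology.IsBounded Ω) {q : ℝ} (hq : 0 ≤ q)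
    {f : EuclideanSpace ℝ (Fin N) → ℝ} (hf : ContinuousOn f Ω) {C : ℝ}
    (hC : ∀ x ∈ Ω, |f x| ≤ C) : IntegrableOn (fun x => |f x| ^ q) Ω := by
  refine IntegrableOn.of_bound hΩb.measure_lt_top
    ((hf.abs.rpow_const fun _ _ => Or.inr hq).aestronglyMeasurable hΩo.measurableSet) (C ^ q) ?_
  refine (ae_restrict_iff' hΩo.measurableSet).mpr (ae_of_all _ fun x hx => ?_)
  rw [Real.norm_of_nonneg (by positivity)]
  exact Real.rpow_le_rpow (abs_nonneg _) (hC x hx) hq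

theorem energy_add_le {N : ℕ} {Ω : Set (EuclideanSpace ℝ (Fin N))}
    (hΩo : IsOpen Ω) (hΩb : Bornology.IsBounded Ω) {q : ℝ} (hq : 1 < q)
    {u w : EuclideanSpace ℝ (Fin N) → ℝ} (hu : ContDiffOn ℝ 2 u Ω)
    (hub : ∃ C : ℝ, ∀ x ∈ Ω, |u x| ≤ C)
    (hgrad : IntegrableOn (fun x => ‖gradient u x‖ ^ 2) Ω)
    (hpde : ∀ x ∈ Ω, -laplacian u x = |u x| ^ (q - 2) * u x)
    (hw : ContDiff ℝ 1 w) (hwc : HasCompactSupport w) (hws : tsupport w ⊆ Ω) :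
    energy q Ω (fun x => u x + w x) ≤ energy q Ω u + (1 / 2) * (∫ x, ‖gradient w x‖ ^ 2)
      - (1 / q) * (∫ x, |w x| ^ q) + (1 / q) * ∫ x in Ω ∩ {x | u x ≠ 0}, |w x| ^ q := by
  have hq0 : 0 < q := by linarith
  obtain ⟨C, hC⟩ := hub
  obtain ⟨M, hM⟩ := hwc.exists_bound_of_continuous hw.continuous
  obtain ⟨hi1, hi2, hparts⟩ :=
    integral_inner_gradient_eq_neg_integral_laplacian_mul hΩo hu hw hwc hws
  have hw0 : ∀ x, x ∉ Ω → w x = 0 := fun x hx => image_eq_zero_of_notMem_tsupport (hx <| hws ·)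
  have hgw0 : ∀ x, x ∉ Ω → gradient w x = 0 := fun x hx => by
    rw [gradient, fderiv_of_notMem_tsupport ℝ (hx <| hws ·), map_zero]
  have hcgw : Continuous (gradient w) :=
    (LinearIsometryEquiv.continuous _).comp (hw.continuous_fderiv one_ne_zero)
  have hi3 : Integrable fun x => ‖gradient w x‖ ^ 2 := by
    refine (hcgw.norm.pow 2).integrable_of_hasCompactSupport (hwc.mono' fun x hx => ?_)
    by_contra h
    simp [gradient, fderiv_of_notMem_tsupport ℝ h] at hx
  have hwq : IntegrableOn (fun x => |w x| ^ q) Ω :=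
    integrableOn_abs_rpow_of_bounded hΩo hΩb hq0.le hw.continuous.continuousOn fun x _ => hM x
  have huq := integrableOn_abs_rpow_of_bounded hΩo hΩb hq0.le hu.continuousOn hC
  have huwq : IntegrableOn (fun x => |u x + w x| ^ q) Ω :=
    integrableOn_abs_rpow_of_bounded hΩo hΩb hq0.le
      (hu.continuousOn.add hw.continuous.continuousOn) fun x hx =>
        (abs_add_le _ _).trans (add_le_add (hC x hx) (hM x))
  have hgradient : ∫ x in Ω, ‖gradient (fun x => u x + w x) x‖ ^ 2 =
      (∫ x in Ω, ‖gradient u x‖ ^ 2) + 2 * (∫ x, -laplacian u x * w x)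
        + ∫ x, ‖gradient w x‖ ^ 2 := by
    have h1 : ∫ x in Ω, ‖gradient (fun x => u x + w x) x‖ ^ 2 = ∫ x in Ω,
        (‖gradient u x‖ ^ 2 + 2 * inner ℝ (gradient u x) (gradient w x)
          + ‖gradient w x‖ ^ 2) := by
      refine setIntegral_congr_fun hΩo.measurableSet fun x hx => ?_
      have hux : DifferentiableAt ℝ u x :=
        (hu.differentiableOn two_ne_zero).differentiableAt (hΩo.mem_nhds hx)
      have : gradient (fun x => u x + w x) x = gradient u x + gradient w x := by
        rw [gradient, fderiv_fun_add hux (hw.differentiable one_ne_zero x), map_add]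
        rfl
      simp only [this]
      exact norm_add_sq_real _ _
    have h2 : IntegrableOn (fun x => ‖gradient u x‖ ^ 2
        + 2 * inner ℝ (gradient u x) (gradient w x)) Ω :=
      hgrad.add (hi1.integrableOn.const_mul 2)
    rw [h1, integral_add h2 hi3.integrableOn,
      integral_add hgrad (hi1.integrableOn.const_mul 2), integral_const_mul, ← hparts,
      setIntegral_eq_integral_of_forall_compl_eq_zero
        (f := fun x => inner ℝ (gradient u x) (gradient w x)) fun x hx => by simp [hgw0 x hx],
      setIntegral_eq_integral_of_forall_compl_eq_zero
        (f := fun x => ‖gradient w x‖ ^ 2) fun x hx => by simp [hgw0 x hx]]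
  have hAm : MeasurableSet (Ω ∩ {x | u x ≠ 0}) :=
    (hu.continuousOn.isOpen_inter_preimage hΩo isOpen_ne).measurableSet
  set A := Ω ∩ {x | u x ≠ 0} with hA
  have hpot : (∫ x in Ω, |u x| ^ q) + q * (∫ x, -laplacian u x * w x) + (∫ x, |w x| ^ q)
      - (∫ x in A, |w x| ^ q) ≤ ∫ x in Ω, |u x + w x| ^ q := by
    have hAi : ∫ x in A, |w x| ^ q = ∫ x in Ω, A.indicator (fun x => |w x| ^ q) x := by
      rw [setIntegral_indicator hAm, inter_eq_self_of_subset_right inter_subset_left]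
    have hwi : IntegrableOn (A.indicator fun x => |w x| ^ q) Ω := hwq.indicator hAm
    have hi2' := (hi2.integrableOn (s := Ω)).const_mul q
    have hi4 : IntegrableOn (fun x => |u x| ^ q + q * (-laplacian u x * w x)) Ω := huq.add hi2'
    have hi5 : IntegrableOn (fun x => |u x| ^ q + q * (-laplacian u x * w x) + |w x| ^ q) Ω :=
      hi4.add hwq
    rw [← setIntegral_eq_integral_of_forall_compl_eq_zero (s := Ω)
        (f := fun x => -laplacian u x * w x) fun x hx => by simp [hw0 x hx],
      ← setIntegral_eq_integral_of_forall_compl_eq_zero (s := Ω)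
        (f := fun x => |w x| ^ q) fun x hx => by simp [hw0 x hx, Real.zero_rpow hq0.ne'],
      hAi, ← integral_const_mul, ← integral_add huq hi2', ← integral_add hi4 hwq,
      ← integral_sub hi5 hwi]
    refine setIntegral_mono_on (hi5.sub hwi) huwq hΩo.measurableSet
      fun x hx => ?_
    by_cases hux : u x = 0
    · simp [hA, hux, hpde x hx, Real.zero_rpow hq0.ne']
    · have hxA : x ∈ A := ⟨hx, hux⟩
      have := abs_rpow_add_tangent_le hq (u x) (w x) hux
      simp only [indicator_of_mem hxA, hpde x hx]
      linarith
  have hpot' := mul_le_mul_of_nonneg_left hpot (one_div_nonneg.mpr hq0.le)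
  have hcancel : 1 / q * (q * ∫ x, -laplacian u x * w x) = ∫ x, -laplacian u x * w x := by
    field_simp
  rw [mul_sub, mul_add, mul_add, hcancel] at hpot'
  rw [energy, energy, hgradient]
  linarith

/-- The rescaled copy `x ↦ c v((x - x₀) / r)` of `v`. -/
noncomputable def rescaledBump {N : ℕ} (v : EuclideanSpace ℝ (Fin N) → ℝ)
    (x₀ : EuclideanSpace ℝ (Fin N)) (c r : ℝ) (x : EuclideanSpace ℝ (Fin N)) : ℝ :=
  c * v (r⁻¹ • (x - x₀))

theorem integral_comp_inv_smul_sub {N : ℕ} (f : EuclideanSpace ℝ (Fin N) → ℝ)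
    (x₀ : EuclideanSpace ℝ (Fin N)) {r : ℝ} (hr : 0 < r) :
    ∫ x, f (r⁻¹ • (x - x₀)) = r ^ N * ∫ x, f x := by
  rw [integral_sub_right_eq_self (fun x => f (r⁻¹ • x)) x₀,
    Measure.integral_comp_inv_smul_of_nonneg _ _ hr.le, finrank_euclideanSpace_fin, smul_eq_mul]

theorem contDiff_rescaledBump {N : ℕ} {v : EuclideanSpace ℝ (Fin N) → ℝ} (hv : ContDiff ℝ 1 v)
    (x₀ : EuclideanSpace ℝ (Fin N)) (c r : ℝ) : ContDiff ℝ 1 (rescaledBump v x₀ c r) := by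
  unfold rescaledBump
  fun_prop

theorem norm_gradient_rescaledBump {N : ℕ} {v : EuclideanSpace ℝ (Fin N) → ℝ}
    (hv : ContDiff ℝ 1 v) (x₀ : EuclideanSpace ℝ (Fin N)) (c r : ℝ)
    (x : EuclideanSpace ℝ (Fin N)) :
    ‖gradient (rescaledBump v x₀ c r) x‖ ^ 2 =
      (c * r⁻¹) ^ 2 * ‖gradient v (r⁻¹ • (x - x₀))‖ ^ 2 := by
  have h1 : HasFDerivAt (fun x : EuclideanSpace ℝ (Fin N) => r⁻¹ • (x - x₀))
      (r⁻¹ • ContinuousLinearMap.id ℝ _) x := ((hasFDerivAt_id x).sub_const x₀).const_smul r⁻¹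
  have h2 := ((hv.differentiable one_ne_zero (r⁻¹ • (x - x₀))).hasFDerivAt.comp x h1).const_mul c
  have h3 : fderiv ℝ (rescaledBump v x₀ c r) x =
      (c * r⁻¹) • fderiv ℝ v (r⁻¹ • (x - x₀)) := by
    refine h2.fderiv.trans ?_
    ext y
    simp [mul_assoc]
  rw [gradient, gradient, h3, LinearIsometryEquiv.norm_map, LinearIsometryEquiv.norm_map,
    norm_smul, mul_pow, Real.norm_eq_abs, sq_abs]

theorem rescaledBump_eq_zero {N : ℕ} {v : EuclideanSpace ℝ (Fin N) → ℝ}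
    (hv : tsupport v ⊆ Metric.ball 0 1) {x₀ x : EuclideanSpace ℝ (Fin N)} (c : ℝ) {r : ℝ}
    (hr : 0 < r) (hx : x ∉ Metric.ball x₀ r) : rescaledBump v x₀ c r x = 0 := by
  have : r⁻¹ • (x - x₀) ∉ tsupport v := fun h => hx <| by
    have h1 := hv h
    rw [mem_ball_zero_iff, norm_smul, norm_inv, Real.norm_of_nonneg hr.le,
      inv_mul_lt_one₀ hr] at h1
    rwa [mem_ball_iff_norm]
  rw [rescaledBump, image_eq_zero_of_notMem_tsupport this, mul_zero]

theorem tsupport_rescaledBump_subset {N : ℕ} {v : EuclideanSpace ℝ (Fin N) → ℝ}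
    (hv : tsupport v ⊆ Metric.ball 0 1) (x₀ : EuclideanSpace ℝ (Fin N)) (c : ℝ) {r : ℝ}
    (hr : 0 < r) : tsupport (rescaledBump v x₀ c r) ⊆ Metric.ball x₀ r := by
  have hcont : Continuous fun x : EuclideanSpace ℝ (Fin N) => r⁻¹ • (x - x₀) := by fun_prop
  have h1 : tsupport (rescaledBump v x₀ c r) ⊆ (fun x => r⁻¹ • (x - x₀)) ⁻¹' tsupport v := by
    refine closure_minimal (fun x hx => subset_tsupport v ?_)
      ((isClosed_tsupport v).preimage hcont)
    exact right_ne_zero_of_mul hx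
  intro x hx
  have h2 := hv (h1 hx)
  rw [mem_ball_zero_iff, norm_smul, norm_inv, Real.norm_of_nonneg hr.le,
    inv_mul_lt_one₀ hr] at h2
  rwa [mem_ball_iff_norm]

theorem measureReal_inter_ball_le_of_density {N : ℕ} {Z A : Set (EuclideanSpace ℝ (Fin N))}
    {x₀ : EuclideanSpace ℝ (Fin N)} {r ε : ℝ} (hr : 0 < r) (hA : MeasurableSet A)
    (hZA : Disjoint Z A) (hZ : ENNReal.ofReal (1 - ε) <
      volume (Z ∩ Metric.ball x₀ r) / volume (Metric.ball x₀ r)) :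
    volume.real (A ∩ Metric.ball x₀ r) ≤ ε * volume.real (Metric.ball x₀ r) := by
  set B := Metric.ball x₀ r
  have hBfin : volume B ≠ ⊤ := measure_ball_lt_top.ne
  have hBpos : 0 < volume.real B :=
    ENNReal.toReal_pos (Metric.measure_ball_pos volume x₀ hr).ne' hBfin
  have h1 : (1 - ε) * volume.real B ≤ volume.real (Z ∩ B) := by
    rw [← le_div_iff₀ hBpos, measureReal_def, measureReal_def, ← ENNReal.toReal_div]
    refine (ENNReal.ofReal_le_iff_le_toReal ?_).mp hZ.le
    exact (ENNReal.div_lt_top (measure_ne_top_of_subset inter_subset_right hBfin)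
      (Metric.measure_ball_pos volume x₀ hr).ne').ne
  have h2 : volume.real (Z ∩ B) + volume.real (A ∩ B) ≤ volume.real B := by
    rw [← measureReal_union (hZA.mono inter_subset_left inter_subset_left)
      (hA.inter measurableSet_ball) (measure_ne_top_of_subset inter_subset_right hBfin)
      (measure_ne_top_of_subset inter_subset_right hBfin)]
    exact measureReal_mono (union_subset inter_subset_right inter_subset_right) hBfin
  linarith

/-- Energy decreases by inserting suitably rescaled negative-energy bumps at a
density-one point of the zero set of a solution of `-Δu = |u|^{q-2}u`. -/
theorem statement5 {N : ℕ} (Ω : Set (EuclideanSpace ℝ (Fin N)))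
    (hΩo : IsOpen Ω) (hΩb : Bornology.IsBounded Ω)
    (q : ℝ) (hq1 : 1 < q) (hq2 : q < 2)
    (u : EuclideanSpace ℝ (Fin N) → ℝ) (hu : ContDiffOn ℝ 2 u Ω)
    (hub : ∃ C : ℝ, ∀ x ∈ Ω, |u x| ≤ C)
    (hgrad : IntegrableOn (fun x => ‖gradient u x‖ ^ 2) Ω)
    (hpde : ∀ x ∈ Ω, -laplacian u x = |u x| ^ (q - 2) * u x)
    (x₀ : EuclideanSpace ℝ (Fin N)) (hx₀ : x₀ ∈ Ω)
    (hdens : Tendsto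
      (fun r : ℝ => volume ({x ∈ Ω | u x = 0} ∩ Metric.ball x₀ r) / volume (Metric.ball x₀ r))
      (nhdsWithin 0 (Ioi 0)) (nhds 1))
    (v : EuclideanSpace ℝ (Fin N) → ℝ) (hv : ContDiff ℝ 1 v)
    (hvsupp : HasCompactSupport v) (hvball : tsupport v ⊆ Metric.ball 0 1)
    (hvneg : (1 / 2) * (∫ x in Metric.ball (0 : EuclideanSpace ℝ (Fin N)) 1, ‖gradient v x‖ ^ 2)
        - (1 / q) * (∫ x in Metric.ball (0 : EuclideanSpace ℝ (Fin N)) 1, |v x| ^ q) < 0) :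
    ∃ r₀ : ℝ, 0 < r₀ ∧ Metric.ball x₀ r₀ ⊆ Ω ∧ ∀ r : ℝ, 0 < r → r < r₀ →
      energy q Ω (fun x => u x +
          (if x ∈ Metric.ball x₀ r then r ^ (2 / (2 - q)) * v (r⁻¹ • (x - x₀)) else 0))
        < energy q Ω u := by
  have hq0 : 0 < q := by linarith
  have hAm : MeasurableSet (Ω ∩ {x | u x ≠ 0}) :=
    (hu.continuousOn.isOpen_inter_preimage hΩo isOpen_ne).measurableSet
  obtain ⟨M, hM⟩ := hvsupp.exists_bound_of_continuous hv.continuous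
  have hM0 : 0 ≤ M := (norm_nonneg _).trans (hM 0)
  rw [setIntegral_eq_integral_of_forall_compl_eq_zero fun x hx => by
      simp [gradient, fderiv_of_notMem_tsupport ℝ (hx <| hvball ·)],
    setIntegral_eq_integral_of_forall_compl_eq_zero fun x hx => by
      simp [image_eq_zero_of_notMem_tsupport (hx <| hvball ·), Real.zero_rpow hq0.ne']] at hvneg
  set I : ℝ := ∫ x, ‖gradient v x‖ ^ 2
  set J : ℝ := ∫ x, |v x| ^ q
  set b : ℝ := volume.real (Metric.ball (0 : EuclideanSpace ℝ (Fin N)) 1)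
  obtain ⟨ε, hε, hεneg⟩ : ∃ ε : ℝ, 0 < ε ∧
      (1 / 2) * I - (1 / q) * J + ε * ((1 / q) * (M ^ q * b)) < 0 := by
    have hK : 0 ≤ (1 / q) * (M ^ q * b) := by positivity
    set K := (1 / q) * (M ^ q * b)
    refine ⟨-((1 / 2) * I - (1 / q) * J) / (K + 1), by apply div_pos <;> linarith, ?_⟩
    have : -((1 / 2) * I - (1 / q) * J) / (K + 1) * K < -((1 / 2) * I - (1 / q) * J) := by
      rw [div_mul_eq_mul_div, div_lt_iff₀ (by linarith)]
      nlinarith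
    linarith
  have hev := hdens.eventually_const_lt (u := ENNReal.ofReal (1 - ε))
    (by rw [ENNReal.ofReal_lt_one]; linarith)
  obtain ⟨r₁, hr₁, hr₁s⟩ := mem_nhdsGT_iff_exists_Ioo_subset.mp hev
  obtain ⟨r₂, hr₂, hr₂s⟩ := Metric.isOpen_iff.mp hΩo x₀ hx₀
  refine ⟨min r₁ r₂, lt_min hr₁ hr₂,
    (Metric.ball_subset_ball (min_le_right _ _)).trans hr₂s, fun r hr hrr => ?_⟩
  have hball : Metric.ball x₀ r ⊆ Ω :=
    (Metric.ball_subset_ball (hrr.le.trans (min_le_right _ _))).trans hr₂s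
  set c : ℝ := r ^ (2 / (2 - q)) with hc
  have hc0 : 0 < c := Real.rpow_pos_of_pos hr _
  have hscale : (c * r⁻¹) ^ 2 = c ^ q := by
    rw [hc, ← Real.rpow_neg_one, ← Real.rpow_add hr, ← Real.rpow_natCast, ← Real.rpow_mul hr.le,
      ← Real.rpow_mul hr.le]
    congr 1
    have : 2 - q ≠ 0 := by linarith
    push_cast
    field_simp
    ring
  have hfun : (fun x => u x + (if x ∈ Metric.ball x₀ r then c * v (r⁻¹ • (x - x₀)) else 0)) =
      fun x => u x + rescaledBump v x₀ c r x := by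
    funext x
    split_ifs with hx
    · rfl
    · rw [rescaledBump_eq_zero hvball c hr hx]
  rw [hfun]
  have hsupp := tsupport_rescaledBump_subset hvball x₀ c hr
  have hle := energy_add_le hΩo hΩb hq1 hu hub hgrad hpde (contDiff_rescaledBump hv x₀ c r)
    (.of_support_subset_isCompact (isCompact_closedBall x₀ r)
      ((subset_tsupport _).trans (hsupp.trans Metric.ball_subset_closedBall)))
    (hsupp.trans hball)
  have hI : ∫ x, ‖gradient (rescaledBump v x₀ c r) x‖ ^ 2 = c ^ q * r ^ N * I := by
    simp only [norm_gradient_rescaledBump hv]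
    rw [integral_const_mul, integral_comp_inv_smul_sub (fun y => ‖gradient v y‖ ^ 2) x₀ hr,
      hscale, mul_assoc]
  have habs : ∀ x, |rescaledBump v x₀ c r x| ^ q = c ^ q * |v (r⁻¹ • (x - x₀))| ^ q := fun x => by
    rw [rescaledBump, abs_mul, abs_of_pos hc0, Real.mul_rpow hc0.le (abs_nonneg _)]
  have hJ : ∫ x, |rescaledBump v x₀ c r x| ^ q = c ^ q * r ^ N * J := by
    simp only [habs]
    rw [integral_const_mul, integral_comp_inv_smul_sub (fun y => |v y| ^ q) x₀ hr, mul_assoc]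
  have hvol : volume.real (Metric.ball x₀ r) = r ^ N * b := by
    rw [measureReal_def, Measure.addHaar_ball_of_pos _ _ hr, finrank_euclideanSpace_fin,
      ENNReal.toReal_mul, ENNReal.toReal_ofReal (by positivity)]
    rfl
  have hsmall := measureReal_inter_ball_le_of_density hr hAm
    (Set.disjoint_left.mpr fun x hx hx' => hx'.2 hx.2)
    (hr₁s ⟨hr, hrr.trans_le (min_le_left _ _)⟩)
  have hrem : ∫ x in Ω ∩ {x | u x ≠ 0}, |rescaledBump v x₀ c r x| ^ q ≤
      c ^ q * M ^ q * (ε * (r ^ N * b)) := by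
    have h0 : ∀ x ∈ (Ω ∩ {x | u x ≠ 0}) \ (Ω ∩ {x | u x ≠ 0} ∩ Metric.ball x₀ r),
        |rescaledBump v x₀ c r x| ^ q = 0 := fun x hx => by
      rw [rescaledBump_eq_zero hvball c hr fun h => hx.2 ⟨hx.1, h⟩, abs_zero,
        Real.zero_rpow hq0.ne']
    rw [setIntegral_eq_of_subset_of_forall_sdiff_eq_zero hAm inter_subset_left h0]
    refine (Real.le_norm_self _).trans ((norm_setIntegral_le_of_norm_le_const
      ((measure_mono inter_subset_right).trans_lt measure_ball_lt_top)
      fun x _ => ?_).trans (mul_le_mul_of_nonneg_left (hvol ▸ hsmall) (by positivity)))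
    rw [Real.norm_of_nonneg (by positivity), habs]
    exact mul_le_mul_of_nonneg_left
      (Real.rpow_le_rpow (abs_nonneg _) (hM _) hq0.le) (by positivity)
  rw [hI, hJ] at hle
  have hrem' := mul_le_mul_of_nonneg_left hrem (one_div_nonneg.mpr hq0.le)
  have hfinal : c ^ q * r ^ N *
      ((1 / 2) * I - (1 / q) * J + ε * ((1 / q) * (M ^ q * b))) < 0 :=
    mul_neg_of_pos_of_neg (by positivity) hεneg
  linarith
end

section
/- Let Ω ⊂ ℝ^N be a bounded open set, and let u ∈ C¹(Ω) be bounded with ∫_Ω |∇u|² dx < ∞ and satisfy ∫_Ω ∇u·∇f dx = ∫_Ω sgn(u) f dx for every f ∈ C_c^∞(Ω). Let x₀ ∈ Ω be a point of density one for the zero set u⁻¹(0). Let v be a C² function on ℝ^N with compact support contained in the open unit ball B₁(0) such that (1/2)∫_{B₁(0)} |∇v|² dx − ∫_{B₁(0)} |v| dx < 0. For r > 0 define v_r : Ω → ℝ by v_r(x) = r² v((x−x₀)/r) for x ∈ B_r(x₀) ∩ Ω and v_r(x) = 0 otherwise. Then there exists r₀ > 0 such that B_{r₀}(x₀) ⊂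 Ω and φ(u+v_r) < φ(u) for every r ∈ (0, r₀), where φ(w) = (1/2)∫_Ω |∇w|² dx − ∫_Ω |w| dx. -/
open MeasureTheory Set Filter
open scoped RealInnerProductSpace

attribute [local instance] Classical.propDecidable

/-- The energy functional `φ(w) = (1/2)∫_Ω |∇w|² dx - ∫_Ω |w| dx` (case `q = 1`). -/
noncomputable def energy1 {N : ℕ} (Ω : Set (EuclideanSpace ℝ (Fin N)))
    (w : EuclideanSpace ℝ (Fin N) → ℝ) : ℝ :=
  (1 / 2) * (∫ x in Ω, ‖gradient w x‖ ^ 2) - ∫ x in Ω, |w x|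

open scoped ContDiff Convolution in
/-- A compactly supported `C¹` function is approximated in the `C¹` norm by smooth functions whose
supports stay inside a prescribed neighbourhood of its support. -/
theorem exists_contDiff_approx_fderiv {E : Type*} [NormedAddCommGroup E]
    [NormedSpace ℝ E] [FiniteDimensional ℝ E] [MeasurableSpace E] [BorelSpace E]
    {f : E → ℝ} (hf : ContDiff ℝ 1 f) (hc : HasCompactSupport f) {U : Set E} (hU : IsOpen U)
    (hfU : tsupport f ⊆ U) {ε : ℝ} (hε : 0 < ε) :
    ∃ g : E → ℝ, ContDiff ℝ ∞ g ∧ HasCompactSupport g ∧ tsupport g ⊆ U ∧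
      (∀ x, ‖g x - f x‖ ≤ ε) ∧ ∀ x, ‖fderiv ℝ g x - fderiv ℝ f x‖ ≤ ε := by
  let μ : Measure E := Measure.addHaar
  have hfc : Continuous f := hf.continuous
  have hdc : Continuous (fderiv ℝ f) := hf.continuous_fderiv one_ne_zero
  obtain ⟨δ₀, hδ₀, hU₀⟩ := hc.isCompact.exists_cthickening_subset_open hU hfU
  obtain ⟨δ₁, hδ₁, h₁⟩ := Metric.uniformContinuous_iff.1
    (hc.uniformContinuous_of_continuous hfc) ε hε
  obtain ⟨δ₂, hδ₂, h₂⟩ := Metric.uniformContinuous_iff.1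
    ((hc.fderiv ℝ).uniformContinuous_of_continuous hdc) ε hε
  have hδ : 0 < min δ₀ (min δ₁ δ₂) := lt_min hδ₀ (lt_min hδ₁ hδ₂)
  let φ : ContDiffBump (0 : E) :=
    ⟨min δ₀ (min δ₁ δ₂) / 2, min δ₀ (min δ₁ δ₂), half_pos hδ, half_lt_self hδ⟩
  have hφ : φ.rOut = min δ₀ (min δ₁ δ₂) := rfl
  let g : E → ℝ := φ.normed μ ⋆[ContinuousLinearMap.lsmul ℝ ℝ, μ] f
  have hli : LocallyIntegrable (φ.normed μ) μ := φ.continuous_normed.locallyIntegrable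
  have hsupp : Function.support g ⊆ Metric.cthickening δ₀ (tsupport f) := by
    refine (support_convolution_subset _).trans ?_
    rw [φ.support_normed_eq]
    rintro _ ⟨y, hy, z, hz, rfl⟩
    refine Metric.mem_cthickening_of_dist_le _ z _ _ (subset_tsupport f hz) ?_
    have : ‖y‖ < φ.rOut := by simpa using hy
    simpa using this.le.trans (hφ ▸ min_le_left _ _)
  have htsupp : tsupport g ⊆ Metric.cthickening δ₀ (tsupport f) :=
    closure_minimal hsupp Metric.isClosed_cthickening
  have hderiv (x : E) : HasFDerivAt g
      ((φ.normed μ ⋆[ContinuousLinearMap.lsmul ℝ ℝ, μ] fderiv ℝ f) x) x :=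
    hc.hasFDerivAt_convolution_right (ContinuousLinearMap.lsmul ℝ ℝ) hli hf x
  refine ⟨g, ?_, ?_, htsupp.trans hU₀, fun x => ?_, fun x => ?_⟩
  · exact φ.hasCompactSupport_normed.contDiff_convolution_left _ φ.contDiff_normed
      hfc.locallyIntegrable
  · exact hc.isCompact.cthickening.of_isClosed_subset (isClosed_tsupport g) htsupp
  · rw [← dist_eq_norm]
    exact φ.dist_normed_convolution_le hfc.aestronglyMeasurable fun y hy =>
      (h₁ (lt_of_lt_of_le hy (hφ ▸ (min_le_right _ _).trans (min_le_left _ _)))).le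
  · rw [(hderiv x).fderiv, ← dist_eq_norm]
    exact φ.dist_normed_convolution_le hdc.aestronglyMeasurable fun y hy =>
      (h₂ (lt_of_lt_of_le hy (hφ ▸ (min_le_right _ _).trans (min_le_right _ _)))).le

theorem norm_gradient_sub_gradient {E : Type*} [NormedAddCommGroup E] [InnerProductSpace ℝ E]
    [CompleteSpace E] (f g : E → ℝ) (x : E) :
    ‖gradient g x - gradient f x‖ = ‖fderiv ℝ g x - fderiv ℝ f x‖ := by
  rw [← toDual_gradient, ← toDual_gradient, ← map_sub, LinearIsometryEquiv.norm_map]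

theorem ContDiff.continuous_gradient {E : Type*} [NormedAddCommGroup E] [InnerProductSpace ℝ E]
    [CompleteSpace E] {f : E → ℝ} (hf : ContDiff ℝ 1 f) : Continuous (gradient f) :=
  (InnerProductSpace.toDual ℝ E).symm.continuous.comp (hf.continuous_fderiv one_ne_zero)

theorem HasCompactSupport.gradient {E : Type*} [NormedAddCommGroup E] [InnerProductSpace ℝ E]
    [CompleteSpace E] {f : E → ℝ} (hf : HasCompactSupport f) : HasCompactSupport (gradient f) :=
  (hf.fderiv ℝ).comp_left (map_zero _)

theorem gradient_eq_zero_of_notMem_tsupport {E : Type*} [NormedAddCommGroup E]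
    [InnerProductSpace ℝ E] [CompleteSpace E] {f : E → ℝ} {x : E} (hx : x ∉ tsupport f) :
    gradient f x = 0 := by
  have : fderiv ℝ f x = 0 := by
    by_contra h
    exact hx (support_fderiv_subset ℝ h)
  simp [gradient, this]

/-- A weak formulation tested against smooth functions extends to `C¹` test functions. -/
theorem integral_inner_gradient_eq_of_contDiff_one {E : Type*} [NormedAddCommGroup E]
    [InnerProductSpace ℝ E] [FiniteDimensional ℝ E] [MeasurableSpace E] [BorelSpace E]
    {μ : Measure E} [IsFiniteMeasureOnCompacts μ] {Ω : Set E} (hΩ : IsOpen Ω) {G : E → E} {s : E → ℝ}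
    (hG : IntegrableOn G Ω μ) (hs : IntegrableOn s Ω μ)
    (hpde : ∀ f : E → ℝ, ContDiff ℝ (⊤ : ℕ∞) f → HasCompactSupport f → tsupport f ⊆ Ω →
      (∫ x in Ω, ⟪G x, gradient f x⟫ ∂μ) = ∫ x in Ω, s x * f x ∂μ)
    {f : E → ℝ} (hf : ContDiff ℝ 1 f) (hc : HasCompactSupport f) (hfΩ : tsupport f ⊆ Ω) :
    (∫ x in Ω, ⟪G x, gradient f x⟫ ∂μ) = ∫ x in Ω, s x * f x ∂μ := by
  have key (ε : ℝ) (hε : 0 < ε) : |(∫ x in Ω, ⟪G x, gradient f x⟫ ∂μ) - ∫ x in Ω, s x * f x ∂μ| ≤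
      ((∫ x in Ω, ‖G x‖ ∂μ) + ∫ x in Ω, ‖s x‖ ∂μ) * ε := by
    obtain ⟨g, hg, hgc, hgΩ, h₀, h₁⟩ := exists_contDiff_approx_fderiv hf hc hΩ hfΩ hε
    have hint {h : E → ℝ} (hh : ContDiff ℝ 1 h) (hhc : HasCompactSupport h) :
        IntegrableOn (fun x => ⟪G x, gradient h x⟫) Ω μ := by
      obtain ⟨C, hC⟩ := hhc.gradient.exists_bound_of_continuous hh.continuous_gradient
      refine (hG.norm.mul_const C).mono'
        (hG.aestronglyMeasurable.inner hh.continuous_gradient.aestronglyMeasurable) ?_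
      exact .of_forall fun x => (norm_inner_le_norm _ _).trans (by gcongr; exact hC x)
    have hint' {h : E → ℝ} (hh : ContDiff ℝ 1 h) (hhc : HasCompactSupport h) :
        IntegrableOn (fun x => s x * h x) Ω μ := by
      obtain ⟨C, hC⟩ := hhc.exists_bound_of_continuous hh.continuous
      refine (hs.norm.mul_const C).mono'
        (hs.aestronglyMeasurable.mul hh.continuous.aestronglyMeasurable) ?_
      exact .of_forall fun x => (norm_mul_le _ _).trans (by gcongr; exact hC x)
    have hg1 : ContDiff ℝ 1 g := hg.of_le (by exact_mod_cast le_top)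
    have e₁ : |(∫ x in Ω, ⟪G x, gradient g x⟫ ∂μ) - ∫ x in Ω, ⟪G x, gradient f x⟫ ∂μ| ≤
        (∫ x in Ω, ‖G x‖ ∂μ) * ε := by
      rw [← integral_sub (hint hg1 hgc) (hint hf hc), ← integral_mul_const]
      rw [← Real.norm_eq_abs]
      refine norm_integral_le_of_norm_le (hG.norm.mul_const ε) (.of_forall fun x => ?_)
      rw [← inner_sub_right]
      refine (norm_inner_le_norm _ _).trans ?_
      gcongr
      rw [norm_gradient_sub_gradient]
      exact h₁ x
    have e₂ : |(∫ x in Ω, s x * g x ∂μ) - ∫ x in Ω, s x * f x ∂μ| ≤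
        (∫ x in Ω, ‖s x‖ ∂μ) * ε := by
      rw [← integral_sub (hint' hg1 hgc) (hint' hf hc), ← integral_mul_const]
      rw [← Real.norm_eq_abs]
      refine norm_integral_le_of_norm_le (hs.norm.mul_const ε) (.of_forall fun x => ?_)
      rw [← mul_sub]
      exact (norm_mul_le _ _).trans (by gcongr; exact h₀ x)
    have e₃ := hpde g hg hgc hgΩ
    rw [abs_le] at *
    constructor <;> linarith
  have hlim : Tendsto (fun ε : ℝ => ((∫ x in Ω, ‖G x‖ ∂μ) + ∫ x in Ω, ‖s x‖ ∂μ) * ε)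
      (nhdsWithin 0 (Ioi 0)) (nhds 0) := by
    refine tendsto_nhdsWithin_of_tendsto_nhds ?_
    simpa using (continuous_const_mul
      ((∫ x in Ω, ‖G x‖ ∂μ) + ∫ x in Ω, ‖s x‖ ∂μ)).tendsto (0 : ℝ)
  have := ge_of_tendsto hlim (eventually_mem_nhdsWithin.mono key)
  exact sub_eq_zero.1 (abs_nonpos_iff.1 this)

theorem abs_add_sign_mul_add_ite_le_abs_add (a b : ℝ) :
    |a| + Real.sign a * b + (if a = 0 then |b| else 0) ≤ |a + b| := by
  rcases lt_trichotomy a 0 with h | rfl | h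
  · rw [Real.sign_of_neg h, if_neg h.ne, abs_of_neg h]
    linarith [neg_le_abs (a + b)]
  · simp
  · rw [Real.sign_of_pos h, if_neg h.ne', abs_of_pos h]
    linarith [le_abs_self (a + b)]

theorem measurable_real_sign : Measurable Real.sign := by
  unfold Real.sign
  exact Measurable.ite measurableSet_Iio measurable_const
    (Measurable.ite measurableSet_Ioi measurable_const measurable_const)

theorem abs_real_sign_le_one (a : ℝ) : |Real.sign a| ≤ 1 := by
  rcases Real.sign_apply_eq a with h | h | h <;> simp [h]

theorem measurableSet_zeros_of_continuousOn {E : Type*} [TopologicalSpace E] [MeasurableSpace E]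
    [OpensMeasurableSpace E] {Ω : Set E} (hΩ : IsOpen Ω) {u : E → ℝ} (hu : ContinuousOn u Ω) :
    MeasurableSet {x ∈ Ω | u x = 0} := by
  have h : {x ∈ Ω | u x = 0} = Ω \ (Ω ∩ u ⁻¹' {0}ᶜ) := by
    ext x
    simp
  rw [h]
  exact hΩ.measurableSet.diff (hu.isOpen_inter_preimage hΩ isOpen_compl_singleton).measurableSet

/-- Adding a compactly supported perturbation `w` to a weak solution of `-Δu = sgn(u)` changes the
energy by at most the Dirichlet energy of `w` minus the mass of `w` on the zero set of `u`. -/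
theorem energy1_add_le {N : ℕ} {Ω : Set (EuclideanSpace ℝ (Fin N))}
    (hΩo : IsOpen Ω) (hΩb : Bornology.IsBounded Ω)
    {u : EuclideanSpace ℝ (Fin N) → ℝ} (hu : ContDiffOn ℝ 1 u Ω)
    (hub : ∃ C : ℝ, ∀ x ∈ Ω, |u x| ≤ C)
    (hgrad : IntegrableOn (fun x => ‖gradient u x‖ ^ 2) Ω)
    (hpde : ∀ f : EuclideanSpace ℝ (Fin N) → ℝ, ContDiff ℝ (⊤ : ℕ∞) f → HasCompactSupport f →
      tsupport f ⊆ Ω →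
      (∫ x in Ω, ⟪gradient u x, gradient f x⟫) = ∫ x in Ω, Real.sign (u x) * f x)
    {w : EuclideanSpace ℝ (Fin N) → ℝ} (hw : ContDiff ℝ 1 w) (hwc : HasCompactSupport w)
    (hwΩ : tsupport w ⊆ Ω) :
    energy1 Ω (fun x => u x + w x) ≤
      energy1 Ω u + ((1 / 2) * (∫ x, ‖gradient w x‖ ^ 2) - ∫ x in {x ∈ Ω | u x = 0}, |w x|) := by
  have hΩm := hΩo.measurableSet
  have hfin : volume Ω < ⊤ := hΩb.measure_lt_top
  have : IsFiniteMeasure (volume.restrict Ω) := ⟨by simpa using hfin⟩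
  obtain ⟨C, hC⟩ := hub
  have hum : AEStronglyMeasurable u (volume.restrict Ω) :=
    hu.continuousOn.aestronglyMeasurable hΩm
  have huint : IntegrableOn u Ω :=
    Integrable.of_bound hum C ((ae_restrict_mem hΩm).mono hC)
  have hsint : IntegrableOn (fun x => Real.sign (u x)) Ω :=
    Integrable.of_bound (measurable_real_sign.comp_aemeasurable hum.aemeasurable).aestronglyMeasurable
      1 (.of_forall fun x => abs_real_sign_le_one _)
  have hGm : AEStronglyMeasurable (gradient u) (volume.restrict Ω) :=
    ((InnerProductSpace.toDual ℝ (EuclideanSpace ℝ (Fin N))).symm.continuous.comp_continuousOn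
      (hu.continuousOn_fderiv_of_isOpen hΩo le_rfl)).aestronglyMeasurable hΩm
  have hG : IntegrableOn (gradient u) Ω :=
    ((memLp_two_iff_integrable_sq_norm hGm).2 hgrad).integrable one_le_two
  have hweak := integral_inner_gradient_eq_of_contDiff_one hΩo hG hsint hpde hw hwc hwΩ
  have hwcont : Continuous w := hw.continuous
  have hdcont : Continuous (gradient w) := hw.continuous_gradient
  obtain ⟨M, hM⟩ := hwc.exists_bound_of_continuous hwcont
  obtain ⟨D, hD⟩ := hwc.gradient.exists_bound_of_continuous hdcont
  have hwint : Integrable w := hwcont.integrable_of_hasCompactSupport hwc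
  have hdint : Integrable (fun x => ‖gradient w x‖ ^ 2) := by
    simp only [sq]
    exact (hdcont.norm.mul hdcont.norm).integrable_of_hasCompactSupport hwc.gradient.norm.mul_right
  have hcross : IntegrableOn (fun x => ⟪gradient u x, gradient w x⟫) Ω :=
    (hG.norm.mul_const D).mono' (hG.aestronglyMeasurable.inner hdcont.aestronglyMeasurable)
      (.of_forall fun x => (norm_inner_le_norm _ _).trans (by gcongr; exact hD x))
  have hsw : IntegrableOn (fun x => Real.sign (u x) * w x) Ω :=
    (hsint.norm.mul_const M).mono' (hsint.aestronglyMeasurable.mul hwcont.aestronglyMeasurable)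
      (.of_forall fun x => (norm_mul_le _ _).trans (by gcongr; exact hM x))
  have hZm := measurableSet_zeros_of_continuousOn hΩo hu.continuousOn
  have hdir : ∫ x in Ω, ‖gradient (fun x => u x + w x) x‖ ^ 2 =
      (∫ x in Ω, ‖gradient u x‖ ^ 2) + 2 * (∫ x in Ω, ⟪gradient u x, gradient w x⟫) +
        ∫ x, ‖gradient w x‖ ^ 2 := by
    have hwhole : ∫ x, ‖gradient w x‖ ^ 2 = ∫ x in Ω, ‖gradient w x‖ ^ 2 := by
      refine (setIntegral_eq_integral_of_forall_compl_eq_zero fun x hx => ?_).symm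
      simp [gradient_eq_zero_of_notMem_tsupport fun h => hx (hwΩ h)]
    have hsum : IntegrableOn (fun x => ‖gradient u x‖ ^ 2 + 2 * ⟪gradient u x, gradient w x⟫) Ω :=
      hgrad.add (hcross.const_mul 2)
    rw [hwhole, ← integral_const_mul, ← integral_add hgrad (hcross.const_mul 2),
      ← integral_add hsum hdint.integrableOn]
    refine setIntegral_congr_fun hΩm fun x hx => ?_
    have hux : DifferentiableAt ℝ u x :=
      (hu.differentiableOn one_ne_zero).differentiableAt (hΩo.mem_nhds hx)
    have hwx : DifferentiableAt ℝ w x := hw.differentiable one_ne_zero x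
    have : gradient (fun x => u x + w x) x = gradient u x + gradient w x := by
      simp only [gradient, ← map_add]
      rw [← fderiv_add hux hwx]
      rfl
    simp only [this, norm_add_sq_real]
  have hmass : (∫ x in Ω, |u x|) + (∫ x in Ω, Real.sign (u x) * w x) +
      (∫ x in {x ∈ Ω | u x = 0}, |w x|) ≤ ∫ x in Ω, |u x + w x| := by
    have hZ : ∫ x in {x ∈ Ω | u x = 0}, |w x| =
        ∫ x in Ω, {x ∈ Ω | u x = 0}.indicator (fun x => |w x|) x := by
      rw [setIntegral_indicator hZm, inter_eq_right.2 (sep_subset _ _)]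
    have hI : IntegrableOn ({x ∈ Ω | u x = 0}.indicator (fun x => |w x|)) Ω :=
      (hwint.abs.indicator hZm).integrableOn
    have hsum : IntegrableOn (fun x => |u x| + Real.sign (u x) * w x) Ω := huint.abs.add hsw
    rw [hZ, ← integral_add huint.abs hsw, ← integral_add hsum hI]
    refine setIntegral_mono_on (hsum.add hI)
      (huint.add hwint.integrableOn).abs hΩm fun x hx => ?_
    convert! abs_add_sign_mul_add_ite_le_abs_add (u x) (w x) using 2
    simp [indicator, hx]
  unfold energy1
  rw [hdir]
  linarith

theorem eventually_measureReal_ball_diff_le {E : Type*} [PseudoMetricSpace E]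
    [MeasurableSpace E] [OpensMeasurableSpace E] [ProperSpace E] {μ : Measure E}
    [IsFiniteMeasureOnCompacts μ] [μ.IsOpenPosMeasure] {Z : Set E} (hZ : MeasurableSet Z) {x₀ : E}
    (hdens : Tendsto (fun r : ℝ => μ (Z ∩ Metric.ball x₀ r) / μ (Metric.ball x₀ r))
      (nhdsWithin 0 (Ioi 0)) (nhds 1)) {ε : ℝ} (hε : 0 < ε) :
    ∀ᶠ r in nhdsWithin (0 : ℝ) (Ioi 0),
      μ.real (Metric.ball x₀ r \ Z) ≤ ε * μ.real (Metric.ball x₀ r) := by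
  have h := (ENNReal.tendsto_toReal ENNReal.one_ne_top).comp hdens
  filter_upwards [h.eventually (lt_mem_nhds (show 1 - ε < (1 : ENNReal).toReal by simpa)),
    eventually_mem_nhdsWithin] with r hr hr0
  have hpos : 0 < μ.real (Metric.ball x₀ r) :=
    ENNReal.toReal_pos (Metric.measure_ball_pos μ x₀ hr0).ne' measure_ball_lt_top.ne
  simp only [Function.comp_apply, ENNReal.toReal_div] at hr
  have hr' := (lt_div_iff₀ hpos).1 hr
  have hsum := measureReal_inter_add_sdiff (μ := μ) (s := Metric.ball x₀ r) hZ
    measure_ball_lt_top.ne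
  rw [inter_comm] at hsum
  change _ < μ.real (Z ∩ Metric.ball x₀ r) at hr'
  linarith

section Rescaling

variable {E : Type*} [NormedAddCommGroup E]

theorem tsupport_comp_smul_sub_subset_ball [NormedSpace ℝ E] {v : E → ℝ}
    (hv : tsupport v ⊆ Metric.ball 0 1) (x₀ : E) {r : ℝ} (hr : 0 < r) :
    tsupport (fun x => r ^ 2 * v (r⁻¹ • (x - x₀))) ⊆ Metric.ball x₀ r := by
  intro x hx
  have hcont : Continuous fun x : E => r⁻¹ • (x - x₀) := by fun_prop
  have hmem : r⁻¹ • (x - x₀) ∈ tsupport v :=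
    tsupport_comp_subset_preimage v hcont (tsupport_mul_subset_right hx)
  have h := hv hmem
  rw [mem_ball_zero_iff, norm_smul, Real.norm_of_nonneg (inv_nonneg.2 hr.le),
    inv_mul_lt_one₀ hr] at h
  rwa [mem_ball_iff_norm]

theorem hasCompactSupport_comp_smul_sub [NormedSpace ℝ E] {v : E → ℝ} (hv : HasCompactSupport v)
    (x₀ : E) {r : ℝ} (hr : r ≠ 0) : HasCompactSupport fun x => r ^ 2 * v (r⁻¹ • (x - x₀)) :=
  (hv.comp_homeomorph ((Homeomorph.subRight x₀).trans
    (Homeomorph.smulOfNeZero r⁻¹ (inv_ne_zero hr)))).mul_left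

theorem integral_comp_inv_smul_sub_s6 [NormedSpace ℝ E] [FiniteDimensional ℝ E] [MeasurableSpace E]
    [BorelSpace E] (μ : Measure E) [μ.IsAddHaarMeasure] (f : E → ℝ) (x₀ : E) {r : ℝ}
    (hr : 0 < r) :
    ∫ x, f (r⁻¹ • (x - x₀)) ∂μ = r ^ Module.finrank ℝ E * ∫ x, f x ∂μ := by
  rw [integral_sub_right_eq_self (fun x => f (r⁻¹ • x)) x₀,
    Measure.integral_comp_inv_smul_of_nonneg μ f hr.le, smul_eq_mul]

theorem gradient_comp_smul_sub [InnerProductSpace ℝ E] [CompleteSpace E] {v : E → ℝ}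
    (hv : Differentiable ℝ v) (x₀ : E) {r : ℝ} (hr : r ≠ 0) (x : E) :
    gradient (fun x => r ^ 2 * v (r⁻¹ • (x - x₀))) x = r • gradient v (r⁻¹ • (x - x₀)) := by
  have h₁ : HasFDerivAt (fun x : E => r⁻¹ • (x - x₀)) (r⁻¹ • ContinuousLinearMap.id ℝ E) x :=
    ((hasFDerivAt_id x).sub_const x₀).const_smul r⁻¹
  have h₂ := ((hv (r⁻¹ • (x - x₀))).hasFDerivAt.comp x h₁).const_mul (r ^ 2)
  have h₃ : fderiv ℝ (fun x => r ^ 2 * v (r⁻¹ • (x - x₀))) x =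
      r • fderiv ℝ v (r⁻¹ • (x - x₀)) := by
    refine h₂.fderiv.trans ?_
    ext y
    simp
    field_simp
  simp [gradient, h₃]

end Rescaling

/-- Energy decreases by inserting suitably rescaled negative-energy bumps at a
density-one point of the zero set of a (weak) solution of `-Δu = sgn(u)`. -/
theorem statement6 {N : ℕ} (Ω : Set (EuclideanSpace ℝ (Fin N)))
    (hΩo : IsOpen Ω) (hΩb : Bornology.IsBounded Ω)
    (u : EuclideanSpace ℝ (Fin N) → ℝ) (hu : ContDiffOn ℝ 1 u Ω)
    (hub : ∃ C : ℝ, ∀ x ∈ Ω, |u x| ≤ C)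
    (hgrad : IntegrableOn (fun x => ‖gradient u x‖ ^ 2) Ω)
    (hpde : ∀ f : EuclideanSpace ℝ (Fin N) → ℝ, ContDiff ℝ (⊤ : ℕ∞) f → HasCompactSupport f →
      tsupport f ⊆ Ω →
      (∫ x in Ω, ⟪gradient u x, gradient f x⟫) = ∫ x in Ω, Real.sign (u x) * f x)
    (x₀ : EuclideanSpace ℝ (Fin N)) (hx₀ : x₀ ∈ Ω)
    (hdens : Tendsto
      (fun r : ℝ => volume ({x ∈ Ω | u x = 0} ∩ Metric.ball x₀ r) / volume (Metric.ball x₀ r))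
      (nhdsWithin 0 (Ioi 0)) (nhds 1))
    (v : EuclideanSpace ℝ (Fin N) → ℝ) (hv : ContDiff ℝ 2 v)
    (hvsupp : HasCompactSupport v) (hvball : tsupport v ⊆ Metric.ball 0 1)
    (hvneg : (1 / 2) * (∫ x in Metric.ball (0 : EuclideanSpace ℝ (Fin N)) 1, ‖gradient v x‖ ^ 2)
        - (∫ x in Metric.ball (0 : EuclideanSpace ℝ (Fin N)) 1, |v x|) < 0) :
    ∃ r₀ : ℝ, 0 < r₀ ∧ Metric.ball x₀ r₀ ⊆ Ω ∧ ∀ r : ℝ, 0 < r → r < r₀ →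
      energy1 Ω (fun x => u x +
          (if x ∈ Metric.ball x₀ r then r ^ (2 : ℕ) * v (r⁻¹ • (x - x₀)) else 0))
        < energy1 Ω u := by
  set Z : Set (EuclideanSpace ℝ (Fin N)) := {x ∈ Ω | u x = 0} with hZ
  have hZm : MeasurableSet Z := measurableSet_zeros_of_continuousOn hΩo hu.continuousOn
  have hv1 : ContDiff ℝ 1 v := hv.of_le one_le_two
  obtain ⟨M, hM⟩ := hvsupp.exists_bound_of_continuous hv.continuous
  have hM0 : 0 ≤ M := (norm_nonneg _).trans (hM 0)
  have hzero (x : EuclideanSpace ℝ (Fin N)) (hx : x ∉ Metric.ball 0 1) : v x = 0 :=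
    image_eq_zero_of_notMem_tsupport fun h => hx (hvball h)
  have hgzero (x : EuclideanSpace ℝ (Fin N)) (hx : x ∉ Metric.ball 0 1) : gradient v x = 0 :=
    gradient_eq_zero_of_notMem_tsupport fun h => hx (hvball h)
  rw [setIntegral_eq_integral_of_forall_compl_eq_zero fun x hx => by simp [hgzero x hx],
    setIntegral_eq_integral_of_forall_compl_eq_zero fun x hx => by simp [hzero x hx]] at hvneg
  set J : ℝ := (1 / 2) * (∫ x, ‖gradient v x‖ ^ 2) - ∫ x, |v x| with hJ
  set b : ℝ := volume.real (Metric.ball (0 : EuclideanSpace ℝ (Fin N)) 1)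
  have hb0 : 0 ≤ b := measureReal_nonneg
  obtain ⟨ε, hε, hεJ⟩ : ∃ ε : ℝ, 0 < ε ∧ J + M * b * ε < 0 := by
    have hpos : 0 < M * b + 1 := by positivity
    refine ⟨-J / (M * b + 1), div_pos (neg_pos.2 hvneg) hpos, ?_⟩
    have : (M * b + 1) * (-J / (M * b + 1)) = -J := mul_div_cancel₀ _ hpos.ne'
    have := div_pos (neg_pos.2 hvneg) hpos
    linarith
  obtain ⟨r₁, hr₁, hball⟩ := Metric.isOpen_iff.1 hΩo x₀ hx₀
  obtain ⟨r₂, hr₂, hsmall⟩ := mem_nhdsGT_iff_exists_Ioo_subset.1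
    (eventually_measureReal_ball_diff_le hZm hdens hε)
  refine ⟨min r₁ r₂, lt_min hr₁ hr₂,
    (Metric.ball_subset_ball (min_le_left _ _)).trans hball, fun r hr hrr => ?_⟩
  have hdiff : volume.real (Metric.ball x₀ r \ Z) ≤ ε * (r ^ N * b) := by
    have h : volume.real (Metric.ball x₀ r \ Z) ≤ ε * volume.real (Metric.ball x₀ r) :=
      hsmall ⟨hr, hrr.trans_le (min_le_right _ _)⟩
    rwa [measureReal_def volume (Metric.ball x₀ r), Measure.addHaar_ball_of_pos volume x₀ hr,
      ENNReal.toReal_mul, ENNReal.toReal_ofReal (by positivity), finrank_euclideanSpace_fin] at h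
  set w : EuclideanSpace ℝ (Fin N) → ℝ := fun x => r ^ 2 * v (r⁻¹ • (x - x₀)) with hw
  have hwball : tsupport w ⊆ Metric.ball x₀ r := tsupport_comp_smul_sub_subset_ball hvball x₀ hr
  have hwc : HasCompactSupport w := hasCompactSupport_comp_smul_sub hvsupp x₀ hr.ne'
  have hwd : ContDiff ℝ 1 w := by fun_prop
  have hwint : Integrable w := hwd.continuous.integrable_of_hasCompactSupport hwc
  have hwzero (x : EuclideanSpace ℝ (Fin N)) (hx : x ∉ Metric.ball x₀ r) : w x = 0 :=
    image_eq_zero_of_notMem_tsupport fun h => hx (hwball h)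
  have hite : (fun x => u x + (if x ∈ Metric.ball x₀ r then
      r ^ (2 : ℕ) * v (r⁻¹ • (x - x₀)) else 0)) = fun x => u x + w x := by
    funext x
    split_ifs with hx
    · rfl
    · rw [hwzero x hx]
  have hdirichlet : ∫ x, ‖gradient w x‖ ^ 2 = r ^ 2 * (r ^ N * ∫ x, ‖gradient v x‖ ^ 2) := by
    simp_rw [hw, gradient_comp_smul_sub (hv1.differentiable one_ne_zero) x₀ hr.ne', norm_smul,
      mul_pow, Real.norm_eq_abs, sq_abs]
    rw [integral_const_mul, integral_comp_inv_smul_sub_s6 volume (fun x => ‖gradient v x‖ ^ 2) x₀ hr,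
      finrank_euclideanSpace_fin]
  have hmass : ∫ x, |w x| = r ^ 2 * (r ^ N * ∫ x, |v x|) := by
    simp_rw [hw, abs_mul, abs_of_nonneg (sq_nonneg r)]
    rw [integral_const_mul, integral_comp_inv_smul_sub_s6 volume (fun x => |v x|) x₀ hr,
      finrank_euclideanSpace_fin]
  have hrest : ∫ x in Zᶜ, |w x| ≤ r ^ 2 * M * (ε * (r ^ N * b)) := by
    have hsub : Metric.ball x₀ r \ Z ⊆ Zᶜ := fun x hx => hx.2
    have hvanish (x) (hx : x ∈ Zᶜ \ (Metric.ball x₀ r \ Z)) : |w x| = 0 := by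
      rw [hwzero x fun h => hx.2 ⟨h, hx.1⟩, abs_zero]
    rw [setIntegral_eq_of_subset_of_forall_sdiff_eq_zero hZm.compl hsub hvanish]
    have hfin : volume (Metric.ball x₀ r \ Z) < ⊤ :=
      (measure_mono sdiff_subset).trans_lt measure_ball_lt_top
    have hle := norm_setIntegral_le_of_norm_le_const (f := fun x => |w x|) (C := r ^ 2 * M) hfin
      fun x _ => by
        rw [Real.norm_eq_abs, abs_abs, hw, abs_mul, abs_of_nonneg (sq_nonneg r)]
        exact mul_le_mul_of_nonneg_left (hM _) (sq_nonneg r)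
    exact (le_abs_self _).trans (hle.trans (by gcongr))
  have hsplit : (∫ x in Z, |w x|) + ∫ x in Zᶜ, |w x| = ∫ x, |w x| :=
    integral_add_compl hZm hwint.abs
  have hmain := energy1_add_le hΩo hΩb hu hub hgrad hpde hwd hwc (hwball.trans
    ((Metric.ball_subset_ball (hrr.le.trans (min_le_left _ _))).trans hball))
  rw [hite]
  refine hmain.trans_lt ?_
  rw [← hZ, hdirichlet]
  have hscale : r ^ 2 * r ^ N * (J + M * b * ε) < 0 :=
    mul_neg_of_pos_of_neg (by positivity) hεJ
  rw [hJ] at hscale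
  linarith
end

section
/- Let Ω ⊂ ℝ^N be an open set and let u ∈ C¹(Ω) satisfy ∫_Ω ∇u·∇f dx = ∫_Ω sgn(u) f dx for every f ∈ C_c^∞(Ω). Suppose x₀ ∈ Ω is a point of density one for the zero set u⁻¹(0) = {x ∈ Ω : u(x) = 0}. Then u(x)/|x−x₀|² → 0 as x → x₀ (x ≠ x₀). -/
open MeasureTheory Set Filter
open scoped RealInnerProductSpace

section RadialKernel

variable {E : Type*} [NormedAddCommGroup E]

/-- A smooth radial bump supported in the closed unit ball. -/
noncomputable def radialPotential (y : E) : ℝ := expNegInvGlue (1 - ‖y‖ ^ 2)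

/-- The nonnegative radial weight `w` with `∇ radialPotential y = -w(y) y`. -/
noncomputable def radialWeight (y : E) : ℝ :=
  2 * (((1 - ‖y‖ ^ 2)⁻¹) ^ 2 * expNegInvGlue (1 - ‖y‖ ^ 2))

lemma hasDerivAt_expNegInvGlue (t : ℝ) :
    HasDerivAt expNegInvGlue ((t⁻¹) ^ 2 * expNegInvGlue t) t := by
  simpa using expNegInvGlue.hasDerivAt_polynomial_eval_inv_mul 1 t

lemma continuous_radialWeight : Continuous (radialWeight : E → ℝ) := by
  have h := expNegInvGlue.continuous_polynomial_eval_inv_mul (Polynomial.X ^ 2)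
  simp only [Polynomial.eval_pow, Polynomial.eval_X] at h
  exact continuous_const.mul (h.comp (by fun_prop : Continuous fun y : E => 1 - ‖y‖ ^ 2))

lemma radialPotential_nonneg (y : E) : 0 ≤ radialPotential y := expNegInvGlue.nonneg _

lemma radialWeight_nonneg (y : E) : 0 ≤ radialWeight y := by
  have := expNegInvGlue.nonneg (1 - ‖y‖ ^ 2)
  unfold radialWeight
  positivity

lemma radialPotential_eq_zero {y : E} (hy : 1 ≤ ‖y‖) : radialPotential y = 0 :=
  expNegInvGlue.zero_of_nonpos (by nlinarith)

lemma radialWeight_eq_zero {y : E} (hy : 1 ≤ ‖y‖) : radialWeight y = 0 := by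
  simp [radialWeight, expNegInvGlue.zero_of_nonpos (show 1 - ‖y‖ ^ 2 ≤ 0 by nlinarith)]

lemma radialWeight_zero_pos : 0 < radialWeight (0 : E) := by
  have := expNegInvGlue.pos_of_pos one_pos
  simpa [radialWeight] using this

variable [InnerProductSpace ℝ E]

lemma add_smul_mem_ball {x y : E} {s R : ℝ} (hs : |s| ≤ R) (hR : 0 < R)
    (hy : y ∈ Metric.ball (0 : E) 1) : x + s • y ∈ Metric.ball x R := by
  have hy' : ‖y‖ < 1 := by simpa using hy
  rw [Metric.mem_ball, dist_eq_norm, add_sub_cancel_left, norm_smul, Real.norm_eq_abs]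
  nlinarith [norm_nonneg y, abs_nonneg s]

lemma hasFDerivAt_radialPotential (y : E) :
    HasFDerivAt (radialPotential : E → ℝ) (-(radialWeight y) • innerSL ℝ y) y := by
  have h := (hasDerivAt_expNegInvGlue (1 - ‖y‖ ^ 2)).comp_hasFDerivAt y
    (((hasFDerivAt_id y).norm_sq).const_sub 1)
  refine h.congr_fderiv ?_
  ext v
  simp [radialWeight]
  ring

lemma contDiff_radialPotential : ContDiff ℝ (⊤ : ℕ∞) (radialPotential : E → ℝ) :=
  expNegInvGlue.contDiff.comp (contDiff_const.sub (contDiff_norm_sq ℝ))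

variable [FiniteDimensional ℝ E]

lemma hasCompactSupport_radialWeight : HasCompactSupport (radialWeight : E → ℝ) :=
  HasCompactSupport.intro (isCompact_closedBall 0 1) fun y hy =>
    radialWeight_eq_zero (by simpa using (not_le.1 (by simpa using hy) : 1 < ‖y‖).le)

lemma hasCompactSupport_radialPotential : HasCompactSupport (radialPotential : E → ℝ) :=
  HasCompactSupport.intro (isCompact_closedBall 0 1) fun y hy =>
    radialPotential_eq_zero (by simpa using (not_le.1 (by simpa using hy) : 1 < ‖y‖).le)

lemma exists_radial_bound :
    ∃ C : ℝ, 0 < C ∧ (∀ y : E, radialWeight y ≤ C) ∧ ∀ y : E, radialPotential y ≤ C := by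
  obtain ⟨A, hA⟩ := hasCompactSupport_radialWeight.exists_bound_of_continuous
    (continuous_radialWeight (E := E))
  obtain ⟨B, hB⟩ := hasCompactSupport_radialPotential.exists_bound_of_continuous
    (contDiff_radialPotential (E := E)).continuous
  exact ⟨max 1 (max A B), by positivity,
    fun y => ((le_abs_self _).trans (hA y)).trans (by simp),
    fun y => ((le_abs_self _).trans (hB y)).trans (by simp)⟩

variable [MeasurableSpace E] [BorelSpace E]

lemma integral_ball_radialWeight_pos :
    0 < ∫ y in Metric.ball (0 : E) 1, radialWeight y := by
  rw [setIntegral_eq_integral_of_forall_compl_eq_zero fun y hy =>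
    radialWeight_eq_zero (by simpa using hy)]
  exact continuous_radialWeight.integral_pos_of_hasCompactSupport_nonneg_nonzero
    hasCompactSupport_radialWeight radialWeight_nonneg radialWeight_zero_pos.ne'

/-- Differentiating radial averages of a `C¹` function with respect to the radius. -/
lemma hasDerivAt_radialAverage {Ω : Set E} (hΩ : IsOpen Ω) {u : E → ℝ}
    (hu : ContDiffOn ℝ 1 u Ω) {x : E} {R s : ℝ} (hR : Metric.closedBall x R ⊆ Ω) (hs : |s| < R) :
    HasDerivAt (fun t : ℝ => ∫ y in Metric.ball (0 : E) 1, radialWeight y * u (x + t • y))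
      (∫ y in Metric.ball (0 : E) 1, radialWeight y * fderiv ℝ u (x + s • y) y) s := by
  have hR0 : 0 < R := (abs_nonneg s).trans_lt hs
  have hmem : ∀ t : ℝ, |t| ≤ R → ∀ y ∈ Metric.ball (0 : E) 1, x + t • y ∈ Ω := fun t ht y hy =>
    hR (Metric.ball_subset_closedBall (add_smul_mem_ball ht hR0 hy))
  have hdu : ContinuousOn (fderiv ℝ u) Ω := hu.continuousOn_fderiv_of_isOpen hΩ le_rfl
  obtain ⟨L, hL⟩ := (isCompact_closedBall x R).exists_bound_of_continuousOn (hdu.mono hR)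
  obtain ⟨K, hK⟩ := (isCompact_closedBall x R).exists_bound_of_continuousOn
    (hu.continuousOn.mono hR)
  obtain ⟨C, hC0, hC, -⟩ := exists_radial_bound (E := E)
  have hnhds : Metric.ball (0 : ℝ) R ∈ nhds s := Metric.isOpen_ball.mem_nhds (by simpa using hs)
  have hcont : ∀ t : ℝ, |t| ≤ R →
      ContinuousOn (fun y => radialWeight y * u (x + t • y)) (Metric.ball (0 : E) 1) :=
    fun t ht => continuous_radialWeight.continuousOn.mul
      (hu.continuousOn.comp (by fun_prop) (hmem t ht))
  have hmeas : ∀ t : ℝ, |t| ≤ R → AEStronglyMeasurable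
      (fun y => radialWeight y * u (x + t • y)) (volume.restrict (Metric.ball (0 : E) 1)) :=
    fun t ht => (hcont t ht).aestronglyMeasurable measurableSet_ball
  have hfin : volume (Metric.ball (0 : E) 1) < ⊤ := measure_ball_lt_top
  have : IsFiniteMeasure (volume.restrict (Metric.ball (0 : E) 1)) := ⟨by simpa using hfin⟩
  have hCabs : ∀ y : E, |radialWeight y| ≤ C := fun y => by
    rw [abs_of_nonneg (radialWeight_nonneg y)]; exact hC y
  refine (hasDerivAt_integral_of_dominated_loc_of_deriv_le
    (bound := fun _ => C * L)
    (F' := fun t y => radialWeight y * fderiv ℝ u (x + t • y) y) hnhds ?_ ?_ ?_ ?_ ?_ ?_).2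
  · filter_upwards [hnhds] with t ht
    exact hmeas t (by simpa using (Metric.mem_ball.1 ht).le)
  · refine Integrable.of_bound (hmeas s hs.le) (C * K) ?_
    refine (ae_restrict_iff' measurableSet_ball).2 (Eventually.of_forall fun y hy => ?_)
    rw [norm_mul]
    exact mul_le_mul (hCabs y)
      (hK _ (Metric.ball_subset_closedBall (add_smul_mem_ball hs.le hR0 hy)))
      (norm_nonneg _) hC0.le
  · refine ContinuousOn.aestronglyMeasurable ?_ measurableSet_ball
    exact continuous_radialWeight.continuousOn.mul
      ((hdu.comp (by fun_prop) (hmem s hs.le)).clm_apply continuousOn_id)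
  · refine (ae_restrict_iff' measurableSet_ball).2 (Eventually.of_forall fun y hy t ht => ?_)
    have ht' : |t| ≤ R := by simpa using (Metric.mem_ball.1 ht).le
    have hy' : ‖y‖ ≤ 1 := by simpa using (Metric.mem_ball.1 hy).le
    have hb := hL _ (Metric.ball_subset_closedBall (add_smul_mem_ball (x := x) ht' hR0 hy))
    rw [norm_mul]
    refine mul_le_mul (hCabs y) ?_ (norm_nonneg _) hC0.le
    calc ‖fderiv ℝ u (x + t • y) y‖ ≤ ‖fderiv ℝ u (x + t • y)‖ * ‖y‖ :=
          ContinuousLinearMap.le_opNorm _ _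
      _ ≤ L * 1 := mul_le_mul hb hy' (norm_nonneg _) ((norm_nonneg _).trans hb)
      _ = L := mul_one L
  · exact integrableOn_const hfin.ne
  · refine (ae_restrict_iff' measurableSet_ball).2 (Eventually.of_forall fun y hy t ht => ?_)
    have ht' : |t| ≤ R := by simpa using (Metric.mem_ball.1 ht).le
    have hdiff : DifferentiableAt ℝ u (x + t • y) :=
      (hu.differentiableOn one_ne_zero).differentiableAt (hΩ.mem_nhds (hmem t ht' y hy))
    have hline : HasDerivAt (fun t : ℝ => x + t • y) y t := by
      simpa using ((hasDerivAt_id t).smul_const y).const_add x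
    exact (hdiff.hasFDerivAt.comp_hasDerivAt t hline).const_mul _

/-- Rescaling an integral over a ball to the unit ball. -/
lemma setIntegral_eq_smul_integral_unit_ball {Ω : Set E} {x : E} {s : ℝ}
    (hs : 0 < s) (hb : Metric.ball x s ⊆ Ω) (G : E → ℝ)
    (hG : ∀ z ∉ Metric.ball x s, G z = 0) :
    ∫ z in Ω, G z = s ^ Module.finrank ℝ E * ∫ y in Metric.ball (0 : E) 1, G (x + s • y) := by
  rw [setIntegral_eq_integral_of_forall_compl_eq_zero fun z hz => hG z fun h => hz (hb h),
    setIntegral_eq_integral_of_forall_compl_eq_zero fun y hy => hG _ ?_]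
  · rw [Measure.integral_comp_smul volume (fun z => G (x + z)), integral_add_left_eq_self,
      abs_of_pos (by positivity), smul_eq_mul, mul_inv_cancel_left₀ (by positivity)]
  · intro h
    apply hy
    rw [Metric.mem_ball, dist_eq_norm, add_sub_cancel_left, norm_smul, Real.norm_eq_abs,
      abs_of_pos hs] at h
    rw [Metric.mem_ball, dist_zero_right]
    nlinarith

/-- Testing the weak equation with a rescaled radial bump. -/
lemma integral_radialWeight_fderiv_eq {Ω : Set E} {u g : E → ℝ}
    (hpde : ∀ f : E → ℝ, ContDiff ℝ (⊤ : ℕ∞) f → HasCompactSupport f → tsupport f ⊆ Ω →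
      (∫ x in Ω, ⟪gradient u x, gradient f x⟫) = ∫ x in Ω, g x * f x)
    {x : E} {s : ℝ} (hs : 0 < s) (hb : Metric.closedBall x s ⊆ Ω) :
    ∫ y in Metric.ball (0 : E) 1, radialWeight y * fderiv ℝ u (x + s • y) y =
      -s * ∫ y in Metric.ball (0 : E) 1, g (x + s • y) * radialPotential y := by
  set f : E → ℝ := fun z => radialPotential (s⁻¹ • (z - x)) with hf
  have hout : ∀ z ∉ Metric.ball x s, 1 ≤ ‖s⁻¹ • (z - x)‖ := fun z hz => by
    have hz' : s ≤ ‖z - x‖ := by simpa [dist_eq_norm] using hz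
    rw [norm_smul, Real.norm_eq_abs, abs_of_pos (inv_pos.2 hs), inv_mul_eq_div]
    exact (one_le_div hs).2 hz'
  have hsupp : Function.support f ⊆ Metric.closedBall x s := fun z hz => by
    by_contra h
    exact hz (radialPotential_eq_zero (hout z fun h' => h (Metric.ball_subset_closedBall h')))
  have htsupp : tsupport f ⊆ Metric.closedBall x s :=
    closure_minimal hsupp Metric.isClosed_closedBall
  have hcomp : HasCompactSupport f :=
    (isCompact_closedBall x s).of_isClosed_subset (isClosed_tsupport f) htsupp
  have hsmooth : ContDiff ℝ (⊤ : ℕ∞) f :=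
    contDiff_radialPotential.comp (contDiff_const.smul (contDiff_id.sub contDiff_const))
  have key := hpde f hsmooth hcomp (htsupp.trans hb)
  have hgrad : ∀ z, ⟪gradient u z, gradient f z⟫ =
      -s⁻¹ * (radialWeight (s⁻¹ • (z - x)) * fderiv ℝ u z (s⁻¹ • (z - x))) := fun z => by
    have hlin : HasFDerivAt (fun z : E => s⁻¹ • (z - x)) (s⁻¹ • ContinuousLinearMap.id ℝ E) z :=
      ((hasFDerivAt_id z).sub_const x).const_smul s⁻¹
    have hfd : HasFDerivAt f _ z := (hasFDerivAt_radialPotential _).comp z hlin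
    rw [inner_gradient_right, hfd.fderiv, ← inner_gradient_left, real_inner_comm]
    simp
  have hball := Metric.ball_subset_closedBall.trans hb
  simp_rw [hgrad] at key
  rw [setIntegral_eq_smul_integral_unit_ball hs hball _
      fun z hz => by rw [radialWeight_eq_zero (hout z hz)]; simp,
    setIntegral_eq_smul_integral_unit_ball hs hball _
      fun z hz => by rw [hf]; simp only [radialPotential_eq_zero (hout z hz), mul_zero]] at key
  have hsc : ∀ y : E, s⁻¹ • (x + s • y - x) = y := fun y => by
    rw [add_sub_cancel_left, smul_smul, inv_mul_cancel₀ hs.ne', one_smul]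
  simp only [hf, hsc] at key
  have key' := mul_left_cancel₀ (by positivity) key
  rw [integral_const_mul] at key'
  rw [← key']
  field_simp

/-- An integral over the unit ball is controlled by the measure of the set where the integrand
may be nonzero. -/
lemma abs_integral_unit_ball_le {p h : E → ℝ} {K : ℝ}
    (hK : ∀ y ∈ Metric.ball (0 : E) 1, |h y| ≤ K)
    (h0 : ∀ y ∈ Metric.ball (0 : E) 1, p y = 0 → h y = 0) :
    |∫ y in Metric.ball (0 : E) 1, h y| ≤
      K * volume.real {y ∈ Metric.ball (0 : E) 1 | p y ≠ 0} := by
  have hsub : {y ∈ Metric.ball (0 : E) 1 | p y ≠ 0} ⊆ Metric.ball (0 : E) 1 := fun y hy => hy.1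
  rw [setIntegral_eq_of_subset_of_forall_sdiff_eq_zero measurableSet_ball hsub fun y hy =>
    h0 y hy.1 (by_contra fun hp => hy.2 ⟨hy.1, hp⟩)]
  rw [← Real.norm_eq_abs]
  exact norm_setIntegral_le_of_norm_le_const ((measure_mono hsub).trans_lt measure_ball_lt_top)
    fun y hy => hK y hy.1

lemma volume_real_rescaled_le {Ω : Set E} {u : E → ℝ} {x : E} {s ρ : ℝ} (hs : 0 < s)
    (hsρ : s ≤ ρ) (hρ : Metric.ball x ρ ⊆ Ω) :
    volume.real {y ∈ Metric.ball (0 : E) 1 | u (x + s • y) ≠ 0} ≤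
      (s ^ Module.finrank ℝ E)⁻¹ * volume.real ({z ∈ Ω | u z ≠ 0} ∩ Metric.ball x ρ) := by
  set Z := {z ∈ Ω | u z ≠ 0} ∩ Metric.ball x ρ
  have hZ : volume Z ≠ ⊤ := ((measure_mono inter_subset_right).trans_lt measure_ball_lt_top).ne
  have hvol : volume ((s • ·) ⁻¹' ((x + ·) ⁻¹' Z)) =
      ENNReal.ofReal (s ^ Module.finrank ℝ E)⁻¹ * volume Z := by
    rw [Measure.addHaar_preimage_smul volume hs.ne', measure_preimage_add,
      abs_of_pos (by positivity)]
  have hsub : {y ∈ Metric.ball (0 : E) 1 | u (x + s • y) ≠ 0} ⊆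
      (s • ·) ⁻¹' ((x + ·) ⁻¹' Z) := fun y hy => by
    have := add_smul_mem_ball (x := x) ((abs_of_pos hs).trans_le hsρ) (hs.trans_le hsρ) hy.1
    exact ⟨⟨hρ this, hy.2⟩, this⟩
  calc volume.real {y ∈ Metric.ball (0 : E) 1 | u (x + s • y) ≠ 0}
      ≤ volume.real ((s • ·) ⁻¹' ((x + ·) ⁻¹' Z)) :=
        measureReal_mono hsub (by rw [hvol]; exact ENNReal.mul_ne_top ENNReal.ofReal_ne_top hZ)
    _ = _ := by
        rw [measureReal_def, hvol, ENNReal.toReal_mul, ENNReal.toReal_ofReal (by positivity),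
          measureReal_def]

/-- A quantitative mean value inequality for weak solutions of `-Δu = g` with `|g| ≤ 1` and
`g = 0` on the zero set of `u`. -/
lemma abs_le_of_weak_solution {Ω : Set E} (hΩ : IsOpen Ω) {u g : E → ℝ}
    (hu : ContDiffOn ℝ 1 u Ω) (hg : ∀ z, |g z| ≤ 1) (hg0 : ∀ z, u z = 0 → g z = 0)
    (hpde : ∀ f : E → ℝ, ContDiff ℝ (⊤ : ℕ∞) f → HasCompactSupport f → tsupport f ⊆ Ω →
      (∫ x in Ω, ⟪gradient u x, gradient f x⟫) = ∫ x in Ω, g x * f x)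
    {C : ℝ} (hC0 : 0 < C) (hCw : ∀ y : E, radialWeight y ≤ C)
    (hCp : ∀ y : E, radialPotential y ≤ C)
    {x : E} {ρ R θ M : ℝ} (hρ : 0 < ρ) (hρR : ρ < R) (hR : Metric.closedBall x R ⊆ Ω)
    (hθ : 0 < θ) (hθ1 : θ < 1) (hM : ∀ z ∈ Metric.ball x ρ, |u z| ≤ M) :
    (∫ y in Metric.ball (0 : E) 1, radialWeight y) * |u x| ≤
      C * M * ((ρ ^ Module.finrank ℝ E)⁻¹ *
          volume.real ({z ∈ Ω | u z ≠ 0} ∩ Metric.ball x ρ)) +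
        (θ * ρ) ^ 2 * (C * volume.real (Metric.ball (0 : E) 1)) +
        ρ ^ 2 * (C * (((θ * ρ) ^ Module.finrank ℝ E)⁻¹ *
          volume.real ({z ∈ Ω | u z ≠ 0} ∩ Metric.ball x ρ))) := by
  set A : ℝ → ℝ := fun t => ∫ y in Metric.ball (0 : E) 1, radialWeight y * u (x + t • y) with hA
  set A' : ℝ → ℝ := fun t =>
    ∫ y in Metric.ball (0 : E) 1, radialWeight y * fderiv ℝ u (x + t • y) y with hA'
  set D := volume.real ({z ∈ Ω | u z ≠ 0} ∩ Metric.ball x ρ)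
  have hD : 0 ≤ D := measureReal_nonneg
  have hρΩ : Metric.ball x ρ ⊆ Ω :=
    (Metric.ball_subset_closedBall.trans (Metric.closedBall_subset_closedBall hρR.le)).trans hR
  have hM0 : 0 ≤ M := (abs_nonneg _).trans (hM x (Metric.mem_ball_self hρ))
  have hderiv : ∀ t, |t| < R → HasDerivAt A (A' t) t := fun t ht =>
    hasDerivAt_radialAverage hΩ hu hR ht
  have hA'le : ∀ t, 0 < t → t ≤ ρ → |A' t| ≤
      t * (C * volume.real {y ∈ Metric.ball (0 : E) 1 | u (x + t • y) ≠ 0}) := by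
    intro t ht htρ
    have hsub : Metric.closedBall x t ⊆ Ω :=
      (Metric.closedBall_subset_closedBall (htρ.trans hρR.le)).trans hR
    simp only [hA']
    rw [integral_radialWeight_fderiv_eq hpde ht hsub, abs_mul, abs_neg, abs_of_pos ht]
    refine mul_le_mul_of_nonneg_left (abs_integral_unit_ball_le (fun y _ => ?_)
      fun y _ hy => by rw [hg0 _ hy, zero_mul]) ht.le
    rw [abs_mul, abs_of_nonneg (radialPotential_nonneg y)]
    calc _ ≤ 1 * C := mul_le_mul (hg _) (hCp y) (radialPotential_nonneg y) zero_le_one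
      _ = C := one_mul C
  have hslope : ∀ a b K, 0 ≤ a → a < b → b ≤ ρ → (∀ t ∈ Ioo a b, |A' t| ≤ K) →
      |A b - A a| ≤ (b - a) * K := by
    intro a b K ha hab hb hK
    have habs : ∀ t ∈ Icc a b, |t| < R := fun t ht => by
      rw [abs_of_nonneg (ha.trans ht.1)]; exact (ht.2.trans hb).trans_lt hρR
    obtain ⟨t, ht, hteq⟩ := exists_hasDerivAt_eq_slope A A' hab
      (fun t ht => (hderiv t (habs t ht)).continuousAt.continuousWithinAt)
      (fun t ht => hderiv t (habs t (Ioo_subset_Icc_self ht)))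
    have hba : 0 < b - a := sub_pos.2 hab
    rw [eq_div_iff hba.ne'] at hteq
    rw [← hteq, abs_mul, abs_of_pos hba, mul_comm]
    exact mul_le_mul_of_nonneg_left (hK t ht) hba.le
  have hθρ : 0 < θ * ρ := by positivity
  have hθρ1 : θ * ρ < ρ := by nlinarith
  have h0 : A 0 = (∫ y in Metric.ball (0 : E) 1, radialWeight y) * u x := by
    simp only [hA, zero_smul, add_zero]
    exact integral_mul_const _ _
  have h1 : |A ρ| ≤ C * M * ((ρ ^ Module.finrank ℝ E)⁻¹ * D) := by
    refine (abs_integral_unit_ball_le (p := fun y => u (x + ρ • y)) (K := C * M)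
      (fun y hy => ?_) fun y _ hy => by rw [hy, mul_zero]).trans
      (mul_le_mul_of_nonneg_left (volume_real_rescaled_le hρ le_rfl hρΩ) (by positivity))
    rw [abs_mul, abs_of_nonneg (radialWeight_nonneg y)]
    exact mul_le_mul (hCw y) (hM _ (add_smul_mem_ball (abs_of_pos hρ).le hρ hy))
      (abs_nonneg _) hC0.le
  have h2 : |A (θ * ρ) - A 0| ≤ (θ * ρ) ^ 2 * (C * volume.real (Metric.ball (0 : E) 1)) := by
    refine (hslope 0 (θ * ρ) (θ * ρ * (C * volume.real (Metric.ball (0 : E) 1))) le_rfl hθρ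
      hθρ1.le fun t ht => (hA'le t ht.1 (ht.2.trans hθρ1).le).trans ?_).trans_eq (by ring)
    have : volume.real {y ∈ Metric.ball (0 : E) 1 | u (x + t • y) ≠ 0} ≤
        volume.real (Metric.ball (0 : E) 1) :=
      measureReal_mono (fun y hy => hy.1) measure_ball_lt_top.ne
    have := ht.2.le
    gcongr
  have h3 : |A ρ - A (θ * ρ)| ≤ ρ ^ 2 * (C * (((θ * ρ) ^ Module.finrank ℝ E)⁻¹ * D)) := by
    refine (hslope (θ * ρ) ρ (ρ * (C * (((θ * ρ) ^ Module.finrank ℝ E)⁻¹ * D))) hθρ.le hθρ1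
      le_rfl fun t ht => ?_).trans ?_
    · have htpos := hθρ.trans ht.1
      refine (hA'le t htpos ht.2.le).trans ?_
      have hv := volume_real_rescaled_le (u := u) htpos ht.2.le hρΩ
      have hpow : (t ^ Module.finrank ℝ E)⁻¹ * D ≤ ((θ * ρ) ^ Module.finrank ℝ E)⁻¹ * D := by
        have := ht.1.le
        gcongr
      exact mul_le_mul ht.2.le (mul_le_mul_of_nonneg_left (hv.trans hpow) hC0.le)
        (by positivity) hρ.le
    · rw [sq, mul_assoc]
      exact mul_le_mul_of_nonneg_right (by linarith) (by positivity)
  have hc := (integral_ball_radialWeight_pos (E := E)).le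
  rw [← abs_of_nonneg hc, ← abs_mul, ← h0]
  have e : A 0 = A ρ - (A ρ - A (θ * ρ)) - (A (θ * ρ) - A 0) := by ring
  have := abs_sub (A ρ - (A ρ - A (θ * ρ))) (A (θ * ρ) - A 0)
  have := abs_sub (A ρ) (A ρ - A (θ * ρ))
  rw [← e] at *
  linarith

/-- The complement of a set with density one at a point has small measure in small balls. -/
lemma eventually_volume_nonzero_le {Ω : Set E} (hΩ : IsOpen Ω) {u : E → ℝ}
    (hu : ContinuousOn u Ω) {x₀ : E} (hx₀ : x₀ ∈ Ω)
    (hdens : Tendsto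
      (fun r : ℝ => volume ({x ∈ Ω | u x = 0} ∩ Metric.ball x₀ r) / volume (Metric.ball x₀ r))
      (nhdsWithin 0 (Ioi 0)) (nhds 1)) {ε : ℝ} (hε : 0 < ε) :
    ∀ᶠ r in nhdsWithin (0 : ℝ) (Ioi 0),
      volume.real ({x ∈ Ω | u x ≠ 0} ∩ Metric.ball x₀ r) ≤ ε * r ^ Module.finrank ℝ E := by
  obtain ⟨R, hR, hRΩ⟩ := Metric.isOpen_iff.1 hΩ x₀ hx₀
  set ω := volume.real (Metric.ball (0 : E) 1)
  have hω : 0 < ω := ENNReal.toReal_pos (Metric.measure_ball_pos _ _ one_pos).ne'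
    measure_ball_lt_top.ne
  have hlim := (ENNReal.tendsto_toReal ENNReal.one_ne_top).comp hdens
  have hev := hlim.eventually (lt_mem_nhds (show 1 - ε / ω < (1 : ENNReal).toReal by
    rw [ENNReal.toReal_one]; have := div_pos hε hω; linarith))
  have hopen : MeasurableSet {x ∈ Ω | u x ≠ 0} :=
    (hu.isOpen_inter_preimage hΩ isOpen_compl_singleton).measurableSet
  filter_upwards [hev, self_mem_nhdsWithin,
    mem_nhdsWithin_of_mem_nhds (Iio_mem_nhds hR)] with r hr hr0 hrR
  have hr0 : 0 < r := hr0
  have hball : volume.real (Metric.ball x₀ r) = r ^ Module.finrank ℝ E * ω := by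
    have := Measure.addHaar_ball_mul_of_pos volume x₀ hr0 1
    rw [mul_one] at this
    rw [measureReal_def, this, ENNReal.toReal_mul, ENNReal.toReal_ofReal (by positivity),
      ← measureReal_def]
  have hsplit := measureReal_inter_add_sdiff (μ := volume) (s := Metric.ball x₀ r) hopen
    measure_ball_lt_top.ne
  have hdiff : Metric.ball x₀ r \ {x ∈ Ω | u x ≠ 0} = {x ∈ Ω | u x = 0} ∩ Metric.ball x₀ r := by
    ext z
    have : z ∈ Metric.ball x₀ r → z ∈ Ω := fun hz => hRΩ (Metric.ball_subset_ball hrR.le hz)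
    simp only [Set.mem_sdiff, mem_ofPred_eq, mem_inter_iff]
    tauto
  rw [hdiff, inter_comm, hball] at hsplit
  simp only [Function.comp, ENNReal.toReal_div] at hr
  rw [← measureReal_def, ← measureReal_def, hball, lt_div_iff₀ (by positivity)] at hr
  have : (1 - ε / ω) * (r ^ Module.finrank ℝ E * ω) =
      r ^ Module.finrank ℝ E * ω - ε * r ^ Module.finrank ℝ E := by field_simp
  linarith

/-- The decay estimate from a ball to the concentric ball of half the radius. -/
lemma eventually_half_ball_estimate {Ω : Set E} (hΩ : IsOpen Ω) {u g : E → ℝ}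
    (hu : ContDiffOn ℝ 1 u Ω) (hg : ∀ z, |g z| ≤ 1) (hg0 : ∀ z, u z = 0 → g z = 0)
    (hpde : ∀ f : E → ℝ, ContDiff ℝ (⊤ : ℕ∞) f → HasCompactSupport f → tsupport f ⊆ Ω →
      (∫ x in Ω, ⟪gradient u x, gradient f x⟫) = ∫ x in Ω, g x * f x)
    {x₀ : E} (hx₀ : x₀ ∈ Ω)
    (hdens : Tendsto
      (fun r : ℝ => volume ({x ∈ Ω | u x = 0} ∩ Metric.ball x₀ r) / volume (Metric.ball x₀ r))
      (nhdsWithin 0 (Ioi 0)) (nhds 1)) {η : ℝ} (hη : 0 < η) :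
    ∀ᶠ r in nhdsWithin (0 : ℝ) (Ioi 0), ∀ M : ℝ, (∀ x ∈ Metric.ball x₀ r, |u x| ≤ M) →
      ∀ x ∈ Metric.ball x₀ (r / 2), |u x| ≤ M / 8 + η * r ^ 2 := by
  obtain ⟨C, hC0, hCw, hCp⟩ := exists_radial_bound (E := E)
  obtain ⟨R, hR, hRΩ⟩ := Metric.nhds_basis_closedBall.mem_iff.1 (hΩ.mem_nhds hx₀)
  set c := ∫ y in Metric.ball (0 : E) 1, radialWeight y with hcdef
  have hc : 0 < c := integral_ball_radialWeight_pos
  set ω := volume.real (Metric.ball (0 : E) 1)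
  have hω : 0 ≤ ω := measureReal_nonneg
  set n := Module.finrank ℝ E
  obtain ⟨θ, hθ, hθ1, hθη⟩ : ∃ θ : ℝ, 0 < θ ∧ θ < 1 ∧ θ * (C * ω) ≤ c * η := by
    refine ⟨min (1 / 2) (c * η / (C * ω + 1)), by positivity,
      (min_le_left _ _).trans_lt (by norm_num), ?_⟩
    calc _ ≤ c * η / (C * ω + 1) * (C * ω + 1) :=
          mul_le_mul (min_le_right _ _) (by linarith) (by positivity) (by positivity)
      _ = c * η := div_mul_cancel₀ _ (by positivity)
  obtain ⟨ε, hε, hε1, hε2⟩ : ∃ ε : ℝ, 0 < ε ∧ C * (2 ^ n * ε) ≤ c / 8 ∧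
      C * ((θ ^ n)⁻¹ * (2 ^ n * ε)) ≤ c * η := by
    refine ⟨min (c / 8 / (C * 2 ^ n)) (c * η / (C * ((θ ^ n)⁻¹ * 2 ^ n))), by positivity, ?_, ?_⟩
    · calc _ = (C * 2 ^ n) * min (c / 8 / (C * 2 ^ n)) (c * η / (C * ((θ ^ n)⁻¹ * 2 ^ n))) := by
            ring
        _ ≤ (C * 2 ^ n) * (c / 8 / (C * 2 ^ n)) := by gcongr; exact min_le_left _ _
        _ = _ := mul_div_cancel₀ _ (by positivity)
    · calc _ = (C * ((θ ^ n)⁻¹ * 2 ^ n)) *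
              min (c / 8 / (C * 2 ^ n)) (c * η / (C * ((θ ^ n)⁻¹ * 2 ^ n))) := by ring
        _ ≤ (C * ((θ ^ n)⁻¹ * 2 ^ n)) * (c * η / (C * ((θ ^ n)⁻¹ * 2 ^ n))) := by
            gcongr; exact min_le_right _ _
        _ = _ := mul_div_cancel₀ _ (by positivity)
  filter_upwards [eventually_volume_nonzero_le hΩ hu.continuousOn hx₀ hdens hε,
    self_mem_nhdsWithin, mem_nhdsWithin_of_mem_nhds (Iio_mem_nhds (half_pos hR))]
    with r hr hr0 hrR M hM x hx
  have hr0 : 0 < r := hr0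
  have hrR : r < R / 2 := hrR
  have hdist : dist x x₀ < r / 2 := hx
  have hsub : Metric.ball x (r / 2) ⊆ Metric.ball x₀ r :=
    Metric.ball_subset_ball' (by linarith)
  have hM0 : 0 ≤ M := (abs_nonneg _).trans (hM x₀ (Metric.mem_ball_self hr0))
  have hmain := abs_le_of_weak_solution hΩ hu hg hg0 hpde hC0 hCw hCp (half_pos hr0)
    (half_lt_self hr0) ((Metric.closedBall_subset_closedBall' (by linarith)).trans hRΩ)
    hθ hθ1 (fun z hz => hM z (hsub hz))
  set D := volume.real ({z ∈ Ω | u z ≠ 0} ∩ Metric.ball x (r / 2))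
  have hD : D ≤ ε * r ^ n := (measureReal_mono (inter_subset_inter_right _ hsub)
    ((measure_mono inter_subset_right).trans_lt measure_ball_lt_top).ne).trans hr
  have hD1 : ((r / 2) ^ n)⁻¹ * D ≤ 2 ^ n * ε := by
    rw [inv_mul_le_iff₀ (by positivity)]
    refine hD.trans_eq ?_
    rw [div_pow]
    field_simp
  have hD2 : ((θ * (r / 2)) ^ n)⁻¹ * D ≤ (θ ^ n)⁻¹ * (2 ^ n * ε) := by
    rw [mul_pow, mul_inv, mul_assoc]
    gcongr
  have t1 : C * M * (((r / 2) ^ n)⁻¹ * D) ≤ c * (M / 8) := by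
    calc _ ≤ C * M * (2 ^ n * ε) := by gcongr
      _ = M * (C * (2 ^ n * ε)) := by ring
      _ ≤ M * (c / 8) := by gcongr
      _ = _ := by ring
  have t2 : (θ * (r / 2)) ^ 2 * (C * ω) ≤ c * (η * r ^ 2 / 4) := by
    calc _ = θ * (θ * (C * ω)) * (r ^ 2 / 4) := by ring
      _ ≤ 1 * (c * η) * (r ^ 2 / 4) := by gcongr
      _ = _ := by ring
  have t3 : (r / 2) ^ 2 * (C * (((θ * (r / 2)) ^ n)⁻¹ * D)) ≤ c * (η * r ^ 2 / 4) := by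
    calc _ ≤ (r / 2) ^ 2 * (C * ((θ ^ n)⁻¹ * (2 ^ n * ε))) := by gcongr
      _ ≤ (r / 2) ^ 2 * (c * η) := by gcongr
      _ = _ := by ring
  have hpos : 0 ≤ c * (η * r ^ 2) := by positivity
  refine le_of_mul_le_mul_left ?_ hc
  linarith

end RadialKernel

/-- Iterating a half-ball decay estimate gives `o(r²)` decay. -/
lemma tendsto_div_norm_sq_of_half_ball_estimate {E : Type*} [NormedAddCommGroup E] {u : E → ℝ}
    {x₀ : E} (hcont : ContinuousAt u x₀)
    (hhalf : ∀ η > 0, ∀ᶠ r in nhdsWithin (0 : ℝ) (Ioi 0), ∀ M : ℝ,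
      (∀ x ∈ Metric.ball x₀ r, |u x| ≤ M) →
      ∀ x ∈ Metric.ball x₀ (r / 2), |u x| ≤ M / 8 + η * r ^ 2) :
    Tendsto (fun x => u x / ‖x - x₀‖ ^ 2) (nhdsWithin x₀ {x₀}ᶜ) (nhds 0) := by
  obtain ⟨R, hR, hbd⟩ : ∃ R > 0, ∀ x ∈ Metric.ball x₀ R, |u x| ≤ |u x₀| + 1 := by
    have h := hcont.abs.eventually (gt_mem_nhds (lt_add_one |u x₀|))
    obtain ⟨R, hR, h⟩ := Metric.eventually_nhds_iff_ball.1 h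
    exact ⟨R, hR, fun x hx => (h x hx).le⟩
  rw [Metric.tendsto_nhds]
  intro δ hδ
  set η := δ / 100
  have hη : 0 < η := by positivity
  obtain ⟨R', hR', hstep⟩ := (nhdsGT_basis (0 : ℝ)).eventually_iff.1 (hhalf η hη)
  set r₀ := min R R' / 2
  have hr₀ : 0 < r₀ := half_pos (lt_min hR hR')
  have hr₀R : r₀ < R := (half_lt_self (lt_min hR hR')).trans_le (min_le_left _ _)
  have hr₀R' : r₀ < R' := (half_lt_self (lt_min hR hR')).trans_le (min_le_right _ _)
  set A := 8 * (|u x₀| + 1) / r₀ ^ 3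
  have hA : 0 < A := by positivity
  have hiter : ∀ k : ℕ, ∀ r, r₀ / 2 ^ k < r → r ≤ r₀ →
      ∀ x ∈ Metric.ball x₀ r, |u x| ≤ (A * r + 8 * η) * r ^ 2 := by
    intro k
    induction k with
    | zero => intro r h1 h2; exact absurd h2 (not_le.2 (by simpa using h1))
    | succ k ih =>
      intro r h1 h2 x hx
      have hr : 0 < r := (by positivity : 0 < r₀ / 2 ^ (k + 1)).trans h1
      rcases le_or_gt r (r₀ / 2) with h | h
      · have h1' : r₀ / 2 ^ k < 2 * r := by
          rw [pow_succ, ← div_div] at h1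
          linarith
        have := hstep ⟨by positivity, by linarith⟩ _ (ih (2 * r) h1' (by linarith)) x
          (by rwa [mul_div_cancel_left₀ r two_ne_zero])
        refine this.trans_eq ?_
        ring
      · have hAr : |u x₀| + 1 ≤ A * r ^ 3 := by
          have : A * (r₀ / 2) ^ 3 = |u x₀| + 1 := by
            simp only [A]
            field_simp
            norm_num
          rw [← this]
          gcongr
        have h8 : 0 ≤ 8 * η * r ^ 2 := by positivity
        calc |u x| ≤ |u x₀| + 1 := hbd x (Metric.ball_subset_ball (h2.trans hr₀R.le) hx)
          _ ≤ A * r ^ 3 + 8 * η * r ^ 2 := by linarith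
          _ = _ := by ring
  have hdecay : ∀ r, 0 < r → r ≤ r₀ →
      ∀ x ∈ Metric.ball x₀ r, |u x| ≤ (A * r + 8 * η) * r ^ 2 := by
    intro r hr hrr
    obtain ⟨k, hk⟩ := exists_pow_lt_of_lt_one (div_pos hr hr₀) (by norm_num : (1 / 2 : ℝ) < 1)
    refine hiter k r ?_ hrr
    rw [lt_div_iff₀ hr₀] at hk
    calc r₀ / 2 ^ k = (1 / 2) ^ k * r₀ := by rw [one_div, inv_pow]; ring
      _ < r := hk
  have hrad : 0 < min (r₀ / 2) (η / A) := by positivity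
  filter_upwards [mem_nhdsWithin_of_mem_nhds (Metric.ball_mem_nhds x₀ hrad),
    self_mem_nhdsWithin] with x hx hne
  have hpos : 0 < ‖x - x₀‖ := norm_pos_iff.2 (sub_ne_zero.2 hne)
  rw [Metric.mem_ball, dist_eq_norm, lt_min_iff, lt_div_iff₀ hA] at hx
  have hb := hdecay (2 * ‖x - x₀‖) (by positivity) (by linarith [hx.1]) x
    (by rw [Metric.mem_ball, dist_eq_norm]; linarith)
  rw [dist_zero_right, norm_div, norm_pow, norm_norm, div_lt_iff₀ (by positivity)]
  refine hb.trans_lt ?_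
  have hηδ : 40 * η < δ := by simp only [η]; linarith
  calc (A * (2 * ‖x - x₀‖) + 8 * η) * (2 * ‖x - x₀‖) ^ 2
      = (2 * (‖x - x₀‖ * A) + 8 * η) * 4 * ‖x - x₀‖ ^ 2 := by ring
    _ < δ * ‖x - x₀‖ ^ 2 := by
      refine mul_lt_mul_of_pos_right ?_ (by positivity)
      linarith [hx.2]

/-- If `u ∈ C¹(Ω)` is a weak solution of `-Δu = sgn(u)` in the open set `Ω` and
`x₀ ∈ Ω` is a point of density one for the zero set of `u`, then `u(x) = o(|x-x₀|²)` as
`x → x₀`. -/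
theorem statement7 {N : ℕ} (Ω : Set (EuclideanSpace ℝ (Fin N))) (hΩo : IsOpen Ω)
    (u : EuclideanSpace ℝ (Fin N) → ℝ) (hu : ContDiffOn ℝ 1 u Ω)
    (hpde : ∀ f : EuclideanSpace ℝ (Fin N) → ℝ, ContDiff ℝ (⊤ : ℕ∞) f → HasCompactSupport f →
      tsupport f ⊆ Ω →
      (∫ x in Ω, ⟪gradient u x, gradient f x⟫) = ∫ x in Ω, Real.sign (u x) * f x)
    (x₀ : EuclideanSpace ℝ (Fin N)) (hx₀ : x₀ ∈ Ω)
    (hdens : Tendsto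
      (fun r : ℝ => volume ({x ∈ Ω | u x = 0} ∩ Metric.ball x₀ r) / volume (Metric.ball x₀ r))
      (nhdsWithin 0 (Ioi 0)) (nhds 1)) :
    Tendsto (fun x => u x / ‖x - x₀‖ ^ 2) (nhdsWithin x₀ {x₀}ᶜ) (nhds 0) := by
  have hsign : ∀ z, |Real.sign (u z)| ≤ 1 := fun z => by
    rcases Real.sign_apply_eq (u z) with h | h | h <;> simp [h]
  exact tendsto_div_norm_sq_of_half_ball_estimate
    (hu.continuousOn.continuousAt (hΩo.mem_nhds hx₀)) fun η hη =>
      eventually_half_ball_estimate hΩo hu hsign (fun z hz => by rw [hz, Real.sign_zero]) hpde hx₀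
        hdens hη
end

section
/- Let Ω ⊂ ℝ^N be an open set, 1 < q < 2, and let u ∈ C¹(Ω) be such that ∇u(x) ≠ 0 for every x ∈ Ω with u(x) = 0. Then for every i ∈ {1,…,N} and every f ∈ C_c^∞(Ω), ∫_Ω |u|^{q−2}u ∂_{x_i} f dx = −(q−1) ∫_Ω |u|^{q−2} (∂_{x_i} u) f dx, and the integral on the right converges absolutely. In other words, the function |u|^{q−2}u has distributional partial derivative (q−1)|u|^{q−2}∂_{x_i}u in Ω. -/
open MeasureTheory Set

open Filter Topology Function

/-- A smooth approximation, for `ε > 0`, of the signed power `t ↦ |t| ^ (2 * p) * t`. -/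
noncomputable def regPow (p ε t : ℝ) : ℝ := t * (t ^ 2 + ε) ^ p

/-- The derivative of `regPow p ε`. -/
noncomputable def regPowDeriv (p ε t : ℝ) : ℝ :=
  (t ^ 2 + ε) ^ p + 2 * p * (t ^ 2 * (t ^ 2 + ε) ^ (p - 1))

section RegPow

variable {p ε : ℝ}

theorem hasDerivAt_regPow (hε : 0 < ε) (t : ℝ) :
    HasDerivAt (regPow p ε) (regPowDeriv p ε t) t := by
  have h : HasDerivAt (fun t : ℝ => t ^ 2 + ε) (2 * t) t := by
    simpa using (hasDerivAt_pow 2 t).add_const ε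
  have hpos : 0 < t ^ 2 + ε := by positivity
  refine ((hasDerivAt_id t).mul (h.rpow_const (p := p) (Or.inl hpos.ne'))).congr_deriv ?_
  simp only [regPowDeriv, id]
  ring

theorem continuous_sq_add_rpow (p : ℝ) (hε : 0 < ε) :
    Continuous fun t : ℝ => (t ^ 2 + ε) ^ p :=
  (by fun_prop : Continuous fun t : ℝ => t ^ 2 + ε).rpow_const
    fun t => Or.inl (by positivity)

theorem continuous_regPow (hε : 0 < ε) : Continuous (regPow p ε) :=
  continuous_id.mul (continuous_sq_add_rpow p hε)

theorem continuous_regPowDeriv (hε : 0 < ε) : Continuous (regPowDeriv p ε) :=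
  (continuous_sq_add_rpow p hε).add
    (continuous_const.mul ((continuous_pow 2).mul (continuous_sq_add_rpow (p - 1) hε)))

theorem sq_mul_rpow_sub_one_le (hε : 0 < ε) (t : ℝ) :
    t ^ 2 * (t ^ 2 + ε) ^ (p - 1) ≤ (t ^ 2 + ε) ^ p := by
  have hpos : 0 < t ^ 2 + ε := by positivity
  rw [Real.rpow_sub_one hpos.ne', mul_div_assoc', div_le_iff₀ hpos, mul_comm]
  have := Real.rpow_nonneg hpos.le p
  gcongr
  linarith

theorem le_regPowDeriv (hp : p < 0) (hε : 0 < ε) (t : ℝ) :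
    (1 + 2 * p) * (t ^ 2 + ε) ^ p ≤ regPowDeriv p ε t := by
  have := sq_mul_rpow_sub_one_le (p := p) hε t
  unfold regPowDeriv
  nlinarith

theorem regPowDeriv_le (hp : p < 0) (hε : 0 < ε) (t : ℝ) :
    regPowDeriv p ε t ≤ (t ^ 2 + ε) ^ p := by
  have : 0 ≤ t ^ 2 * (t ^ 2 + ε) ^ (p - 1) := by positivity
  unfold regPowDeriv
  nlinarith

theorem sq_rpow_eq_abs_rpow (p t : ℝ) : (t ^ 2) ^ p = |t| ^ (2 * p) := by
  rw [← sq_abs, Real.rpow_mul (abs_nonneg t), Real.rpow_two]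

theorem sq_add_rpow_le (hp : p < 0) (hε : 0 < ε) {t : ℝ} (ht : t ≠ 0) :
    (t ^ 2 + ε) ^ p ≤ |t| ^ (2 * p) := by
  rw [← sq_rpow_eq_abs_rpow]
  exact Real.rpow_le_rpow_of_nonpos (by positivity) (by linarith) hp.le

theorem regPowDeriv_nonneg (hp : -(1 / 2) < p) (hp0 : p < 0) (hε : 0 < ε) (t : ℝ) :
    0 ≤ regPowDeriv p ε t :=
  (mul_nonneg (by linarith) (by positivity)).trans (le_regPowDeriv hp0 hε t)

theorem abs_rpow_mul_abs (hp : -(1 / 2) < p) (t : ℝ) :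
    |t| ^ (2 * p) * |t| = |t| ^ (2 * p + 1) := by
  rw [Real.rpow_add_one' (abs_nonneg t) (by linarith)]

theorem abs_regPow_le (hp : -(1 / 2) < p) (hp0 : p < 0) (hε : 0 < ε) (t : ℝ) :
    |regPow p ε t| ≤ |t| ^ (2 * p + 1) := by
  rw [← abs_rpow_mul_abs hp, regPow, abs_mul, mul_comm]
  rcases eq_or_ne t 0 with rfl | ht
  · simp
  · rw [abs_of_nonneg (by positivity : (0 : ℝ) ≤ (t ^ 2 + ε) ^ p)]
    gcongr
    exact sq_add_rpow_le hp0 hε ht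

variable {e : ℕ → ℝ}

theorem tendsto_sq_add_rpow (he : Tendsto e atTop (𝓝 0)) (p : ℝ) {t : ℝ} (ht : t ≠ 0) :
    Tendsto (fun n => (t ^ 2 + e n) ^ p) atTop (𝓝 ((t ^ 2) ^ p)) := by
  have h : Tendsto (fun n => t ^ 2 + e n) atTop (𝓝 (t ^ 2)) := by
    simpa using he.const_add (t ^ 2)
  exact h.rpow_const (Or.inl (by positivity))

theorem tendsto_regPow (he : Tendsto e atTop (𝓝 0)) (p t : ℝ) :
    Tendsto (fun n => regPow p (e n) t) atTop (𝓝 (|t| ^ (2 * p) * t)) := by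
  rcases eq_or_ne t 0 with rfl | ht
  · simp [regPow]
  · rw [← sq_rpow_eq_abs_rpow, mul_comm]
    exact (tendsto_sq_add_rpow he p ht).const_mul t

theorem tendsto_regPowDeriv (he : Tendsto e atTop (𝓝 0)) (p : ℝ) {t : ℝ} (ht : t ≠ 0) :
    Tendsto (fun n => regPowDeriv p (e n) t) atTop (𝓝 ((1 + 2 * p) * |t| ^ (2 * p))) := by
  have h := (tendsto_sq_add_rpow he p ht).add
    (((tendsto_sq_add_rpow he (p - 1) ht).const_mul (t ^ 2)).const_mul (2 * p))
  convert! h using 2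
  have : t ^ 2 ≠ 0 := by positivity
  rw [← sq_rpow_eq_abs_rpow, Real.rpow_sub_one this]
  field_simp

end RegPow

section Integral

variable {E : Type*} [NormedAddCommGroup E] {Ω : Set E} {u f : E → ℝ} {p ε : ℝ}

theorem ContinuousOn.continuous_mul_of_tsupport_subset (hΩ : IsOpen Ω) {F : E → ℝ}
    (hF : ContinuousOn F Ω) (hf : Continuous f) (hfΩ : tsupport f ⊆ Ω) :
    Continuous fun x => F x * f x :=
  continuous_of_tsupport fun _x hx =>
    (hF.continuousAt (hΩ.mem_nhds (hfΩ (tsupport_mul_subset_right hx)))).mul hf.continuousAt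

section Measure

variable [MeasurableSpace E] [BorelSpace E] {μ : Measure E}

theorem ContinuousOn.integrable_mul_of_tsupport_subset_s11 [IsFiniteMeasureOnCompacts μ]
    (hΩ : IsOpen Ω) {F : E → ℝ}
    (hF : ContinuousOn F Ω) (hf : Continuous f) (hfc : HasCompactSupport f)
    (hfΩ : tsupport f ⊆ Ω) : Integrable (fun x => F x * f x) μ :=
  (hF.continuous_mul_of_tsupport_subset hΩ hf hfΩ).integrable_of_hasCompactSupport
    hfc.mul_left

theorem ContinuousOn.aemeasurable_ofReal_sq_rpow {s : Set E} (hu : ContinuousOn u s)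
    (hs : MeasurableSet s) (p : ℝ) :
    AEMeasurable (fun x => ENNReal.ofReal (u x ^ 2) ^ p) (μ.restrict s) :=
  (((hu.aemeasurable hs).pow_const 2).ennreal_ofReal).pow_const p

theorem lintegral_ofReal_sq_rpow_le {s : Set E} (hu : ContinuousOn u s) (hs : MeasurableSet s)
    {C : ENNReal} (hC : ∀ ε > 0, ∫⁻ x in s, ENNReal.ofReal ((u x ^ 2 + ε) ^ p) ∂μ ≤ C) :
    ∫⁻ x in s, ENNReal.ofReal (u x ^ 2) ^ p ∂μ ≤ C := by
  let e : ℕ → ℝ := fun n => 1 / ((n : ℝ) + 1)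
  have he (n) : 0 < e n := Nat.one_div_pos_of_nat
  have he0 : Tendsto e atTop (𝓝 0) := tendsto_one_div_add_atTop_nhds_zero_nat
  have hlim (x) : Tendsto (fun n => ENNReal.ofReal ((u x ^ 2 + e n) ^ p)) atTop
      (𝓝 (ENNReal.ofReal (u x ^ 2) ^ p)) := by
    have h : Tendsto (fun n => u x ^ 2 + e n) atTop (𝓝 (u x ^ 2)) := by
      simpa using he0.const_add (u x ^ 2)
    refine ((ENNReal.continuous_rpow_const.tendsto _).comp (ENNReal.tendsto_ofReal h)).congr ?_
    intro n
    have := he n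
    exact ENNReal.ofReal_rpow_of_pos (by positivity)
  calc ∫⁻ x in s, ENNReal.ofReal (u x ^ 2) ^ p ∂μ
      = ∫⁻ x in s, liminf (fun n => ENNReal.ofReal ((u x ^ 2 + e n) ^ p)) atTop ∂μ := by
        simp_rw [fun x => (hlim x).liminf_eq]
    _ ≤ liminf (fun n => ∫⁻ x in s, ENNReal.ofReal ((u x ^ 2 + e n) ^ p) ∂μ) atTop :=
        lintegral_liminf_le' fun n =>
          ((((hu.aemeasurable hs).pow_const 2).add_const _).pow_const p).ennreal_ofReal
    _ ≤ C := liminf_le_of_frequently_le' (Frequently.of_forall fun n => hC _ (he n))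

end Measure

variable [NormedSpace ℝ E]

theorem ContDiffOn.continuousOn_fderiv_apply (hΩ : IsOpen Ω) (hu : ContDiffOn ℝ 1 u Ω) (v : E) :
    ContinuousOn (fun x => fderiv ℝ u x v) Ω :=
  (hu.continuousOn_fderiv_of_isOpen hΩ le_rfl).clm_apply continuousOn_const

theorem ContDiff.continuous_fderiv_apply_const (hf : ContDiff ℝ 1 f) (v : E) :
    Continuous fun x => fderiv ℝ f x v :=
  (hf.continuous_fderiv one_ne_zero).clm_apply continuous_const

variable [FiniteDimensional ℝ E] [MeasurableSpace E] [BorelSpace E] {μ : Measure E}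
  [μ.IsAddHaarMeasure]

theorem integral_regPow_mul_fderiv (hΩ : IsOpen Ω) (hu : ContDiffOn ℝ 1 u Ω) (hf : ContDiff ℝ 1 f)
    (hfc : HasCompactSupport f) (hfΩ : tsupport f ⊆ Ω) (hε : 0 < ε) (v : E) :
    ∫ x, regPow p ε (u x) * fderiv ℝ f x v ∂μ =
      -∫ x, regPowDeriv p ε (u x) * fderiv ℝ u x v * f x ∂μ := by
  have hd (x) (hx : x ∈ Ω) : HasFDerivAt (fun x => regPow p ε (u x))
      (regPowDeriv p ε (u x) • fderiv ℝ u x) x :=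
    (hasDerivAt_regPow hε (u x)).comp_hasFDerivAt x
      ((hu.differentiableOn one_ne_zero).differentiableAt (hΩ.mem_nhds hx)).hasFDerivAt
  have heq : (fun x => fderiv ℝ (fun x => regPow p ε (u x)) x v * f x) =
      fun x => regPowDeriv p ε (u x) * fderiv ℝ u x v * f x := by
    ext x
    by_cases hx : x ∈ tsupport f
    · rw [(hd x (hfΩ hx)).fderiv]
      simp
    · simp [image_eq_zero_of_notMem_tsupport hx]
  have hreg : ContinuousOn (fun x => regPow p ε (u x)) Ω :=
    (continuous_regPow hε).comp_continuousOn hu.continuousOn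
  rw [← heq]
  refine integral_mul_fderiv_eq_neg_fderiv_mul_of_integrable ?_ ?_ ?_
    (fun x hx => (hd x (hfΩ hx)).differentiableAt)
    (fun x _ => (hf.differentiable one_ne_zero) x)
  · rw [heq]
    exact (((continuous_regPowDeriv hε).comp_continuousOn hu.continuousOn).mul
      (hu.continuousOn_fderiv_apply hΩ v)).integrable_mul_of_tsupport_subset_s11 hΩ
      hf.continuous hfc hfΩ
  · exact hreg.integrable_mul_of_tsupport_subset_s11 hΩ (hf.continuous_fderiv_apply_const v)
      (hfc.fderiv_apply ℝ v) ((tsupport_fderiv_apply_subset ℝ v).trans hfΩ)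
  · exact hreg.integrable_mul_of_tsupport_subset_s11 hΩ hf.continuous hfc hfΩ

theorem integral_regPowDeriv_mul_le (hp : -(1 / 2) < p) (hp0 : p < 0)
    (hΩ : IsOpen Ω) (hu : ContDiffOn ℝ 1 u Ω) (hf : ContDiff ℝ 1 f)
    (hfc : HasCompactSupport f) (hfΩ : tsupport f ⊆ Ω) (hε : 0 < ε) (v : E) :
    ∫ x, regPowDeriv p ε (u x) * fderiv ℝ u x v * f x ∂μ ≤
      ∫ x, |u x| ^ (2 * p + 1) * |fderiv ℝ f x v| ∂μ := by
  have hcont : ContinuousOn (fun x => |u x| ^ (2 * p + 1)) Ω :=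
    hu.continuousOn.abs.rpow_const fun x _ => Or.inr (by linarith)
  have hint : Integrable (fun x => |u x| ^ (2 * p + 1) * |fderiv ℝ f x v|) μ := by
    refine (hcont.integrable_mul_of_tsupport_subset_s11 (μ := μ) hΩ (hf.continuous_fderiv_apply_const v)
      (hfc.fderiv_apply ℝ v) ((tsupport_fderiv_apply_subset ℝ v).trans hfΩ)).abs.congr ?_
    refine Eventually.of_forall fun x => ?_
    simp only [abs_mul, abs_of_nonneg (Real.rpow_nonneg (abs_nonneg (u x)) (2 * p + 1))]
  rw [← neg_neg (∫ x, _ ∂μ), ← integral_regPow_mul_fderiv hΩ hu hf hfc hfΩ hε v]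
  refine (neg_le_abs _).trans ((abs_integral_le_integral_abs).trans ?_)
  refine integral_mono_of_nonneg (Eventually.of_forall fun x => abs_nonneg _) hint
    (Eventually.of_forall fun x => ?_)
  simp only [abs_mul]
  gcongr
  exact abs_regPow_le hp hp0 hε _

theorem exists_nhds_lintegral_lt_top_of_fderiv_pos (hp : -(1 / 2) < p) (hp0 : p < 0)
    (hΩ : IsOpen Ω) (hu : ContDiffOn ℝ 1 u Ω) {x₀ v : E} (hx₀ : x₀ ∈ Ω)
    (hv : 0 < fderiv ℝ u x₀ v) :
    ∃ s ∈ 𝓝 x₀, ∫⁻ x in s, ENNReal.ofReal (u x ^ 2) ^ p ∂μ < ⊤ := by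
  set c := fderiv ℝ u x₀ v / 2 with hc
  have hc0 : 0 < c := by positivity
  have hnhds : {x | c < fderiv ℝ u x v} ∩ Ω ∈ 𝓝 x₀ :=
    inter_mem (((hu.continuousOn_fderiv_apply hΩ v).continuousAt
      (hΩ.mem_nhds hx₀)).eventually (lt_mem_nhds (by linarith))) (hΩ.mem_nhds hx₀)
  obtain ⟨φ, hφs, hφc, hφ, hφr, hφ1⟩ := exists_contDiff_tsupport_subset (n := 1) hnhds
  have hφ0 (x) : 0 ≤ φ x := (hφr (mem_range_self x)).1
  have hφΩ : tsupport φ ⊆ Ω := hφs.trans inter_subset_right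
  let s := {x | 1 / 2 < φ x}
  have hs : IsOpen s := isOpen_lt continuous_const hφ.continuous
  have hsφ : s ⊆ tsupport φ := fun x hx =>
    subset_tsupport φ (mem_support.2 (lt_trans (by norm_num) (mem_ofPred.1 hx)).ne')
  let k := 2 / (c * (1 + 2 * p))
  have hp1 : 0 < 1 + 2 * p := by linarith
  have hk : 0 < k := by positivity
  refine ⟨s, hs.mem_nhds (by simp [s, hφ1]; norm_num), lt_of_le_of_lt
    (lintegral_ofReal_sq_rpow_le (hu.continuousOn.mono (hsφ.trans hφΩ)) hs.measurableSet
      (C := ENNReal.ofReal (k * ∫ x, |u x| ^ (2 * p + 1) * |fderiv ℝ φ x v| ∂μ))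
      fun ε hε => ?_) ENNReal.ofReal_lt_top⟩
  have hnonneg (x) : 0 ≤ regPowDeriv p ε (u x) * fderiv ℝ u x v * φ x := by
    by_cases hx : x ∈ tsupport φ
    · have h1 := regPowDeriv_nonneg hp hp0 hε (u x)
      have h2 : c < fderiv ℝ u x v := (hφs hx).1
      have h3 := hφ0 x
      have h4 := hc0.trans h2
      positivity
    · simp [image_eq_zero_of_notMem_tsupport hx]
  have hint : Integrable (fun x => regPowDeriv p ε (u x) * fderiv ℝ u x v * φ x) μ :=
    (((continuous_regPowDeriv hε).comp_continuousOn hu.continuousOn).mul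
      (hu.continuousOn_fderiv_apply hΩ v)).integrable_mul_of_tsupport_subset_s11 hΩ
      hφ.continuous hφc hφΩ
  calc ∫⁻ x in s, ENNReal.ofReal ((u x ^ 2 + ε) ^ p) ∂μ
      ≤ ∫⁻ x in s, ENNReal.ofReal (k * (regPowDeriv p ε (u x) * fderiv ℝ u x v * φ x)) ∂μ := by
        refine setLIntegral_mono' hs.measurableSet fun x hx => ENNReal.ofReal_le_ofReal ?_
        have h1 := le_regPowDeriv hp0 hε (u x)
        have h2 : c < fderiv ℝ u x v := (hφs (hsφ hx)).1
        have h3 : 1 / 2 < φ x := hx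
        have h4 : 0 ≤ (u x ^ 2 + ε) ^ p := by positivity
        calc (u x ^ 2 + ε) ^ p = k * ((1 + 2 * p) * (u x ^ 2 + ε) ^ p * c * (1 / 2)) := by
              simp only [k]; field_simp
          _ ≤ _ := by
              have h5 := regPowDeriv_nonneg hp hp0 hε (u x)
              have h6 := hc0.trans h2
              gcongr
    _ ≤ ∫⁻ x, ENNReal.ofReal (k * (regPowDeriv p ε (u x) * fderiv ℝ u x v * φ x)) ∂μ :=
        setLIntegral_le_lintegral _ _
    _ = ENNReal.ofReal (k * ∫ x, regPowDeriv p ε (u x) * fderiv ℝ u x v * φ x ∂μ) := by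
        rw [← integral_const_mul, ofReal_integral_eq_lintegral_ofReal (hint.const_mul k)
          (Eventually.of_forall fun x => mul_nonneg hk.le (hnonneg x))]
    _ ≤ _ := ENNReal.ofReal_le_ofReal (mul_le_mul_of_nonneg_left
        (integral_regPowDeriv_mul_le hp hp0 hΩ hu hφ hφc hφΩ hε v) hk.le)

theorem exists_nhds_lintegral_lt_top (hp : -(1 / 2) < p) (hp0 : p < 0)
    (hΩ : IsOpen Ω) (hu : ContDiffOn ℝ 1 u Ω) {x₀ : E} (hx₀ : x₀ ∈ Ω)
    (hnd : u x₀ = 0 → fderiv ℝ u x₀ ≠ 0) :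
    ∃ s ∈ 𝓝 x₀, ∫⁻ x in s, ENNReal.ofReal (u x ^ 2) ^ p ∂μ < ⊤ := by
  by_cases h0 : u x₀ = 0
  · obtain ⟨v, hv⟩ : ∃ v : E, fderiv ℝ u x₀ v ≠ 0 := by
      by_contra! h
      exact hnd h0 (ContinuousLinearMap.ext h)
    rcases hv.lt_or_gt with hv | hv
    · exact exists_nhds_lintegral_lt_top_of_fderiv_pos (μ := μ) hp hp0 hΩ hu (v := -v) hx₀ (by simpa)
    · exact exists_nhds_lintegral_lt_top_of_fderiv_pos hp hp0 hΩ hu hx₀ hv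
  · have hcont : ContinuousAt (fun x => ENNReal.ofReal (u x ^ 2) ^ p) x₀ :=
      (ENNReal.continuous_rpow_const.comp (ENNReal.continuous_ofReal.comp
        (continuous_pow 2))).continuousAt.comp (hu.continuousOn.continuousAt (hΩ.mem_nhds hx₀))
    have hfin : ENNReal.ofReal (u x₀ ^ 2) ^ p < ⊤ := by
      rw [ENNReal.ofReal_rpow_of_pos (by positivity)]
      exact ENNReal.ofReal_lt_top
    obtain ⟨a, ha, ha'⟩ := exists_between hfin
    have hs := hcont.eventually (gt_mem_nhds ha)
    obtain ⟨t, ht, hto, hxt⟩ := mem_nhds_iff.1 (inter_mem hs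
      (Metric.ball_mem_nhds x₀ one_pos))
    refine ⟨t, hto.mem_nhds hxt, ?_⟩
    calc ∫⁻ x in t, ENNReal.ofReal (u x ^ 2) ^ p ∂μ ≤ ∫⁻ _ in t, a ∂μ :=
          setLIntegral_mono' hto.measurableSet fun x hx => (ht hx).1.le
      _ = a * μ t := setLIntegral_const _ _
      _ < ⊤ := ENNReal.mul_lt_top ha'
          ((measure_mono fun x hx => (ht hx).2).trans_lt measure_ball_lt_top)

theorem IsCompact.lintegral_ofReal_sq_rpow_lt_top (hp : -(1 / 2) < p) (hp0 : p < 0)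
    (hΩ : IsOpen Ω) (hu : ContDiffOn ℝ 1 u Ω) (hnd : ∀ x ∈ Ω, u x = 0 → fderiv ℝ u x ≠ 0)
    {K : Set E} (hK : IsCompact K) (hKΩ : K ⊆ Ω) :
    ∫⁻ x in K, ENNReal.ofReal (u x ^ 2) ^ p ∂μ < ⊤ := by
  refine hK.induction_on (p := fun s => ∫⁻ x in s, ENNReal.ofReal (u x ^ 2) ^ p ∂μ < ⊤)
    (by simp) (fun s t hst ht => (lintegral_mono_set hst).trans_lt ht)
    (fun s t hs ht => (lintegral_union_le _ s t).trans_lt (ENNReal.add_lt_top.2 ⟨hs, ht⟩))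
    fun x hx => ?_
  obtain ⟨s, hs, hs'⟩ := exists_nhds_lintegral_lt_top (μ := μ) hp hp0 hΩ hu (hKΩ hx)
    (hnd x (hKΩ hx))
  exact ⟨s, mem_nhdsWithin_of_mem_nhds hs, hs'⟩

theorem IsCompact.ae_ne_zero (hp : -(1 / 2) < p) (hp0 : p < 0)
    (hΩ : IsOpen Ω) (hu : ContDiffOn ℝ 1 u Ω) (hnd : ∀ x ∈ Ω, u x = 0 → fderiv ℝ u x ≠ 0)
    {K : Set E} (hK : IsCompact K) (hKΩ : K ⊆ Ω) : ∀ᵐ x ∂μ, x ∈ K → u x ≠ 0 := by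
  rw [← ae_restrict_iff' hK.measurableSet]
  filter_upwards [ae_lt_top' ((hu.continuousOn.mono hKΩ).aemeasurable_ofReal_sq_rpow
    hK.measurableSet p) (hK.lintegral_ofReal_sq_rpow_lt_top hp hp0 hΩ hu hnd hKΩ).ne]
    with x hx h0
  simp [h0, ENNReal.zero_rpow_of_neg hp0] at hx

theorem IsCompact.integrableOn_abs_rpow (hp : -(1 / 2) < p) (hp0 : p < 0)
    (hΩ : IsOpen Ω) (hu : ContDiffOn ℝ 1 u Ω) (hnd : ∀ x ∈ Ω, u x = 0 → fderiv ℝ u x ≠ 0)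
    {K : Set E} (hK : IsCompact K) (hKΩ : K ⊆ Ω) :
    IntegrableOn (fun x => |u x| ^ (2 * p)) K μ := by
  have hmeas := (hu.continuousOn.mono hKΩ).aemeasurable (μ := μ) hK.measurableSet
  refine ⟨((measurable_norm.comp_aemeasurable hmeas).pow_const (2 * p)).aestronglyMeasurable, ?_⟩
  rw [hasFiniteIntegral_iff_ofReal (Eventually.of_forall fun x => by positivity)]
  refine (lintegral_congr_ae ?_).trans_lt
    (hK.lintegral_ofReal_sq_rpow_lt_top hp hp0 hΩ hu hnd hKΩ)
  filter_upwards [(ae_restrict_iff' hK.measurableSet).2 (hK.ae_ne_zero hp hp0 hΩ hu hnd hKΩ)]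
    with x hx
  rw [ENNReal.ofReal_rpow_of_pos (by positivity), sq_rpow_eq_abs_rpow]

theorem integrable_abs_rpow_mul_fderiv_mul (hp : -(1 / 2) < p) (hp0 : p < 0)
    (hΩ : IsOpen Ω) (hu : ContDiffOn ℝ 1 u Ω) (hnd : ∀ x ∈ Ω, u x = 0 → fderiv ℝ u x ≠ 0)
    (hf : Continuous f) (hfc : HasCompactSupport f) (hfΩ : tsupport f ⊆ Ω) (v : E) :
    Integrable (fun x => |u x| ^ (2 * p) * fderiv ℝ u x v * f x) μ := by
  refine (integrableOn_iff_integrable_of_support_subset (s := tsupport f) fun x hx =>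
    subset_tsupport f (right_ne_zero_of_mul hx)).1 ?_
  simp_rw [mul_assoc]
  exact (hfc.isCompact.integrableOn_abs_rpow hp hp0 hΩ hu hnd hfΩ).mul_continuousOn
    (((hu.continuousOn_fderiv_apply hΩ v).mono hfΩ).mul hf.continuousOn) hfc.isCompact

/-- Integration by parts for the signed power `|u| ^ (2 * p) * u` against a test function. -/
theorem integral_abs_rpow_mul_fderiv (hp : -(1 / 2) < p) (hp0 : p < 0)
    (hΩ : IsOpen Ω) (hu : ContDiffOn ℝ 1 u Ω) (hnd : ∀ x ∈ Ω, u x = 0 → fderiv ℝ u x ≠ 0)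
    (hf : ContDiff ℝ 1 f) (hfc : HasCompactSupport f) (hfΩ : tsupport f ⊆ Ω) (v : E) :
    ∫ x, |u x| ^ (2 * p) * u x * fderiv ℝ f x v ∂μ =
      -(1 + 2 * p) * ∫ x, |u x| ^ (2 * p) * fderiv ℝ u x v * f x ∂μ := by
  let e : ℕ → ℝ := fun n => 1 / ((n : ℝ) + 1)
  have he (n) : 0 < e n := Nat.one_div_pos_of_nat
  have he0 : Tendsto e atTop (𝓝 0) := tendsto_one_div_add_atTop_nhds_zero_nat
  have hf'Ω : tsupport (fun x => fderiv ℝ f x v) ⊆ Ω :=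
    (tsupport_fderiv_apply_subset ℝ v).trans hfΩ
  have hint (n) : Integrable (fun x => regPow p (e n) (u x) * fderiv ℝ f x v) μ :=
    ((continuous_regPow (he n)).comp_continuousOn
      hu.continuousOn).integrable_mul_of_tsupport_subset_s11 hΩ (hf.continuous_fderiv_apply_const v)
      (hfc.fderiv_apply ℝ v) hf'Ω
  have hint' (n) : Integrable (fun x => regPowDeriv p (e n) (u x) * fderiv ℝ u x v * f x) μ :=
    (((continuous_regPowDeriv (he n)).comp_continuousOn hu.continuousOn).mul
      (hu.continuousOn_fderiv_apply hΩ v)).integrable_mul_of_tsupport_subset_s11 hΩ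
      hf.continuous hfc hfΩ
  have hbound : Integrable (fun x => |u x| ^ (2 * p + 1) * fderiv ℝ f x v) μ :=
    (hu.continuousOn.abs.rpow_const fun x _ =>
      Or.inr (by linarith)).integrable_mul_of_tsupport_subset_s11 hΩ
      (hf.continuous_fderiv_apply_const v) (hfc.fderiv_apply ℝ v) hf'Ω
  have hlim : Tendsto (fun n => ∫ x, regPow p (e n) (u x) * fderiv ℝ f x v ∂μ) atTop
      (𝓝 (∫ x, |u x| ^ (2 * p) * u x * fderiv ℝ f x v ∂μ)) := by
    refine tendsto_integral_of_dominated_convergence _ (fun n => (hint n).1) hbound.norm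
      (fun n => Eventually.of_forall fun x => ?_)
      (Eventually.of_forall fun x => (tendsto_regPow he0 p (u x)).mul_const _)
    rw [norm_mul, norm_mul, Real.norm_of_nonneg (by positivity : 0 ≤ |u x| ^ (2 * p + 1))]
    gcongr
    exact abs_regPow_le hp hp0 (he n) _
  have hlim' : Tendsto (fun n => ∫ x, regPowDeriv p (e n) (u x) * fderiv ℝ u x v * f x ∂μ) atTop
      (𝓝 (∫ x, (1 + 2 * p) * |u x| ^ (2 * p) * fderiv ℝ u x v * f x ∂μ)) := by
    have hne := hfc.isCompact.ae_ne_zero (μ := μ) hp hp0 hΩ hu hnd hfΩ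
    refine tendsto_integral_of_dominated_convergence _ (fun n => (hint' n).1)
      (integrable_abs_rpow_mul_fderiv_mul hp hp0 hΩ hu hnd hf.continuous hfc hfΩ v).norm
      (fun n => ?_) ?_
    · filter_upwards [hne] with x hx
      by_cases hxf : x ∈ tsupport f
      · simp only [norm_mul]
        gcongr
        rw [Real.norm_of_nonneg (regPowDeriv_nonneg hp hp0 (he n) _),
          Real.norm_of_nonneg (by positivity)]
        exact (regPowDeriv_le hp0 (he n) _).trans (sq_add_rpow_le hp0 (he n) (hx hxf))
      · simp [image_eq_zero_of_notMem_tsupport hxf]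
    · filter_upwards [hne] with x hx
      by_cases hxf : x ∈ tsupport f
      · exact ((tendsto_regPowDeriv he0 p (hx hxf)).mul_const _).mul_const _
      · simp [image_eq_zero_of_notMem_tsupport hxf]
  rw [tendsto_nhds_unique hlim (hlim'.neg.congr fun n =>
    (integral_regPow_mul_fderiv hΩ hu hf hfc hfΩ (he n) v).symm)]
  simp_rw [mul_assoc, integral_const_mul, neg_mul]

end Integral

/-- For `u ∈ C¹(Ω)` with nondegenerate zeros, `|u|^{q-2}u` has distributional
partial derivative `(q-1)|u|^{q-2} ∂ᵢu` in `Ω`: for every test function `f ∈ C_c^∞(Ω)`,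
`∫_Ω |u|^{q-2}u ∂ᵢf dx = -(q-1) ∫_Ω |u|^{q-2} (∂ᵢu) f dx`, the right-hand integral being
absolutely convergent. -/
theorem statement11 {N : ℕ} (Ω : Set (EuclideanSpace ℝ (Fin N))) (hΩo : IsOpen Ω)
    (q : ℝ) (hq1 : 1 < q) (hq2 : q < 2)
    (u : EuclideanSpace ℝ (Fin N) → ℝ) (hu : ContDiffOn ℝ 1 u Ω)
    (hnd : ∀ x ∈ Ω, u x = 0 → gradient u x ≠ 0) :
    ∀ i : Fin N, ∀ f : EuclideanSpace ℝ (Fin N) → ℝ,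
      ContDiff ℝ (⊤ : ℕ∞) f → HasCompactSupport f → tsupport f ⊆ Ω →
      IntegrableOn (fun x => |u x| ^ (q - 2) * fderiv ℝ u x (EuclideanSpace.single i 1) * f x) Ω ∧
      (∫ x in Ω, |u x| ^ (q - 2) * u x * fderiv ℝ f x (EuclideanSpace.single i 1))
        = -(q - 1) *
          ∫ x in Ω, |u x| ^ (q - 2) * fderiv ℝ u x (EuclideanSpace.single i 1) * f x := by
  intro i f hf hfc hfΩ
  have hnd' : ∀ x ∈ Ω, u x = 0 → fderiv ℝ u x ≠ 0 := fun x hx h0 h =>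
    hnd x hx h0 (by simp [gradient, h])
  have hp : -(1 / 2) < (q - 2) / 2 := by linarith
  have hp0 : (q - 2) / 2 < 0 := by linarith
  have hf1 : ContDiff ℝ 1 f := hf.of_le (by exact_mod_cast le_top)
  have hint := integrable_abs_rpow_mul_fderiv_mul (μ := volume) hp hp0 hΩo hu hnd' hf.continuous
    hfc hfΩ (EuclideanSpace.single i 1)
  have hparts := integral_abs_rpow_mul_fderiv (μ := volume) hp hp0 hΩo hu hnd' hf1
    hfc hfΩ (EuclideanSpace.single i 1)
  rw [mul_div_cancel₀ (q - 2) two_ne_zero] at hint hparts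
  refine ⟨hint.integrableOn, ?_⟩
  rw [setIntegral_eq_integral_of_forall_compl_eq_zero, hparts,
    setIntegral_eq_integral_of_forall_compl_eq_zero]
  · ring
  · intro x hx
    simp [image_eq_zero_of_notMem_tsupport fun h => hx (hfΩ h)]
  · intro x hx
    rw [image_eq_zero_of_notMem_tsupport (f := fun x => fderiv ℝ f x (EuclideanSpace.single i 1))
      fun h => hx (hfΩ (tsupport_fderiv_apply_subset ℝ _ h)), mul_zero]
end

section
/- Let N ≥ 3 be an integer, set a = 2^{−1/N}, and define u : [0,1] → ℝ by u(r) = (a² − r²)/(2N) for 0 ≤ r ≤ a and u(r) = (1/(2N)) ( (2/(N−2)) r^{2−N} + r² − 2^{−2/N}(N+2)/(N−2) ) for a ≤ r ≤ 1. Then: u is C¹ on [0,1] with u′(0) = u′(1) = 0; u(r) > 0 for 0 ≤ r < a, u(a) = 0, and u(r) < 0 for a < r ≤ 1; u″(r) + ((N−1)/r) u′(r) + sgn(u(r)) = 0 for every r ∈ (0,1] with r ≠ a; the radial extension U(x) = u(|x|) on the open unit ball B of ℝ^N satisfies λ({U > 0}) = λ({U < 0}) = ω_N/2; and ∫_B |∇U|²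 dx = ∫_B |U| dx = ω_N ( (2^{−2/N}−1)N + 2^{1−2/N} ) / ( (N−2)(N+2) ). In particular (1/2)∫_B |∇U|² dx − ∫_B |U| dx = −(ω_N/2) ( (2^{−2/N}−1)N + 2^{1−2/N} ) / ( (N−2)(N+2) ). -/
open MeasureTheory Set

attribute [local instance] Classical.propDecidable

/-- A function glued from two differentiable pieces with matching values and slopes at the
junction is differentiable. -/
lemma hasDerivAt_ite_le {f g f' g' : ℝ → ℝ} {a : ℝ} (hf : ∀ r, r ≤ a → HasDerivAt f (f' r) r)
    (hg : ∀ r, a ≤ r → HasDerivAt g (g' r) r) (hfg : f a = g a) (hfg' : f' a = g' a) (r : ℝ) :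
    HasDerivAt (fun s => if s ≤ a then f s else g s) (if r ≤ a then f' r else g' r) r := by
  rcases lt_trichotomy r a with h | rfl | h
  · rw [if_pos h.le]
    refine (hf r h.le).congr_of_eventuallyEq ?_
    filter_upwards [Iio_mem_nhds h] with s hs
    exact if_pos (le_of_lt hs)
  · rw [if_pos le_rfl]
    have h1 : HasDerivWithinAt (fun s => if s ≤ r then f s else g s) (f' r) (Iic r) r :=
      (hf r le_rfl).hasDerivWithinAt.congr (fun s hs => if_pos hs) (if_pos le_rfl)
    have h2 : HasDerivWithinAt (fun s => if s ≤ r then f s else g s) (f' r) (Ici r) r := by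
      rw [hfg']
      refine (hg r le_rfl).hasDerivWithinAt.congr (fun s hs => ?_) (by simp [hfg])
      rcases (mem_Ici.1 hs).eq_or_lt with rfl | h
      · simp [hfg]
      · exact if_neg h.not_ge
    have h3 := h1.union h2
    rw [Iic_union_Ici] at h3
    exact h3.hasDerivAt Filter.univ_mem
  · rw [if_neg h.not_ge]
    refine (hg r h.le).congr_of_eventuallyEq ?_
    filter_upwards [Ioi_mem_nhds h] with s hs
    exact if_neg (not_le_of_gt hs)

lemma rpow_natCast_sub_natCast {r : ℝ} (hr : 0 < r) (k N : ℕ) :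
    r ^ ((k : ℝ) - N) = r ^ k / r ^ N := by
  rw [Real.rpow_sub hr, Real.rpow_natCast, Real.rpow_natCast]

lemma rpow_two_sub_natCast {r : ℝ} (hr : 0 < r) (N : ℕ) :
    r ^ ((2 : ℝ) - N) = r ^ 2 / r ^ N := by
  exact_mod_cast rpow_natCast_sub_natCast hr 2 N

lemma rpow_one_sub_natCast {r : ℝ} (hr : 0 < r) (N : ℕ) :
    r ^ ((1 : ℝ) - N) = r / r ^ N := by
  simpa using rpow_natCast_sub_natCast hr 1 N

/-- The integral of a radial function over the open unit ball in polar coordinates. -/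
lemma setIntegral_ball_fun_norm {N : ℕ} (hN : 0 < N) (f : ℝ → ℝ) :
    ∫ x in Metric.ball (0 : EuclideanSpace ℝ (Fin N)) 1, f ‖x‖
      = N * (volume (Metric.ball (0 : EuclideanSpace ℝ (Fin N)) 1)).toReal
        * ∫ r in (0 : ℝ)..1, r ^ (N - 1) * f r := by
  have : Nonempty (Fin N) := ⟨⟨0, hN⟩⟩
  have h := integral_fun_norm_addHaar (volume : Measure (EuclideanSpace ℝ (Fin N)))
    ((Iio (1 : ℝ)).indicator f)
  have hball : (fun x : EuclideanSpace ℝ (Fin N) => (Iio (1 : ℝ)).indicator f ‖x‖)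
      = (Metric.ball 0 1).indicator fun x => f ‖x‖ := by
    funext x
    simp [indicator]
  have hind : (fun r : ℝ => r ^ (N - 1) • (Iio (1 : ℝ)).indicator f r)
      = (Iio (1 : ℝ)).indicator fun r => r ^ (N - 1) * f r := by
    funext r
    simp [indicator]
  rw [hball, integral_indicator measurableSet_ball, finrank_euclideanSpace_fin, hind,
    setIntegral_indicator measurableSet_Iio, Ioi_inter_Iio, ← integral_Ioc_eq_integral_Ioo,
    ← intervalIntegral.integral_of_le zero_le_one] at h
  rw [h, nsmul_eq_mul, smul_eq_mul, mul_assoc]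
  rfl

lemma norm_gradient_comp_norm {E : Type*} [NormedAddCommGroup E] [InnerProductSpace ℝ E]
    [CompleteSpace E] {f : ℝ → ℝ} {c : ℝ} {x : E} (hx : x ≠ 0) (hf : HasDerivAt f c ‖x‖) :
    ‖gradient (fun y => f ‖y‖) x‖ = |c| := by
  have hd : DifferentiableAt ℝ (fun y : E => ‖y‖) x := differentiableAt_id.norm ℝ hx
  have h := hf.comp_hasFDerivAt x hd.hasFDerivAt
  have : Nontrivial E := ⟨x, 0, hx⟩
  have h' : fderiv ℝ (fun y => f ‖y‖) x = c • fderiv ℝ (fun y : E => ‖y‖) x := h.fderiv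
  rw [gradient, LinearIsometryEquiv.norm_map, h', norm_smul, norm_fderiv_norm hd, mul_one,
    Real.norm_eq_abs]

/-- The explicit profile, written in terms of the nodal radius `a`. -/
noncomputable def nodalProfile (N : ℕ) (a r : ℝ) : ℝ :=
  if r ≤ a then (a ^ 2 - r ^ 2) / (2 * N)
  else (1 / (2 * (N : ℝ))) * ((2 / ((N : ℝ) - 2)) * r ^ ((2 : ℝ) - N) + r ^ 2
    - a ^ 2 * ((N : ℝ) + 2) / ((N : ℝ) - 2))

/-- The derivative of `nodalProfile`. -/
noncomputable def nodalProfileDeriv (N : ℕ) (a r : ℝ) : ℝ :=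
  if r ≤ a then -r / N else (r - r ^ ((1 : ℝ) - N)) / N

section

variable {N : ℕ} {a : ℝ}

lemma hasDerivAt_nodalProfile (hN : 3 ≤ N) (ha0 : 0 < a) (haN : a ^ N = 1 / 2) (r : ℝ) :
    HasDerivAt (nodalProfile N a) (nodalProfileDeriv N a r) r := by
  have hN' : (3 : ℝ) ≤ N := by exact_mod_cast hN
  have h0 : (N : ℝ) ≠ 0 := by positivity
  have h2 : (N : ℝ) - 2 ≠ 0 := by linarith
  refine hasDerivAt_ite_le (f := fun r => (a ^ 2 - r ^ 2) / (2 * N)) (f' := fun r => -r / N)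
    (g := fun r => (1 / (2 * (N : ℝ))) * ((2 / ((N : ℝ) - 2)) * r ^ ((2 : ℝ) - N) + r ^ 2
      - a ^ 2 * ((N : ℝ) + 2) / ((N : ℝ) - 2)))
    (g' := fun r => (r - r ^ ((1 : ℝ) - N)) / N) (fun r _ => ?_) (fun r hr => ?_) ?_ ?_ r
  · convert! ((hasDerivAt_pow 2 r).const_sub (a ^ 2)).div_const (2 * (N : ℝ)) using 1
    field_simp
    simp [mul_comm]
  · have hr0 : 0 < r := ha0.trans_le hr
    convert! ((((Real.hasDerivAt_rpow_const (p := (2 : ℝ) - N) (Or.inl hr0.ne')).const_mul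
      (2 / ((N : ℝ) - 2))).add (hasDerivAt_pow 2 r)).sub_const
        (a ^ 2 * ((N : ℝ) + 2) / ((N : ℝ) - 2))).const_mul (1 / (2 * (N : ℝ))) using 1
    rw [show (2 : ℝ) - N - 1 = 1 - N by ring]
    field_simp
    push_cast
    ring
  · rw [rpow_two_sub_natCast ha0, haN]
    field_simp
    ring
  · rw [rpow_one_sub_natCast ha0, haN]
    field_simp
    ring

lemma continuousOn_nodalProfileDeriv (ha0 : 0 < a) (haN : a ^ N = 1 / 2) :
    ContinuousOn (nodalProfileDeriv N a) (Icc 0 1) := by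
  have h1 : ContinuousOn (fun r : ℝ => -r / (N : ℝ)) (Icc 0 a) := by fun_prop
  have h2 : ContinuousOn (fun r : ℝ => (r - r ^ ((1 : ℝ) - N)) / (N : ℝ)) (Ici a) := by
    refine (continuousOn_id.sub (continuousOn_id.rpow_const fun r hr => Or.inl ?_)).div_const _
    exact (ha0.trans_le hr).ne'
  refine ContinuousOn.if (p := fun r => r ≤ a) ?_ ?_ ?_
  · rintro r ⟨-, hr⟩
    have : r = a := by
      have := frontier_Iic_subset a hr
      simpa using this
    rw [this, rpow_one_sub_natCast ha0, haN]
    ring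
  · refine Continuous.continuousOn (by fun_prop)
  · refine h2.mono ?_
    rintro r ⟨-, hr⟩
    have : closure {r : ℝ | ¬ r ≤ a} ⊆ Ici a := by
      simp only [not_le]
      exact closure_minimal (fun r hr => mem_Ici.2 (le_of_lt hr)) isClosed_Ici
    exact this hr

lemma nodalProfile_radial_ode (hN : 3 ≤ N) {r : ℝ} (hr0 : 0 < r) (hra : r ≠ a) :
    ∃ d : ℝ, HasDerivAt (nodalProfileDeriv N a) d r ∧
      d + (((N : ℝ) - 1) / r) * nodalProfileDeriv N a r + (if r < a then 1 else -1) = 0 := by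
  have h0 : (N : ℝ) ≠ 0 := by positivity
  rcases lt_or_gt_of_ne hra with h | h
  · refine ⟨-1 / N, ((hasDerivAt_id r).neg.div_const (N : ℝ)).congr_of_eventuallyEq ?_, ?_⟩
    · filter_upwards [Iio_mem_nhds h] with s hs
      exact if_pos (le_of_lt hs)
    · rw [nodalProfileDeriv, if_pos h.le, if_pos h]
      field_simp
      ring
  · refine ⟨(1 - (1 - N) * r ^ ((1 : ℝ) - N - 1)) / N, (((hasDerivAt_id r).sub
      (Real.hasDerivAt_rpow_const (Or.inl hr0.ne'))).div_const (N : ℝ)).congr_of_eventuallyEq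
        ?_, ?_⟩
    · filter_upwards [Ioi_mem_nhds h] with s hs
      exact if_neg (not_le_of_gt hs)
    · rw [nodalProfileDeriv, if_neg h.not_ge, if_neg h.not_gt, Real.rpow_sub_one hr0.ne']
      field_simp
      ring

lemma nodalProfile_pos (hN : 3 ≤ N) {r : ℝ} (hr : 0 ≤ r) (hra : r < a) :
    0 < nodalProfile N a r := by
  have h0 : (0 : ℝ) < N := by positivity
  rw [nodalProfile, if_pos hra.le]
  have : r ^ 2 < a ^ 2 := by gcongr
  exact div_pos (by linarith) (by linarith)

lemma nodalProfile_self : nodalProfile N a a = 0 := by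
  simp [nodalProfile]

lemma nodalProfile_neg (hN : 3 ≤ N) (ha0 : 0 < a) (haN : a ^ N = 1 / 2) {r : ℝ} (har : a < r)
    (hr : r ≤ 1) : nodalProfile N a r < 0 := by
  have h0 : (0 : ℝ) < N := by positivity
  have hN' : (3 : ℝ) ≤ N := by exact_mod_cast hN
  have hanti : StrictAntiOn (nodalProfile N a) (Icc a 1) := by
    refine strictAntiOn_of_deriv_neg (convex_Icc a 1)
      (fun s _ => (hasDerivAt_nodalProfile hN ha0 haN s).continuousAt.continuousWithinAt) ?_
    intro s hs
    rw [interior_Icc] at hs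
    rw [(hasDerivAt_nodalProfile hN ha0 haN s).deriv, nodalProfileDeriv, if_neg hs.1.not_ge]
    have : s < s ^ ((1 : ℝ) - N) := by
      simpa using Real.rpow_lt_rpow_of_exponent_gt (ha0.trans hs.1) hs.2
        (show (1 : ℝ) - N < 1 by linarith)
    exact div_neg_of_neg_of_pos (by linarith) h0
  simpa [nodalProfile_self] using
    hanti (left_mem_Icc.2 (har.le.trans hr)) ⟨har.le, hr⟩ har

lemma integral_abs_nodalProfile (hN : 3 ≤ N) (ha0 : 0 < a) (ha1 : a < 1) (haN : a ^ N = 1 / 2) :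
    ∫ r in (0 : ℝ)..1, r ^ (N - 1) * |nodalProfile N a r|
      = ((a ^ 2 - 1) * N + 2 * a ^ 2) / (((N : ℝ) - 2) * (N + 2)) / N := by
  obtain ⟨m, rfl⟩ : ∃ m, N = m + 1 := ⟨N - 1, by omega⟩
  have hm : (2 : ℝ) ≤ m := by exact_mod_cast (by omega : 2 ≤ m)
  have hm1 : (m : ℝ) - 1 ≠ 0 := by linarith
  have hcont : Continuous fun r => r ^ (m + 1 - 1) * |nodalProfile (m + 1) a r| :=
    (continuous_pow _).mul (continuous_iff_continuousAt.2
      fun s => (hasDerivAt_nodalProfile hN ha0 haN s).continuousAt).abs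
  have hleft : ∫ r in (0 : ℝ)..a, r ^ (m + 1 - 1) * |nodalProfile (m + 1) a r|
      = ∫ r in (0 : ℝ)..a, (a ^ 2 / (2 * (m + 1)) * r ^ m - 1 / (2 * (m + 1)) * r ^ (m + 2)) := by
    refine intervalIntegral.integral_congr fun r hr => ?_
    rw [uIcc_of_le ha0.le] at hr
    have hnn : 0 ≤ nodalProfile (m + 1) a r := by
      rcases hr.2.eq_or_lt with rfl | h
      · exact nodalProfile_self.ge
      · exact (nodalProfile_pos hN hr.1 h).le
    simp only [abs_of_nonneg hnn]
    rw [nodalProfile, if_pos hr.2]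
    push_cast
    ring
  have hright : ∫ r in a..1, r ^ (m + 1 - 1) * |nodalProfile (m + 1) a r|
      = ∫ r in a..1, (a ^ 2 * (m + 3) / ((m - 1) * (2 * (m + 1))) * r ^ m
        - 1 / (2 * (m + 1)) * r ^ (m + 2) - 1 / ((m - 1) * (m + 1)) * r ^ 1) := by
    refine intervalIntegral.integral_congr fun r hr => ?_
    rw [uIcc_of_le ha1.le] at hr
    have hr0 : 0 < r := ha0.trans_le hr.1
    rcases hr.1.eq_or_lt with rfl | h
    · simp only [nodalProfile_self, abs_zero, mul_zero]
      have h' : a ^ m = 1 / (2 * a) := by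
        rw [pow_succ] at haN
        field_simp
        linarith
      rw [pow_add, h']
      field_simp
      ring
    · simp only [abs_of_neg (nodalProfile_neg hN ha0 haN h hr.2)]
      rw [nodalProfile, if_neg h.not_ge, rpow_two_sub_natCast hr0]
      push_cast
      rw [show (m : ℝ) + 1 - 2 = m - 1 by ring]
      field_simp
      ring
  rw [← intervalIntegral.integral_add_adjacent_intervals (hcont.intervalIntegrable 0 a)
    (hcont.intervalIntegrable a 1), hleft, hright]
  rw [intervalIntegral.integral_sub, intervalIntegral.integral_sub, intervalIntegral.integral_sub]
  · simp only [intervalIntegral.integral_const_mul, integral_pow, one_pow]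
    have h3 : a ^ (m + 2 + 1) = a ^ 2 / 2 := by
      rw [show m + 2 + 1 = (m + 1) + 2 by ring, pow_add, haN]
      ring
    rw [haN, h3, zero_pow (by omega), zero_pow (by omega)]
    push_cast
    rw [show (m : ℝ) + 1 - 2 = m - 1 by ring]
    field_simp
    ring
  all_goals exact Continuous.intervalIntegrable (by fun_prop) _ _

lemma integral_sq_nodalProfileDeriv (hN : 3 ≤ N) (ha0 : 0 < a) (ha1 : a < 1)
    (haN : a ^ N = 1 / 2) :
    ∫ r in (0 : ℝ)..1, r ^ (N - 1) * nodalProfileDeriv N a r ^ 2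
      = ((a ^ 2 - 1) * N + 2 * a ^ 2) / (((N : ℝ) - 2) * (N + 2)) / N := by
  have hcont : ContinuousOn (fun r => r ^ (N - 1) * nodalProfileDeriv N a r ^ 2) (Icc 0 1) :=
    (continuous_pow _).continuousOn.mul ((continuousOn_nodalProfileDeriv ha0 haN).pow 2)
  have hint1 : IntervalIntegrable (fun r => r ^ (N - 1) * nodalProfileDeriv N a r ^ 2)
      volume 0 a := (hcont.mono (Icc_subset_Icc_right ha1.le)).intervalIntegrable_of_Icc ha0.le
  have hint2 : IntervalIntegrable (fun r => r ^ (N - 1) * nodalProfileDeriv N a r ^ 2)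
      volume a 1 := (hcont.mono (Icc_subset_Icc_left ha0.le)).intervalIntegrable_of_Icc ha1.le
  obtain ⟨m, rfl⟩ : ∃ m, N = m + 1 := ⟨N - 1, by omega⟩
  have hm : (2 : ℝ) ≤ m := by exact_mod_cast (by omega : 2 ≤ m)
  have hm1 : (m : ℝ) - 1 ≠ 0 := by linarith
  have hleft : ∫ r in (0 : ℝ)..a, r ^ (m + 1 - 1) * nodalProfileDeriv (m + 1) a r ^ 2
      = ∫ r in (0 : ℝ)..a, 1 / (m + 1) ^ 2 * r ^ (m + 2) := by
    refine intervalIntegral.integral_congr fun r hr => ?_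
    rw [uIcc_of_le ha0.le] at hr
    simp only [nodalProfileDeriv, if_pos hr.2]
    push_cast
    field_simp
    ring
  have h0 : (0 : ℝ) ∉ uIcc a 1 := by
    rw [uIcc_of_le ha1.le]
    exact fun h => h.1.not_gt ha0
  have hright : ∫ r in a..1, r ^ (m + 1 - 1) * nodalProfileDeriv (m + 1) a r ^ 2
      = ∫ r in a..1, 1 / (m + 1 : ℝ) ^ 2 * (r ^ (m + 2) - 2 * r ^ 1 + r ^ (-(m : ℝ))) := by
    refine intervalIntegral.integral_congr fun r hr => ?_
    rw [uIcc_of_le ha1.le] at hr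
    have hr0 : 0 < r := ha0.trans_le hr.1
    have hd : nodalProfileDeriv (m + 1) a r = (r - r / r ^ (m + 1)) / ((m + 1 : ℕ) : ℝ) := by
      rcases hr.1.eq_or_lt with rfl | h
      · rw [nodalProfileDeriv, if_pos le_rfl, haN]
        ring
      · rw [nodalProfileDeriv, if_neg h.not_ge, rpow_one_sub_natCast hr0]
    simp only [hd, Real.rpow_neg hr0.le, Real.rpow_natCast]
    push_cast
    field_simp
    ring
  rw [← intervalIntegral.integral_add_adjacent_intervals hint1 hint2, hleft, hright]
  simp only [intervalIntegral.integral_const_mul]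
  rw [intervalIntegral.integral_add, intervalIntegral.integral_sub]
  · rw [integral_rpow (Or.inr ⟨by linarith, h0⟩)]
    simp only [intervalIntegral.integral_const_mul, integral_pow, one_pow,
      Real.one_rpow]
    have h3 : a ^ (m + 2 + 1) = a ^ 2 / 2 := by
      rw [show m + 2 + 1 = (m + 1) + 2 by ring, pow_add, haN]
      ring
    have h4 : a ^ (-(m : ℝ) + 1) = 2 * a ^ 2 := by
      have := rpow_two_sub_natCast ha0 (m + 1)
      rw [haN] at this
      rw [show -(m : ℝ) + 1 = 2 - ((m + 1 : ℕ) : ℝ) by push_cast; ring, this]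
      ring
    rw [h3, h4, zero_pow (by omega)]
    push_cast
    rw [show (m : ℝ) + 1 - 2 = m - 1 by ring, show -(m : ℝ) + 1 = -(m - 1) by ring]
    field_simp
    ring
  · exact Continuous.intervalIntegrable (by fun_prop) _ _
  · exact Continuous.intervalIntegrable (by fun_prop) _ _
  · exact Continuous.intervalIntegrable (by fun_prop) _ _
  · exact intervalIntegral.intervalIntegrable_rpow (Or.inr h0)

lemma volume_ball_eq_half (ha0 : 0 < a) (haN : a ^ N = 1 / 2) :
    volume (Metric.ball (0 : EuclideanSpace ℝ (Fin N)) a)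
      = volume (Metric.ball (0 : EuclideanSpace ℝ (Fin N)) 1) / 2 := by
  rw [Measure.addHaar_ball_of_pos _ _ ha0, finrank_euclideanSpace_fin, haN, one_div,
    ENNReal.ofReal_inv_of_pos two_pos, ENNReal.ofReal_ofNat, ENNReal.div_eq_inv_mul]

lemma volume_ball_diff_closedBall_eq_half (hN : 0 < N) (ha0 : 0 < a) (ha1 : a < 1)
    (haN : a ^ N = 1 / 2) :
    volume (Metric.ball (0 : EuclideanSpace ℝ (Fin N)) 1 \ Metric.closedBall 0 a)
      = volume (Metric.ball (0 : EuclideanSpace ℝ (Fin N)) 1) / 2 := by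
  have : Nonempty (Fin N) := ⟨⟨0, hN⟩⟩
  rw [measure_sdiff (Metric.closedBall_subset_ball ha1)
    measurableSet_closedBall.nullMeasurableSet measure_closedBall_lt_top.ne,
    Measure.addHaar_closedBall_eq_addHaar_ball, volume_ball_eq_half ha0 haN]
  exact ENNReal.sub_half measure_ball_lt_top.ne

end

/-- Explicit description of the (up to sign unique) strictly monotone radial
solution of the Neumann problem `-Δu = sgn(u)` on the unit ball `B ⊆ ℝ^N`, `N ≥ 3`:
with `a = 2^{-1/N}`, the explicit piecewise function `u` is `C¹` on `[0,1]` with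
`u'(0) = u'(1) = 0`, is positive on `[0,a)`, vanishes at `a`, is negative on `(a,1]`,
solves the radial ODE away from `a`, its radial extension `U(x) = u(|x|)` satisfies
`λ({U > 0}) = λ({U < 0}) = ω_N/2` and
`∫_B |∇U|² = ∫_B |U| = ω_N((2^{-2/N}-1)N + 2^{1-2/N})/((N-2)(N+2))`; in particular
`(1/2)∫_B |∇U|² - ∫_B |U| = -(ω_N/2)((2^{-2/N}-1)N + 2^{1-2/N})/((N-2)(N+2))`. -/
theorem statement14 (N : ℕ) (hN : 3 ≤ N)
    (a : ℝ) (ha : a = (2 : ℝ) ^ (-(1 / (N : ℝ))))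
    (u : ℝ → ℝ)
    (hu : ∀ r : ℝ, u r = if r ≤ a then (a ^ 2 - r ^ 2) / (2 * N)
      else (1 / (2 * (N : ℝ))) * ((2 / ((N : ℝ) - 2)) * r ^ ((2 : ℝ) - N) + r ^ 2
        - (2 : ℝ) ^ (-(2 / (N : ℝ))) * ((N : ℝ) + 2) / ((N : ℝ) - 2)))
    (U : EuclideanSpace ℝ (Fin N) → ℝ) (hU : ∀ x, U x = u ‖x‖)
    (B : Set (EuclideanSpace ℝ (Fin N))) (hB : B = Metric.ball 0 1)
    (ωN : ℝ) (hω : ωN = (volume B).toReal) :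
    (∃ u' : ℝ → ℝ, ContinuousOn u' (Icc 0 1)
      ∧ (∀ r ∈ Icc (0 : ℝ) 1, HasDerivWithinAt u (u' r) (Icc 0 1) r)
      ∧ u' 0 = 0 ∧ u' 1 = 0
      ∧ (∀ r ∈ Ioc (0 : ℝ) 1, r ≠ a → ∃ d : ℝ, HasDerivAt u' d r ∧
          d + (((N : ℝ) - 1) / r) * u' r + Real.sign (u r) = 0))
    ∧ (∀ r : ℝ, 0 ≤ r → r < a → 0 < u r) ∧ u a = 0 ∧ (∀ r : ℝ, a < r → r ≤ 1 → u r < 0)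
    ∧ volume {x ∈ B | 0 < U x} = volume B / 2
    ∧ volume {x ∈ B | U x < 0} = volume B / 2
    ∧ (∫ x in B, ‖gradient U x‖ ^ 2)
        = ωN * (((2 : ℝ) ^ (-(2 / (N : ℝ))) - 1) * N + (2 : ℝ) ^ (1 - 2 / (N : ℝ)))
          / (((N : ℝ) - 2) * ((N : ℝ) + 2))
    ∧ (∫ x in B, |U x|)
        = ωN * (((2 : ℝ) ^ (-(2 / (N : ℝ))) - 1) * N + (2 : ℝ) ^ (1 - 2 / (N : ℝ)))
          / (((N : ℝ) - 2) * ((N : ℝ) + 2))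
    ∧ (1 / 2) * (∫ x in B, ‖gradient U x‖ ^ 2) - (∫ x in B, |U x|)
        = -(ωN / 2) * (((2 : ℝ) ^ (-(2 / (N : ℝ))) - 1) * N + (2 : ℝ) ^ (1 - 2 / (N : ℝ)))
          / (((N : ℝ) - 2) * ((N : ℝ) + 2)) := by
  have hN0 : (0 : ℝ) < N := by positivity
  have hN' : (3 : ℝ) ≤ N := by exact_mod_cast hN
  have ha0 : 0 < a := by rw [ha]; positivity
  have haN : a ^ N = 1 / 2 := by
    rw [ha, ← Real.rpow_natCast, ← Real.rpow_mul two_pos.le, neg_mul, one_div_mul_cancel hN0.ne',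
      Real.rpow_neg_one, one_div]
  have ha1 : a < 1 := by
    rw [ha]
    exact Real.rpow_lt_one_of_one_lt_of_neg one_lt_two (neg_neg_of_pos (by positivity))
  have ha2 : (2 : ℝ) ^ (-(2 / (N : ℝ))) = a ^ 2 := by
    rw [ha, ← Real.rpow_natCast, ← Real.rpow_mul two_pos.le]
    congr 1
    push_cast
    ring
  have ha3 : (2 : ℝ) ^ (1 - 2 / (N : ℝ)) = 2 * a ^ 2 := by
    rw [sub_eq_add_neg, Real.rpow_add two_pos, ha2, Real.rpow_one]
  obtain rfl : u = nodalProfile N a := by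
    funext r
    rw [hu, ha2, nodalProfile]
  obtain rfl : U = fun x => nodalProfile N a ‖x‖ := funext hU
  have hderiv := hasDerivAt_nodalProfile hN ha0 haN
  have hpos : ∀ r : ℝ, 0 ≤ r → r < a → 0 < nodalProfile N a r :=
    fun r h h' => nodalProfile_pos hN h h'
  have hneg : ∀ r : ℝ, a < r → r ≤ 1 → nodalProfile N a r < 0 :=
    fun r h h' => nodalProfile_neg hN ha0 haN h h'
  have : Nonempty (Fin N) := ⟨⟨0, by omega⟩⟩
  have hgrad : (∫ x in B, ‖gradient (fun x => nodalProfile N a ‖x‖) x‖ ^ 2)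
      = ωN * ((a ^ 2 - 1) * N + 2 * a ^ 2) / (((N : ℝ) - 2) * ((N : ℝ) + 2)) := by
    have hae : ∀ᵐ x : EuclideanSpace ℝ (Fin N), x ≠ 0 := by
      simp [ae_iff]
    have hcongr : (∫ x in B, ‖gradient (fun x => nodalProfile N a ‖x‖) x‖ ^ 2)
        = ∫ x in B, nodalProfileDeriv N a ‖x‖ ^ 2 := by
      refine integral_congr_ae (ae_restrict_of_ae ?_)
      filter_upwards [hae] with x hx
      rw [norm_gradient_comp_norm hx (hderiv ‖x‖), sq_abs]
    rw [hcongr, hω, hB, setIntegral_ball_fun_norm (by omega) fun r => nodalProfileDeriv N a r ^ 2,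
      integral_sq_nodalProfileDeriv hN ha0 ha1 haN]
    field_simp
  have habs : (∫ x in B, |nodalProfile N a ‖x‖|)
      = ωN * ((a ^ 2 - 1) * N + 2 * a ^ 2) / (((N : ℝ) - 2) * ((N : ℝ) + 2)) := by
    rw [hω, hB, setIntegral_ball_fun_norm (by omega) fun r => |nodalProfile N a r|,
      integral_abs_nodalProfile hN ha0 ha1 haN]
    field_simp
  rw [ha2, ha3]
  refine ⟨⟨nodalProfileDeriv N a, continuousOn_nodalProfileDeriv ha0 haN,
    fun r _ => (hderiv r).hasDerivWithinAt, ?_, ?_, ?_⟩, hpos, nodalProfile_self, hneg, ?_, ?_,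
    hgrad, habs, ?_⟩
  · simp [nodalProfileDeriv, ha0.le]
  · simp [nodalProfileDeriv, ha1]
  · intro r hr hra
    obtain ⟨d, hd, hode⟩ := nodalProfile_radial_ode hN hr.1 hra
    refine ⟨d, hd, ?_⟩
    rcases lt_or_gt_of_ne hra with h | h
    · rw [if_pos h] at hode
      rwa [Real.sign_of_pos (hpos r hr.1.le h)]
    · rw [if_neg h.not_gt] at hode
      rwa [Real.sign_of_neg (hneg r h hr.2)]
  · have hset : {x ∈ B | 0 < nodalProfile N a ‖x‖} = Metric.ball 0 a := by
      ext x
      simp only [hB, mem_ofPred_eq, mem_ball_zero_iff]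
      refine ⟨fun ⟨h1, h⟩ => ?_, fun h => ⟨h.trans ha1, hpos _ (norm_nonneg x) h⟩⟩
      by_contra! hle
      rcases hle.eq_or_lt with heq | hlt
      · rw [← heq, nodalProfile_self] at h
        exact h.false
      · exact (hneg _ hlt h1.le).not_gt h
    rw [hset, hB, volume_ball_eq_half ha0 haN]
  · have hset : {x ∈ B | nodalProfile N a ‖x‖ < 0} = Metric.ball 0 1 \ Metric.closedBall 0 a := by
      ext x
      simp only [hB, mem_ofPred_eq, mem_sdiff, mem_ball_zero_iff, mem_closedBall_zero_iff, not_le]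
      refine ⟨fun ⟨h1, h⟩ => ⟨h1, ?_⟩, fun ⟨h1, h⟩ => ⟨h1, hneg _ h h1.le⟩⟩
      by_contra! hle
      rcases hle.eq_or_lt with heq | hlt
      · rw [heq, nodalProfile_self] at h
        exact h.false
      · exact (hpos _ (norm_nonneg x) hlt).not_gt h
    rw [hset, hB, volume_ball_diff_closedBall_eq_half (by omega) ha0 ha1 haN]
  · rw [hgrad, habs]
    ring
end

section
/- Let N ≥ 3 be an integer, let B be the open unit ball of ℝ^N, and define v : B \ {0} → ℝ by v(x) = x₁/|x| (with v(0) = 0). Then ∫_B |v(x)| dx ≥ ω_N/N, ∫_B |∇v(x)|² dx = ω_N (N−1)/(N−2), and consequently ( ∫_B |v| dx )² / ( 2 ∫_B |∇v|² dx ) ≥ ω_N (N−2) / ( 2N²(N−1) ). -/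
open MeasureTheory Set

attribute [local instance] Classical.propDecidable

theorem setIntegral_ball_sq_mul_norm_eq {N : ℕ} (g : ℝ → ℝ) (i j : Fin N) :
    ∫ x in Metric.ball (0 : EuclideanSpace ℝ (Fin N)) 1, x i ^ 2 * g ‖x‖
      = ∫ x in Metric.ball (0 : EuclideanSpace ℝ (Fin N)) 1, x j ^ 2 * g ‖x‖ := by
  let L := LinearIsometryEquiv.piLpCongrLeft 2 ℝ ℝ (Equiv.swap i j)
  have h := L.measurePreserving.setIntegral_preimage_emb
    L.toMeasurableEquiv.measurableEmbedding (fun x => x i ^ 2 * g ‖x‖) (Metric.ball 0 1)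
  rw [← h]
  have hpre : L ⁻¹' Metric.ball 0 1 = Metric.ball 0 1 := by
    ext x; simp
  rw [hpre]
  simp [L]

theorem integrableOn_ball_sq_mul_norm {N : ℕ} {g : ℝ → ℝ} (hg : Measurable g)
    (hint : IntegrableOn (fun x : EuclideanSpace ℝ (Fin N) => ‖x‖ ^ 2 * g ‖x‖)
      (Metric.ball 0 1)) (i : Fin N) :
    IntegrableOn (fun x : EuclideanSpace ℝ (Fin N) => x i ^ 2 * g ‖x‖) (Metric.ball 0 1) := by
  refine hint.norm.mono' (by fun_prop) (.of_forall fun x => ?_)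
  have hxi : x i ^ 2 ≤ ‖x‖ ^ 2 := by
    simpa only [sq_abs, Real.norm_eq_abs] using
      pow_le_pow_left₀ (norm_nonneg _) (PiLp.norm_apply_le x i) 2
  rw [norm_mul, norm_mul, Real.norm_of_nonneg (sq_nonneg _), Real.norm_of_nonneg (sq_nonneg _)]
  gcongr

theorem setIntegral_ball_sq_mul_norm {N : ℕ} {g : ℝ → ℝ} (hg : Measurable g)
    (hint : IntegrableOn (fun x : EuclideanSpace ℝ (Fin N) => ‖x‖ ^ 2 * g ‖x‖)
      (Metric.ball 0 1)) (i : Fin N) :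
    N * ∫ x in Metric.ball (0 : EuclideanSpace ℝ (Fin N)) 1, x i ^ 2 * g ‖x‖
      = ∫ x in Metric.ball (0 : EuclideanSpace ℝ (Fin N)) 1, ‖x‖ ^ 2 * g ‖x‖ := by
  simp_rw [EuclideanSpace.real_norm_sq_eq, Finset.sum_mul]
  rw [integral_finsetSum _ fun j _ => integrableOn_ball_sq_mul_norm hg hint j]
  simp [setIntegral_ball_sq_mul_norm_eq g _ i]

theorem hasGradientAt_coord_div_norm {N : ℕ} (i : Fin N) {x : EuclideanSpace ℝ (Fin N)}
    (hx : x ≠ 0) :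
    HasGradientAt (fun y : EuclideanSpace ℝ (Fin N) => y i / ‖y‖)
      (‖x‖⁻¹ • EuclideanSpace.single i (1 : ℝ) - (x i * (‖x‖ ^ 3)⁻¹) • x) x := by
  rw [hasGradientAt_iff_hasFDerivAt]
  have hn : ‖x‖ ≠ 0 := norm_ne_zero_iff.2 hx
  have h1 : HasFDerivAt (fun y : EuclideanSpace ℝ (Fin N) => y i)
      (EuclideanSpace.proj i : EuclideanSpace ℝ (Fin N) →L[ℝ] ℝ) x :=
    (EuclideanSpace.proj i : EuclideanSpace ℝ (Fin N) →L[ℝ] ℝ).hasFDerivAt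
  have h2 := (hasStrictFDerivAt_norm_sq x).hasFDerivAt.sqrt (by positivity)
  simp only [Real.sqrt_sq (norm_nonneg _)] at h2
  have h3 := h1.mul ((hasDerivAt_inv hn).comp_hasFDerivAt x h2)
  simp only [div_eq_mul_inv]
  refine h3.congr_fderiv ?_
  ext y
  simp [EuclideanSpace.inner_single_left]
  field_simp
  ring

theorem norm_sq_gradient_coord_div_norm {N : ℕ} (i : Fin N) {x : EuclideanSpace ℝ (Fin N)}
    (hx : x ≠ 0) :
    ‖‖x‖⁻¹ • EuclideanSpace.single i (1 : ℝ) - (x i * (‖x‖ ^ 3)⁻¹) • x‖ ^ 2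
      = (‖x‖ ^ 2)⁻¹ - x i ^ 2 * (‖x‖ ^ 4)⁻¹ := by
  have hn : ‖x‖ ≠ 0 := norm_ne_zero_iff.2 hx
  rw [norm_sub_sq_real, inner_smul_left, inner_smul_right, EuclideanSpace.inner_single_left]
  simp [norm_smul, mul_pow]
  field_simp
  ring

theorem integrableOn_ball_inv_norm_sq {N : ℕ} (hN : 3 ≤ N) :
    IntegrableOn (fun x : EuclideanSpace ℝ (Fin N) => (‖x‖ ^ 2)⁻¹) (Metric.ball 0 1) ∧
    ∫ x in Metric.ball (0 : EuclideanSpace ℝ (Fin N)) 1, (‖x‖ ^ 2)⁻¹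
      = volume.real (Metric.ball (0 : EuclideanSpace ℝ (Fin N)) 1) * N / (N - 2) := by
  have hne : Nonempty (Fin N) := ⟨⟨0, by omega⟩⟩
  have hind : (Metric.ball (0 : EuclideanSpace ℝ (Fin N)) 1).indicator (fun x => (‖x‖ ^ 2)⁻¹)
      = fun x => (Iio (1 : ℝ)).indicator (fun r => (r ^ 2)⁻¹) ‖x‖ := by
    ext x; simp [indicator]
  have hrad : ∀ y ∈ Ioi (0 : ℝ), y ^ (N - 1) • (Iio (1 : ℝ)).indicator (fun r => (r ^ 2)⁻¹) y
      = (Iio (1 : ℝ)).indicator (fun r => r ^ (N - 3)) y := by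
    intro y hy
    simp only [indicator, smul_eq_mul]
    split_ifs
    · have : N - 1 = N - 3 + 2 := by omega
      rw [this, pow_add, mul_assoc, mul_inv_cancel₀ (pow_pos hy 2).ne', mul_one]
    · simp
  constructor
  · rw [← integrable_indicator_iff measurableSet_ball, hind, integrable_fun_norm_addHaar,
      finrank_euclideanSpace_fin, integrableOn_congr_fun hrad measurableSet_Ioi,
      IntegrableOn, integrable_indicator_iff measurableSet_Iio, IntegrableOn,
      Measure.restrict_restrict measurableSet_Iio, inter_comm, Ioi_inter_Iio]
    exact ((continuous_pow (N - 3)).integrableOn_Icc (a := 0) (b := 1)).mono_set Ioo_subset_Icc_self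
  · rw [← integral_indicator measurableSet_ball, hind, integral_fun_norm_addHaar,
      finrank_euclideanSpace_fin, setIntegral_congr_fun measurableSet_Ioi hrad,
      setIntegral_indicator measurableSet_Iio, Ioi_inter_Iio, ← integral_Ioc_eq_integral_Ioo,
      ← intervalIntegral.integral_of_le zero_le_one, integral_pow]
    have : ((N - 3 : ℕ) : ℝ) + 1 = N - 2 := by push_cast [hN]; ring
    rw [this]
    simp
    ring

theorem measure_ball_div_le_setIntegral_abs_coord_div_norm {N : ℕ} (i : Fin N) :
    volume.real (Metric.ball (0 : EuclideanSpace ℝ (Fin N)) 1) / N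
      ≤ ∫ x in Metric.ball (0 : EuclideanSpace ℝ (Fin N)) 1, |x i / ‖x‖| := by
  have hN : 0 < N := i.pos
  have hne : Nonempty (Fin N) := ⟨i⟩
  have hae : (fun x : EuclideanSpace ℝ (Fin N) => ‖x‖ ^ 2 * (‖x‖ ^ 2)⁻¹)
      =ᵐ[volume.restrict (Metric.ball 0 1)] fun _ => 1 := by
    filter_upwards [ae_restrict_of_ae (Measure.ae_ne volume 0)] with x hx
    exact mul_inv_cancel₀ (pow_ne_zero 2 (norm_ne_zero_iff.2 hx))
  have hone : IntegrableOn (fun _ : EuclideanSpace ℝ (Fin N) => (1 : ℝ)) (Metric.ball 0 1) :=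
    integrableOn_const measure_ball_lt_top.ne
  have hint := hone.congr hae.symm
  have hg : Measurable fun r : ℝ => (r ^ 2)⁻¹ := by fun_prop
  have hle (x : EuclideanSpace ℝ (Fin N)) : |x i / ‖x‖| ≤ 1 := by
    rw [abs_div, abs_norm]
    exact div_le_one_of_le₀ (PiLp.norm_apply_le x i) (norm_nonneg x)
  have hsum := setIntegral_ball_sq_mul_norm hg hint i
  rw [integral_congr_ae hae, setIntegral_const, smul_eq_mul, mul_one] at hsum
  rw [← hsum, mul_div_cancel_left₀ _ (by positivity)]
  refine integral_mono (integrableOn_ball_sq_mul_norm hg hint i)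
    (hone.mono' (Measurable.aestronglyMeasurable (by fun_prop)) (.of_forall fun x => by simpa using hle x)) fun x => ?_
  calc x i ^ 2 * (‖x‖ ^ 2)⁻¹ = |x i / ‖x‖| ^ 2 := by rw [sq_abs, div_pow, div_eq_mul_inv]
    _ ≤ |x i / ‖x‖| := pow_le_of_le_one (abs_nonneg _) (hle x) two_ne_zero

theorem setIntegral_ball_norm_sq_gradient_coord_div_norm {N : ℕ} (hN : 3 ≤ N) (i : Fin N) :
    ∫ x in Metric.ball (0 : EuclideanSpace ℝ (Fin N)) 1,
        ‖gradient (fun y : EuclideanSpace ℝ (Fin N) => y i / ‖y‖) x‖ ^ 2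
      = volume.real (Metric.ball (0 : EuclideanSpace ℝ (Fin N)) 1) * (N - 1) / (N - 2) := by
  have hne : Nonempty (Fin N) := ⟨i⟩
  obtain ⟨hint, hval⟩ := integrableOn_ball_inv_norm_sq hN
  have hg : Measurable fun r : ℝ => (r ^ 4)⁻¹ := by fun_prop
  have heq (x : EuclideanSpace ℝ (Fin N)) : ‖x‖ ^ 2 * (‖x‖ ^ 4)⁻¹ = (‖x‖ ^ 2)⁻¹ := by
    rcases eq_or_ne x 0 with rfl | hx
    · simp
    · have : ‖x‖ ≠ 0 := norm_ne_zero_iff.2 hx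
      field_simp
  have hint' : IntegrableOn (fun x : EuclideanSpace ℝ (Fin N) => ‖x‖ ^ 2 * (‖x‖ ^ 4)⁻¹)
      (Metric.ball 0 1) := by simpa only [heq] using hint
  have hsum := setIntegral_ball_sq_mul_norm hg hint' i
  simp only [heq, hval] at hsum
  have hae : (fun x => ‖gradient (fun y : EuclideanSpace ℝ (Fin N) => y i / ‖y‖) x‖ ^ 2)
      =ᵐ[volume.restrict (Metric.ball 0 1)]
        fun x => (‖x‖ ^ 2)⁻¹ - x i ^ 2 * (‖x‖ ^ 4)⁻¹ := by
    filter_upwards [ae_restrict_of_ae (Measure.ae_ne volume 0)] with x hx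
    rw [(hasGradientAt_coord_div_norm i hx).gradient, norm_sq_gradient_coord_div_norm i hx]
  rw [integral_congr_ae hae, integral_sub hint (integrableOn_ball_sq_mul_norm hg hint' i), hval]
  have hN0 : (N : ℝ) ≠ 0 := by positivity
  rw [eq_div_of_mul_eq hN0 ((mul_comm _ _).trans hsum)]
  have hN2 : (N : ℝ) - 2 ≠ 0 := by
    have : (3 : ℝ) ≤ N := by exact_mod_cast hN
    linarith
  field_simp

/-- For `N ≥ 3` and the test function `v(x) = x₁/|x|` on the unit ball `B` of
`ℝ^N`, one has `∫_B |v| ≥ ω_N/N`, `∫_B |∇v|² = ω_N(N-1)/(N-2)`, and consequently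
`(∫_B |v|)²/(2∫_B |∇v|²) ≥ ω_N(N-2)/(2N²(N-1))`. -/
theorem statement15 (N : ℕ) (hN : 3 ≤ N)
    (B : Set (EuclideanSpace ℝ (Fin N))) (hB : B = Metric.ball 0 1)
    (v : EuclideanSpace ℝ (Fin N) → ℝ)
    (hv : ∀ x, v x = if x = 0 then 0 else x ⟨0, by omega⟩ / ‖x‖)
    (ωN : ℝ) (hω : ωN = (volume B).toReal) :
    ωN / N ≤ (∫ x in B, |v x|)
    ∧ (∫ x in B, ‖gradient v x‖ ^ 2) = ωN * ((N : ℝ) - 1) / ((N : ℝ) - 2)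
    ∧ ωN * ((N : ℝ) - 2) / (2 * (N : ℝ) ^ 2 * ((N : ℝ) - 1))
        ≤ (∫ x in B, |v x|) ^ 2 / (2 * ∫ x in B, ‖gradient v x‖ ^ 2) := by
  have hN0 : (N : ℝ) ≠ 0 := by positivity
  have hN2 : (0 : ℝ) < N - 2 := by
    have : (3 : ℝ) ≤ N := by exact_mod_cast hN
    linarith
  have hv' : v = fun x => x ⟨0, by omega⟩ / ‖x‖ := by
    ext x
    rw [hv]
    split_ifs with hx
    · simp [hx]
    · rfl
  have hωpos : 0 < ωN := by
    rw [hω, hB]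
    exact ENNReal.toReal_pos (Metric.measure_ball_pos _ _ one_pos).ne' measure_ball_lt_top.ne
  have habs : ωN / N ≤ ∫ x in B, |v x| := by
    rw [hω, hB, hv']
    exact measure_ball_div_le_setIntegral_abs_coord_div_norm _
  have hgrad : ∫ x in B, ‖gradient v x‖ ^ 2 = ωN * ((N : ℝ) - 1) / ((N : ℝ) - 2) := by
    rw [hω, hB, hv']
    exact setIntegral_ball_norm_sq_gradient_coord_div_norm hN _
  refine ⟨habs, hgrad, ?_⟩
  rw [hgrad]
  have hN1 : (0 : ℝ) < N - 1 := by linarith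
  calc ωN * ((N : ℝ) - 2) / (2 * (N : ℝ) ^ 2 * ((N : ℝ) - 1))
      = (ωN / N) ^ 2 / (2 * (ωN * ((N : ℝ) - 1) / ((N : ℝ) - 2))) := by field_simp
    _ ≤ _ := by gcongr
end
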